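/- arXiv:2407.10665 — 3 statements merged into one kernel-verified Lean document; each statement's English description precedes it below -/
import Mathlib

section
/- Let Ω ⊆ ℝ^d be a nonempty open set, V ∈ C^∞(Ω, ℂ), x ∈ Ω and r ∈ (0,1) with B(x,r) ⊆ Ω. Then for every ε > 0 there is a constant C > 0, depending only on d, r, ε, the potential V and the point x, such that for every λ ∈ ℂ with Re λ ≥ 1 and every smooth solution ψ_λ of (−Δ + V)ψ_λ = λψ_λ on Ω one has |ψ_λ(x)| ≤ C (Re λ)^{(d−1)/4 + ε} ‖ψ_λ‖_{L²(B(x,r))}. -/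
open MeasureTheory Metric Complex Finset ENNReal NNReal

noncomputable section

variable {d : ℕ}

/-- Euclidean space ℝ^d. -/
abbrev Euc (d : ℕ) := EuclideanSpace ℝ (Fin d)

/-- Partial derivative in coordinate direction `j`. -/
def pd (j : Fin d) (f : Euc d → ℂ) : Euc d → ℂ :=
  fun x => fderiv ℝ f x (EuclideanSpace.single j 1)

/-- The operator `D^γ = (−i∂₁)^{γ₁} ⋯ (−i∂_d)^{γ_d}`. -/
def Dpow (γ : Fin d → ℕ) (f : Euc d → ℂ) : Euc d → ℂ :=
  fun x => (-Complex.I) ^ (∑ j, γ j) *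
    ((List.finRange d).foldr (fun j g => (pd j)^[γ j] g) f) x

/-- The `L²` norm of `f` on the set `s` (valued in `ℝ≥0∞`). -/
def L2 (f : Euc d → ℂ) (s : Set (Euc d)) : ℝ≥0∞ := eLpNorm f 2 (volume.restrict s)

/-- Euclidean norm of an integer vector `ξ ∈ ℤ^d`. -/
def znorm (ξ : Fin d → ℤ) : ℝ := Real.sqrt (∑ j, ((ξ j : ℝ)) ^ 2)

/-- Embedding of `ℤ^d` into `ℝ^d`. -/
def zcoe (ξ : Fin d → ℤ) : Euc d := (WithLp.equiv 2 (Fin d → ℝ)).symm (fun j => (ξ j : ℝ))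

/-- The symbol `P(ξ)` of a constant coefficient operator, evaluated at real `ξ`. -/
def symbR (P : MvPolynomial (Fin d) ℂ) (ξ : Euc d) : ℂ :=
  MvPolynomial.eval (fun j => (ξ j : ℂ)) P

/-- The symbol `P(ξ)` evaluated at an integer lattice point. -/
def symbZ (P : MvPolynomial (Fin d) ℂ) (ξ : Fin d → ℤ) : ℂ :=
  MvPolynomial.eval (fun j => ((ξ j : ℤ) : ℂ)) P

/-- The constant coefficient differential operator `H = Σ_{α} c_α D^α` with symbol `P`. -/
def toOp (P : MvPolynomial (Fin d) ℂ) (f : Euc d → ℂ) : Euc d → ℂ :=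
  fun x => ∑ α ∈ P.support, P.coeff α * Dpow (fun j => α j) f x

/-- The axis-parallel cube of side length `2π` centered at `x₀`. -/
def cube (x₀ : Euc d) : Set (Euc d) :=
  {y | ∀ j, y j ∈ Set.Icc (x₀ j - Real.pi) (x₀ j + Real.pi)}

/-- The smooth cutoff of `ψ`: `x ↦ χ((x−x₀)/r) ψ(x)`. -/
def cutoffFn (χ : Euc d → ℝ) (x₀ : Euc d) (r : ℝ) (ψ : Euc d → ℂ) : Euc d → ℂ :=
  fun x => (χ (r⁻¹ • (x - x₀)) : ℂ) * ψ x

/-- The `2πℤ^d`-periodization of a function `F : ℝ^d → ℂ`. -/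
def perFn (F : Euc d → ℂ) : Euc d → ℂ :=
  fun x => ∑' k : Fin d → ℤ,
    F (x - (WithLp.equiv 2 (Fin d → ℝ)).symm (fun j => 2 * Real.pi * (k j : ℝ)))

/-- Fourier coefficient (w.r.t. the cube of side `2π` centered at `x₀`):
`Ĝ(ξ) = (2π)^{-d} ∫_{cube} G(x) e^{-i⟨ξ,x⟩} dx`. -/
def fCoeff (x₀ : Euc d) (G : Euc d → ℂ) (ξ : Fin d → ℤ) : ℂ :=
  ((2 * Real.pi) ^ d : ℝ)⁻¹ *
    ∫ x in cube x₀, G x * Complex.exp (-Complex.I * ((∑ j, (ξ j : ℝ) * x j : ℝ) : ℂ))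

/-- The Fourier coefficients `Ψ̂(ξ)` of the periodized cutoff `Ψ` of `ψ`. -/
def PsiHat (χ : Euc d → ℝ) (x₀ : Euc d) (r : ℝ) (ψ : Euc d → ℂ) (ξ : Fin d → ℤ) : ℂ :=
  fCoeff x₀ (perFn (cutoffFn χ x₀ r ψ)) ξ


/-- Test functions on the set `B`. -/
structure GoodFn (B : Set (Euc d)) (η : Euc d → ℂ) : Prop where
  smooth : ContDiff ℝ (⊤ : ℕ∞) η
  cpt : HasCompactSupport η
  sub : tsupport η ⊆ B

/-- The plane wave. -/
def ex (ζ : Euc d) : Euc d → ℂ := fun y => Complex.exp (((inner ℝ ζ y : ℝ) : ℂ) * Complex.I)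

lemma ex_smooth (ζ : Euc d) : ContDiff ℝ (⊤ : ℕ∞) (ex ζ) := by
  unfold ex
  have h : ContDiff ℝ (⊤ : ℕ∞) (fun y : Euc d => ((inner ℝ ζ y : ℝ) : ℂ)) :=
    Complex.ofRealCLM.contDiff.comp (contDiff_const.inner ℝ contDiff_id)
  exact (h.mul contDiff_const).cexp

lemma ex_norm (ζ y : Euc d) : ‖ex ζ y‖ = 1 := by
  unfold ex
  exact Complex.norm_exp_ofReal_mul_I _

lemma smooth_mul {B : Set (Euc d)} (hB : IsOpen B) {f η : Euc d → ℂ}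
    (hf : ContDiffOn ℝ (⊤ : ℕ∞) f B) (hη : GoodFn B η) : GoodFn B (fun y => f y * η y) := by
  refine ⟨?_, hη.cpt.mul_left, (tsupport_mul_subset_right).trans hη.sub⟩
  rw [contDiff_iff_contDiffAt]
  intro y
  by_cases hy : y ∈ tsupport η
  · exact (hf.contDiffAt (hB.mem_nhds (hη.sub hy))).mul hη.smooth.contDiffAt
  · have h0 : (fun y => f y * η y) =ᶠ[nhds y] fun _ => 0 := by
      filter_upwards [(isClosed_tsupport η).isOpen_compl.mem_nhds hy] with z hz
      rw [image_eq_zero_of_notMem_tsupport hz, mul_zero]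
    exact contDiffAt_const.congr_of_eventuallyEq h0

lemma GoodFn.integrable {B : Set (Euc d)} {η : Euc d → ℂ} (h : GoodFn B η) : Integrable η :=
  h.smooth.continuous.integrable_of_hasCompactSupport h.cpt

lemma GoodFn.zero {B : Set (Euc d)} : GoodFn B (fun _ => (0:ℂ)) :=
  ⟨contDiff_const, HasCompactSupport.zero, by
    have : tsupport (fun _ : Euc d => (0:ℂ)) = ∅ := by
      rw [tsupport_eq_empty_iff]; rfl
    rw [this]; exact Set.empty_subset _⟩

lemma GoodFn.add {B : Set (Euc d)} {η θ : Euc d → ℂ} (h : GoodFn B η) (h' : GoodFn B θ) :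
    GoodFn B (fun y => η y + θ y) :=
  ⟨h.smooth.add h'.smooth, h.cpt.add h'.cpt,
    (tsupport_add η θ).trans (Set.union_subset h.sub h'.sub)⟩

lemma GoodFn.smul {B : Set (Euc d)} (hB : IsOpen B) {η : Euc d → ℂ} (h : GoodFn B η) (c : ℂ) :
    GoodFn B (fun y => c * η y) := smooth_mul hB contDiffOn_const h

lemma GoodFn.sum {B : Set (Euc d)} {ι : Type*} (s : Finset ι) {η : ι → Euc d → ℂ}
    (h : ∀ i, GoodFn B (η i)) : GoodFn B (fun y => ∑ i ∈ s, η i y) := by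
  classical
  induction s using Finset.induction_on with
  | empty => simpa using GoodFn.zero
  | insert a s ha ih =>
    simp only [Finset.sum_insert ha]
    exact (h a).add ih

lemma GoodFn.ex {B : Set (Euc d)} (hB : IsOpen B) {η : Euc d → ℂ} (h : GoodFn B η) (ζ : Euc d) :
    GoodFn B (fun y => η y * ex ζ y) := by
  have := smooth_mul hB (ex_smooth ζ).contDiffOn h
  simpa only [mul_comm] using this

lemma pd_smoothOn {B : Set (Euc d)} (hB : IsOpen B) {f : Euc d → ℂ}
    (hf : ContDiffOn ℝ (⊤ : ℕ∞) f B) (j : Fin d) : ContDiffOn ℝ (⊤ : ℕ∞) (pd j f) B := by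
  unfold pd
  exact (hf.fderiv_of_isOpen hB (by simp)).clm_apply contDiffOn_const

lemma pd_smooth {f : Euc d → ℂ}
    (hf : ContDiff ℝ (⊤ : ℕ∞) f) (j : Fin d) : ContDiff ℝ (⊤ : ℕ∞) (pd j f) := by
  unfold pd
  exact (hf.fderiv_right (by simp)).clm_apply contDiff_const

lemma GoodFn.pd {B : Set (Euc d)} {η : Euc d → ℂ} (h : GoodFn B η) (j : Fin d) :
    GoodFn B (pd j η) :=
  ⟨pd_smooth h.smooth j, h.cpt.fderiv_apply ℝ _,
    (tsupport_fderiv_apply_subset ℝ _).trans h.sub⟩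

lemma ibp {B : Set (Euc d)} (hB : IsOpen B) {f η : Euc d → ℂ}
    (hf : ContDiffOn ℝ (⊤ : ℕ∞) f B) (hη : GoodFn B η) (j : Fin d) :
    ∫ y, f y * pd j η y = - ∫ y, pd j f y * η y := by
  unfold pd
  refine integral_mul_fderiv_eq_neg_fderiv_mul_of_integrable
    (smooth_mul hB (pd_smoothOn hB hf j) hη).integrable
    (smooth_mul hB hf (hη.pd j)).integrable (smooth_mul hB hf hη).integrable ?_ ?_
  · intro y hy
    exact (hf.contDiffAt (hB.mem_nhds (hη.sub hy))).differentiableAt (by simp)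
  · intro y _
    exact hη.smooth.contDiffAt.differentiableAt (by simp)

lemma green {B : Set (Euc d)} (hB : IsOpen B) {f η : Euc d → ℂ}
    (hf : ContDiffOn ℝ (⊤ : ℕ∞) f B) (hη : GoodFn B η) (j : Fin d) :
    ∫ y, pd j (pd j f) y * η y = ∫ y, f y * pd j (pd j η) y := by
  have h1 := ibp hB (pd_smoothOn hB hf j) hη j
  have h2 := ibp hB hf (hη.pd j) j
  rw [h2, h1, neg_neg]

lemma pd_ex (ζ : Euc d) (j : Fin d) (y : Euc d) : pd j (ex ζ) y = (ζ j * Complex.I) * ex ζ y := by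
  unfold pd
  have h : HasFDerivAt (fun y : Euc d => (((inner ℝ ζ y : ℝ) : ℂ) * Complex.I))
      ((Complex.ofRealCLM.comp (innerSL ℝ ζ)).smulRight Complex.I) y := by
    have := ((Complex.ofRealCLM.comp (innerSL ℝ ζ)).smulRight Complex.I).hasFDerivAt (x := y)
    exact this
  have h2 := h.cexp
  have : HasFDerivAt (ex ζ) _ y := h2
  rw [this.fderiv]
  simp [ex, EuclideanSpace.inner_single_right]
  ring

lemma pd_mul {f g : Euc d → ℂ} {y : Euc d} (hf : DifferentiableAt ℝ f y)
    (hg : DifferentiableAt ℝ g y) (j : Fin d) :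
    pd j (fun z => f z * g z) y = f y * pd j g y + pd j f y * g y := by
  unfold pd
  rw [fderiv_fun_mul hf hg]
  simp
  ring

lemma pd_mul_ex {η : Euc d → ℂ} (h : ContDiff ℝ (⊤ : ℕ∞) η) (ζ : Euc d) (j : Fin d) :
    pd j (fun z => η z * ex ζ z) = fun y => (pd j η y + ζ j * Complex.I * η y) * ex ζ y := by
  funext y
  rw [pd_mul (h.contDiffAt.differentiableAt (by simp))
    ((ex_smooth ζ).contDiffAt.differentiableAt (by simp)), pd_ex]
  ring

lemma pd_pd_mul_ex {η : Euc d → ℂ} (h : ContDiff ℝ (⊤ : ℕ∞) η) (ζ : Euc d) (j : Fin d) (y : Euc d) :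
    pd j (pd j (fun z => η z * ex ζ z)) y =
      (pd j (pd j η) y + 2 * Complex.I * ζ j * pd j η y - (ζ j) ^ 2 * η y) * ex ζ y := by
  have hp := pd_smooth h j
  have hs : ContDiff ℝ (⊤ : ℕ∞) (fun y => (ζ j : ℂ) * Complex.I * η y) := contDiff_const.mul h
  rw [pd_mul_ex h, pd_mul_ex (hp.add hs)]
  have e1 : pd j (fun y => pd j η y + (ζ j : ℂ) * Complex.I * η y) y
      = pd j (pd j η) y + (ζ j : ℂ) * Complex.I * pd j η y := by
    have e2 := pd_mul (f := fun _ => (ζ j : ℂ) * Complex.I) (g := η) (y := y)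
      (differentiableAt_const _) (h.contDiffAt.differentiableAt (by simp)) j
    have e3 : pd j (fun _ => (ζ j : ℂ) * Complex.I) y = 0 := by simp [pd]
    rw [e3] at e2
    have e4 : pd j (fun y => pd j η y + (ζ j : ℂ) * Complex.I * η y) y
      = pd j (pd j η) y + pd j (fun y => (ζ j : ℂ) * Complex.I * η y) y := by
      have e5 := fderiv_fun_add (hp.contDiffAt.differentiableAt (by simp))
        (hs.contDiffAt.differentiableAt (x := y) (by simp))
      exact congrArg (fun L : Euc d →L[ℝ] ℂ => L (EuclideanSpace.single j 1)) e5
    rw [e4, e2]; ring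
  simp only [e1]
  linear_combination ((ζ j : ℂ)^2 * η y * ex ζ y) * Complex.I_sq

/-- Pairing of `ψ` with `η` times the plane wave. -/
def pairing (ψ η : Euc d → ℂ) (ζ : Euc d) : ℂ := ∫ y, ψ y * (η y * ex ζ y)

lemma key_identity {B : Set (Euc d)} (hB : IsOpen B) {V ψ η : Euc d → ℂ} {lam : ℂ}
    (hV : ContDiffOn ℝ (⊤ : ℕ∞) V B)
    (hψ : ContDiffOn ℝ (⊤ : ℕ∞) ψ B)
    (heq : ∀ y ∈ B, -(∑ j, pd j (pd j ψ) y) + V y * ψ y = lam * ψ y)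
    (hη : GoodFn B η) (ζ : Euc d) :
    (lam - (‖ζ‖ ^ 2 : ℝ)) * pairing ψ η ζ =
      pairing ψ (fun y => V y * η y + ∑ j, (-1) * pd j (pd j η) y) ζ
      + ∑ j, (-2 * Complex.I * ζ j) * pairing ψ (pd j η) ζ := by
  have hφ := hη.ex hB ζ
  set φ : Euc d → ℂ := fun y => η y * ex ζ y with hφdef
  have hIntg : ∀ {θ : Euc d → ℂ}, GoodFn B θ → Integrable (fun y => ψ y * (θ y * ex ζ y)) :=
    fun hθ => (smooth_mul hB hψ (hθ.ex hB ζ)).integrable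
  have hη1 : GoodFn B (fun y => V y * η y + ∑ j, (-1) * pd j (pd j η) y) :=
    (smooth_mul hB hV hη).add (GoodFn.sum _ fun j => ((hη.pd j).pd j).smul hB (-1))
  have hA : lam * pairing ψ η ζ = -(∑ j, ∫ y, pd j (pd j ψ) y * φ y)
      + ∫ y, ψ y * ((V y * η y) * ex ζ y) := by
    have i1 : ∀ j, Integrable (fun y => pd j (pd j ψ) y * φ y) := fun j =>
      (smooth_mul hB (pd_smoothOn hB (pd_smoothOn hB hψ j) j) hφ).integrable
    have i2 : Integrable (fun y => -∑ j, pd j (pd j ψ) y * φ y) :=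
      (integrable_finsetSum _ fun j _ => i1 j).neg
    rw [← integral_finsetSum _ (fun j _ => i1 j), ← integral_neg, ← integral_add
      i2 (hIntg (smooth_mul hB hV hη)), pairing, ← integral_const_mul]
    refine integral_congr_ae (Filter.Eventually.of_forall fun y => ?_)
    simp only
    rw [← Finset.sum_mul]
    by_cases hy : y ∈ tsupport η
    · have := heq y (hη.sub hy)
      simp only [hφdef]
      linear_combination (-(η y * ex ζ y)) * this
    · have := image_eq_zero_of_notMem_tsupport hy
      simp [hφdef, this]
  have hBj : ∀ j, ∫ y, pd j (pd j ψ) y * φ y = pairing ψ (pd j (pd j η)) ζ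
      + (2 * Complex.I * ζ j) * pairing ψ (pd j η) ζ - (ζ j : ℂ) ^ 2 * pairing ψ η ζ := by
    intro j
    rw [green hB hψ hφ j]
    unfold pairing
    have i1 := hIntg ((hη.pd j).pd j)
    have i2 := (hIntg (hη.pd j)).const_mul (2 * Complex.I * ζ j)
    have i3 := (hIntg hη).const_mul ((ζ j : ℂ) ^ 2)
    have i4 : Integrable (fun y => ψ y * (pd j (pd j η) y * ex ζ y) +
      2 * Complex.I * ζ j * (ψ y * (pd j η y * ex ζ y))) := i1.add i2
    rw [← integral_const_mul, ← integral_const_mul, ← integral_add i1 i2,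
      ← integral_sub i4 i3]
    refine integral_congr_ae (Filter.Eventually.of_forall fun y => ?_)
    simp only [hφdef]
    rw [pd_pd_mul_ex hη.smooth]
    ring
  have hC : pairing ψ (fun y => V y * η y + ∑ j, (-1) * pd j (pd j η) y) ζ
      = (∫ y, ψ y * ((V y * η y) * ex ζ y)) - ∑ j, pairing ψ (pd j (pd j η)) ζ := by
    unfold pairing
    rw [← integral_finsetSum _ (fun j _ => hIntg ((hη.pd j).pd j)), ← integral_sub
      (hIntg (smooth_mul hB hV hη)) (integrable_finsetSum _ fun j _ => hIntg ((hη.pd j).pd j))]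
    refine integral_congr_ae (Filter.Eventually.of_forall fun y => ?_)
    simp only [← Finset.mul_sum, ← Finset.sum_mul]
    ring
  have hn : ((‖ζ‖ ^ 2 : ℝ) : ℂ) = ∑ j, (ζ j : ℂ) ^ 2 := by
    rw [EuclideanSpace.norm_sq_eq]
    simp
  rw [hC, sub_mul, hA, hn]
  simp only [hBj, Finset.sum_add_distrib, Finset.sum_sub_distrib, Finset.sum_mul]
  have : ∑ j, (-2 * Complex.I * ζ j) * pairing ψ (pd j η) ζ
     = - ∑ j, (2 * Complex.I * ζ j) * pairing ψ (pd j η) ζ := by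
    rw [← Finset.sum_neg_distrib]
    exact Finset.sum_congr rfl fun j _ => by ring
  rw [this]
  ring

lemma base_bound {x : Euc d} {r : ℝ} {η : Euc d → ℂ} (hη : GoodFn (ball x r) η) :
    ∃ C : ℝ, 0 ≤ C ∧ ∀ ψ : Euc d → ℂ, ContDiffOn ℝ (⊤ : ℕ∞) ψ (ball x r) → 
      L2 ψ (ball x r) ≠ ⊤ → ∀ ζ, ‖pairing ψ η ζ‖ ≤ C * (L2 ψ (ball x r)).toReal := by
  obtain ⟨M, hM⟩ := hη.smooth.continuous.bounded_above_of_compact_support hη.cpt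
  have hM0 : 0 ≤ M := (norm_nonneg _).trans (hM x)
  set μ : Measure (Euc d) := volume.restrict (ball x r) with hμ
  have hfin : IsFiniteMeasure μ := ⟨by simp [hμ, measure_ball_lt_top]⟩
  refine ⟨M * ((μ Set.univ) ^ (1 / (1:ℝ≥0∞).toReal - 1 / (2:ℝ≥0∞).toReal)).toReal,
    by positivity, fun ψ hψ hL ζ => ?_⟩
  have hm : AEStronglyMeasurable ψ μ := hψ.continuousOn.aestronglyMeasurable measurableSet_ball
  have h1 := eLpNorm_le_eLpNorm_mul_rpow_measure_univ (p := 1) (q := 2) (by norm_num) hm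
  have hfin2 : (μ Set.univ) ^ (1 / (1:ℝ≥0∞).toReal - 1 / (2:ℝ≥0∞).toReal) ≠ ⊤ := by
    apply ENNReal.rpow_ne_top_of_nonneg (by norm_num) (measure_ne_top _ _)
  have hL' : eLpNorm ψ 2 μ ≠ ⊤ := hL
  have htop : eLpNorm ψ 1 μ ≠ ⊤ := ne_top_of_le_ne_top (ENNReal.mul_ne_top hL' hfin2) h1
  have hi : Integrable ψ μ := memLp_one_iff_integrable.1 ⟨hm, htop.lt_top⟩
  have h2 : ∫ y, ‖ψ y‖ ∂μ ≤ (L2 ψ (ball x r)).toReal *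
      ((μ Set.univ) ^ (1 / (1:ℝ≥0∞).toReal - 1 / (2:ℝ≥0∞).toReal)).toReal := by
    rw [← ENNReal.toReal_mul, integral_norm_eq_lintegral_enorm hm, ← eLpNorm_one_eq_lintegral_enorm]
    exact ENNReal.toReal_mono (ENNReal.mul_ne_top hL' hfin2) h1
  have h3 : pairing ψ η ζ = ∫ y, ψ y * (η y * ex ζ y) ∂μ := by
    rw [pairing, hμ, setIntegral_eq_integral_of_forall_compl_eq_zero]
    intro y hy
    have : η y = 0 := image_eq_zero_of_notMem_tsupport fun h => hy (hη.sub h)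
    simp [this]
  calc ‖pairing ψ η ζ‖ ≤ ∫ y, M * ‖ψ y‖ ∂μ := by
        rw [h3]
        refine norm_integral_le_of_norm_le (hi.norm.const_mul M) (Filter.Eventually.of_forall ?_)
        intro y
        rw [norm_mul, norm_mul, ex_norm, mul_one, mul_comm]
        exact mul_le_mul_of_nonneg_right (hM y) (norm_nonneg _)
    _ = M * ∫ y, ‖ψ y‖ ∂μ := integral_const_mul _ _
    _ ≤ _ := by
        rw [mul_assoc]
        refine mul_le_mul_of_nonneg_left (h2.trans (le_of_eq (mul_comm _ _))) hM0

lemma iter_bound {x : Euc d} {r : ℝ} {V : Euc d → ℂ}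
    (hV : ContDiffOn ℝ (⊤ : ℕ∞) V (ball x r)) (k : ℕ) :
    ∀ {η : Euc d → ℂ}, GoodFn (ball x r) η →
    ∃ C : ℝ, 0 ≤ C ∧ ∀ (lam : ℂ) (ψ : Euc d → ℂ), ContDiffOn ℝ (⊤ : ℕ∞) ψ (ball x r) → 
      (∀ y ∈ ball x r, -(∑ j, pd j (pd j ψ) y) + V y * ψ y = lam * ψ y) →
      L2 ψ (ball x r) ≠ ⊤ → ∀ ζ,
      ‖lam - (‖ζ‖ ^ 2 : ℝ)‖ ^ k * ‖pairing ψ η ζ‖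
        ≤ C * (1 + ‖ζ‖) ^ k * (L2 ψ (ball x r)).toReal := by
  induction k with
  | zero =>
    intro η hη
    obtain ⟨C, hC, h⟩ := base_bound hη
    exact ⟨C, hC, fun lam ψ hψ _ hL ζ => by simpa using h ψ hψ hL ζ⟩
  | succ k ih =>
    intro η hη
    have hB : IsOpen (ball x r) := isOpen_ball
    have hη1 : GoodFn (ball x r) (fun y => V y * η y + ∑ j, (-1) * pd j (pd j η) y) :=
      (smooth_mul hB hV hη).add (GoodFn.sum _ fun j => ((hη.pd j).pd j).smul hB (-1))
    obtain ⟨C0, hC0, h0⟩ := ih hη1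
    choose C hC h using fun j => ih (hη.pd j)
    refine ⟨C0 + ∑ j, 2 * C j, by
      have : 0 ≤ ∑ j, 2 * C j := Finset.sum_nonneg fun j _ => by have := hC j; positivity
      positivity, fun lam ψ hψ heq hL ζ => ?_⟩
    have key := key_identity hB hV hψ heq hη ζ
    set N := (L2 ψ (ball x r)).toReal
    have hN : 0 ≤ N := ENNReal.toReal_nonneg
    set q := ‖lam - (‖ζ‖ ^ 2 : ℝ)‖ with hq
    have hq0 : 0 ≤ q := norm_nonneg _
    set P := (1 + ‖ζ‖) ^ k * N with hP
    have hP0 : 0 ≤ P := by positivity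
    calc q ^ (k+1) * ‖pairing ψ η ζ‖
        = q ^ k * ‖(lam - (‖ζ‖ ^ 2 : ℝ)) * pairing ψ η ζ‖ := by
          rw [norm_mul, ← hq]; ring
      _ ≤ q ^ k * (‖pairing ψ (fun y => V y * η y + ∑ j, (-1) * pd j (pd j η) y) ζ‖
          + ∑ j, 2 * ‖ζ‖ * ‖pairing ψ (pd j η) ζ‖) := by
          rw [key]
          refine mul_le_mul_of_nonneg_left ((norm_add_le _ _).trans ?_) (by positivity)
          refine add_le_add le_rfl ((norm_sum_le _ _).trans (Finset.sum_le_sum fun j _ => ?_))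
          rw [norm_mul]
          refine mul_le_mul_of_nonneg_right ?_ (norm_nonneg _)
          have := PiLp.norm_apply_le ζ j
          simpa using this
      _ = q ^ k * ‖pairing ψ (fun y => V y * η y + ∑ j, (-1) * pd j (pd j η) y) ζ‖
          + ∑ j, 2 * ‖ζ‖ * (q ^ k * ‖pairing ψ (pd j η) ζ‖) := by
          rw [mul_add, Finset.mul_sum]
          congr 1
          exact Finset.sum_congr rfl fun j _ => by ring
      _ ≤ C0 * (1 + ‖ζ‖) ^ k * N + ∑ j, 2 * ‖ζ‖ * (C j * (1 + ‖ζ‖) ^ k * N) := by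
          refine add_le_add (h0 lam ψ hψ heq hL ζ) (Finset.sum_le_sum fun j _ => ?_)
          exact mul_le_mul_of_nonneg_left (h j lam ψ hψ heq hL ζ) (by positivity)
      _ = C0 * P + ‖ζ‖ * (∑ j, 2 * C j) * P := by
          rw [Finset.mul_sum, Finset.sum_mul, hP]
          congr 1
          · ring
          · exact Finset.sum_congr rfl fun j _ => by ring
      _ ≤ (C0 + ∑ j, 2 * C j) * (1 + ‖ζ‖) * P := by
          have h1 : 0 ≤ ∑ j, 2 * C j := Finset.sum_nonneg fun j _ => by have := hC j; positivity
          have h2 := norm_nonneg ζ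
          rw [← add_mul]
          refine mul_le_mul_of_nonneg_right ?_ hP0
          nlinarith [mul_nonneg hC0 h2]
      _ = _ := by rw [hP]; ring

open scoped FourierTransform

lemma pow_diff_le (n : ℕ) {a b : ℝ} (ha : 0 ≤ a) (hab : a ≤ b) :
    b ^ n - a ^ n ≤ n * b ^ (n - 1) * (b - a) := by
  have hb : 0 ≤ b := ha.trans hab
  induction n with
  | zero => simp
  | succ n ih =>
    rcases n with _ | n
    · simp
    · simp only [Nat.add_sub_cancel] at ih ⊢
      have h1 := mul_le_mul_of_nonneg_left ih hb
      have h2 : a ^ (n+1) * (b - a) ≤ b ^ (n+1) * (b - a) :=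
        mul_le_mul_of_nonneg_right (pow_le_pow_left₀ ha hab _) (by linarith)
      push_cast at h1 ⊢
      have e1 : b ^ (n+1+1) - a ^ (n+1+1) = b * (b^(n+1) - a^(n+1)) + a^(n+1) * (b - a) := by ring
      have e2 : b * ((n + 1) * b ^ n * (b - a)) = (n+1) * b ^ (n+1) * (b - a) := by ring
      rw [e1]
      rw [e2] at h1
      linarith

/-- The spectral shell. -/
def shell (d : ℕ) (μ w : ℝ) : Set (Euc d) := {ξ | |2 * Real.pi * ‖ξ‖ - μ| ≤ w}

lemma shell_meas (d : ℕ) (μ w : ℝ) : MeasurableSet (shell d μ w) := by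
  apply IsClosed.measurableSet
  exact isClosed_le (by fun_prop) continuous_const

lemma shell_vol {d : ℕ} (hd : 0 < d) : ∃ A : ℝ, 0 < A ∧ ∀ μ w : ℝ, 1 ≤ μ → 0 ≤ w → w ≤ μ →
    volume (shell d μ w) ≤ ENNReal.ofReal (A * (w * μ ^ (d - 1))) := by
  have : Nonempty (Fin d) := ⟨⟨0, hd⟩⟩
  set ω := (volume (ball (0 : Euc d) 1)) with hω
  have hωtop : ω ≠ ⊤ := measure_ball_lt_top.ne
  refine ⟨ω.toReal * d + 1, by positivity, fun μ w hμ hw hwμ => ?_⟩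
  have hpi := Real.pi_gt_three
  set R0 := (μ - w) / (2 * Real.pi) with hR0
  set R1 := (μ + w) / (2 * Real.pi) with hR1
  have h0 : 0 ≤ R0 := div_nonneg (by linarith) (by positivity)
  have h01 : R0 ≤ R1 := by rw [hR0, hR1]; gcongr; linarith
  have h1 : 0 ≤ R1 := h0.trans h01
  have hsub : shell d μ w ⊆ closedBall 0 R1 \ ball 0 R0 := by
    intro ξ hξ
    have hξ' : |2 * Real.pi * ‖ξ‖ - μ| ≤ w := hξ
    rw [abs_le] at hξ'
    refine ⟨?_, ?_⟩
    · rw [mem_closedBall_zero_iff, hR1, le_div_iff₀ (by positivity)]; linarith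
    · rw [mem_ball_zero_iff, not_lt, hR0, div_le_iff₀ (by positivity)]; linarith
  have hR1μ : R1 ≤ μ := by
    rw [hR1, div_le_iff₀ (by positivity)]; nlinarith
  have hdiff : R1 - R0 ≤ w := by
    rw [hR1, hR0, ← _root_.sub_div, div_le_iff₀ (by positivity)]; nlinarith
  have hball : volume (ball (0 : Euc d) R0) ≠ ⊤ := measure_ball_lt_top.ne
  calc volume (shell d μ w) ≤ volume (closedBall (0 : Euc d) R1 \ ball 0 R0) := measure_mono hsub
    _ = volume (closedBall (0 : Euc d) R1) - volume (ball (0 : Euc d) R0) :=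
        measure_sdiff ((ball_subset_closedBall).trans (closedBall_subset_closedBall h01))
          measurableSet_ball.nullMeasurableSet hball
    _ = ENNReal.ofReal ((R1 ^ d - R0 ^ d) * ω.toReal) := by
        rw [Measure.addHaar_closedBall _ _ h1, Measure.addHaar_ball _ _ h0, ← hω,
          finrank_euclideanSpace_fin, ← ENNReal.ofReal_toReal hωtop,
          ← ENNReal.ofReal_mul (by positivity), ← ENNReal.ofReal_mul (by positivity),
          ← ENNReal.ofReal_sub _ (by positivity), ENNReal.toReal_ofReal (by positivity), sub_mul]
    _ ≤ _ := by
        apply ENNReal.ofReal_le_ofReal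
        have h2 := pow_diff_le d h0 h01
        have h3 : (d : ℝ) * R1 ^ (d-1) * (R1 - R0) ≤ d * μ ^ (d-1) * w := by
          have : 0 ≤ R1 - R0 := by linarith
          gcongr
        have h4 : 0 ≤ w * μ ^ (d - 1) := by positivity
        have h5 : 0 ≤ ω.toReal := ENNReal.toReal_nonneg
        nlinarith [mul_le_mul_of_nonneg_right (h2.trans h3) h5]

lemma off_shell {d k : ℕ} {δ μ z g K : ℝ} (hδ : 0 < δ) (hδ1 : δ ≤ 1) (hμ : 1 ≤ μ) (hz : 0 ≤ z)
    (hk : ((d : ℝ) + 1) / δ ≤ k) (ht : μ ^ δ ≤ |z - μ|) (hg : 0 ≤ g)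
    (hb : |z - μ| ^ k * g ≤ K) : g ≤ 3 ^ (d+1) * K * (1 + z) ^ (-((d : ℝ) + 1)) := by
  set t := |z - μ| with htdef
  have ht1 : 1 ≤ t := (Real.one_le_rpow hμ hδ.le).trans ht
  have ht0 : 0 ≤ t := by linarith
  have hδi : 1 ≤ 1 / δ := by rw [le_div_iff₀ hδ]; linarith
  have hμt : μ ≤ t ^ (1 / δ) := by
    have := Real.rpow_le_rpow (by positivity) ht (z := 1 / δ) (by positivity)
    rwa [← Real.rpow_mul (by linarith), mul_one_div_cancel hδ.ne', Real.rpow_one] at this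
  have htt : t ≤ t ^ (1 / δ) := by
    simpa using Real.rpow_le_rpow_of_exponent_le ht1 hδi
  have hzt : 1 + z ≤ 3 * t ^ (1 / δ) := by
    have : z - μ ≤ t := le_abs_self _
    linarith
  have hpow : (1 + z) ^ (d + 1) ≤ 3 ^ (d+1) * t ^ k := by
    calc (1 + z) ^ (d+1) ≤ (3 * t ^ (1 / δ)) ^ (d+1) := pow_le_pow_left₀ (by positivity) hzt _
      _ = 3 ^ (d+1) * t ^ (((d : ℝ) + 1) / δ) := by
          rw [mul_pow, ← Real.rpow_natCast (t ^ (1/δ)), ← Real.rpow_mul ht0]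
          congr 2
          push_cast; ring
      _ ≤ 3 ^ (d+1) * t ^ (k : ℝ) := by
          gcongr
      _ = _ := by rw [Real.rpow_natCast]
  rw [Real.rpow_neg (by positivity), ← div_eq_mul_inv, le_div_iff₀ (by positivity)]
  have e : (1 + z) ^ ((d : ℝ) + 1) = (1 + z) ^ (d + 1) := by
    rw [← Real.rpow_natCast]; push_cast; rfl
  rw [e]
  calc g * (1 + z) ^ (d+1) ≤ g * (3 ^ (d+1) * t ^ k) := by gcongr
    _ = 3 ^ (d+1) * (t ^ k * g) := by ring
    _ ≤ _ := by gcongr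

lemma fourier_pairing {ψ χ : Euc d → ℂ} (ξ : Euc d) :
    𝓕 (fun y => ψ y * χ y) ξ = pairing ψ χ ((-(2 * Real.pi)) • ξ) := by
  rw [Real.fourier_eq', pairing]
  refine integral_congr_ae (Filter.Eventually.of_forall fun y => ?_)
  simp only [ex, smul_eq_mul]
  rw [real_inner_smul_left, real_inner_comm]
  have : (-2 * Real.pi * inner ℝ ξ y) = -(2 * Real.pi) * inner ℝ ξ y := by ring
  rw [this]
  ring

lemma zero_dim (Ω : Set (Euc 0))
    (V : Euc 0 → ℂ) 
    (x : Euc 0) (hx : x ∈ Ω) (r : ℝ) (hr : 0 < r) (e : ℝ) :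
    ∃ C : ℝ, 0 < C ∧ ∀ (lam : ℂ), 1 ≤ lam.re → ∀ ψ : Euc 0 → ℂ,
      (∀ y ∈ Ω, -(∑ j, pd j (pd j ψ) y) + V y * ψ y = lam * ψ y) →
      (‖ψ x‖₊ : ℝ≥0∞) ≤
        ENNReal.ofReal (C * lam.re ^ e) * L2 ψ (ball x r) := by
  set m := volume (ball x r) with hm
  have hm0 : m ≠ 0 := (measure_ball_pos _ _ hr).ne'
  have hmtop : m ≠ ⊤ := measure_ball_lt_top.ne
  set c := m ^ (1 / (2 : ℝ≥0∞).toReal) with hc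
  have hc0 : c ≠ 0 := by
    rw [hc, Ne, ENNReal.rpow_eq_zero_iff]; simp [hm0, hmtop]
  have hctop : c ≠ ⊤ := ENNReal.rpow_ne_top_of_nonneg (by simp) hmtop
  have hcpos : 0 < c.toReal := ENNReal.toReal_pos hc0 hctop
  by_cases hV : 1 ≤ (V x).re
  · have hp : 0 < (V x).re ^ e := Real.rpow_pos_of_pos (by linarith) _
    refine ⟨(c.toReal)⁻¹ * ((V x).re ^ e)⁻¹, by positivity, fun lam hlam ψ h => ?_⟩
    by_cases h0 : ψ x = 0
    · simp [h0]
    have h1 := h x hx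
    simp only [Finset.univ_eq_empty, Finset.sum_empty, neg_zero, zero_add] at h1
    have h2 : V x = lam := mul_right_cancel₀ h0 h1
    have hconst : ψ = fun _ => ψ x := by
      funext y; rw [Subsingleton.elim y x]
    have hL : L2 ψ (ball x r) = ‖ψ x‖ₑ * c := by
      unfold L2
      rw [hconst, eLpNorm_const _ (by simp) (by
        rw [Ne, Measure.restrict_eq_zero]; exact hm0)]
      rw [Measure.restrict_apply_univ]
    rw [hL, ← h2, mul_assoc, inv_mul_cancel₀ hp.ne', mul_one, ENNReal.ofReal_inv_of_pos hcpos,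
      ENNReal.ofReal_toReal hctop, mul_comm, mul_assoc, ENNReal.mul_inv_cancel hc0 hctop, mul_one]
    exact le_rfl
  · refine ⟨1, one_pos, fun lam hlam ψ h => ?_⟩
    by_cases h0 : ψ x = 0
    · simp [h0]
    have h1 := h x hx
    simp only [Finset.univ_eq_empty, Finset.sum_empty, neg_zero, zero_add] at h1
    have h2 : V x = lam := mul_right_cancel₀ h0 h1
    rw [h2] at hV
    exact absurd hlam hV

lemma fourier_package {x : Euc d} {r : ℝ} {χ : Euc d → ℂ}
    (hχ : GoodFn (ball x r) χ) (hχ1 : ∀ y, ‖χ y‖ ≤ 1) (hχx : χ x = 1)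
    {ψ : Euc d → ℂ} (hψ : ContDiffOn ℝ (⊤ : ℕ∞) ψ (ball x r)) :
    ∃ G : Euc d → ℂ, Continuous G ∧ (∀ ξ, G ξ = pairing ψ χ ((-(2 * Real.pi)) • ξ)) ∧
      ‖ψ x‖ₑ ≤ ∫⁻ ξ, ‖G ξ‖ₑ ∧ eLpNorm G 2 volume ≤ L2 ψ (ball x r) := by
  have hF := smooth_mul isOpen_ball hψ hχ
  set f := hF.cpt.toSchwartzMap hF.smooth with hf
  have hfF : (f : Euc d → ℂ) = fun y => ψ y * χ y := rfl
  set g : SchwartzMap (Euc d) ℂ := 𝓕 f with hg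
  refine ⟨(g : Euc d → ℂ), g.continuous, fun ξ => ?_, ?_, ?_⟩
  · rw [hg, SchwartzMap.fourier_coe, hfF]
    exact fourier_pairing ξ
  · have h1 : 𝓕⁻ g = f := FourierTransform.fourierInv_fourier_eq f
    have h2 : ψ x = (𝓕⁻ g) x := by
      rw [h1, hfF]; simp [hχx]
    rw [h2, SchwartzMap.fourierInv_coe, Real.fourierInv_eq']
    refine (enorm_integral_le_lintegral_enorm _).trans (le_of_eq ?_)
    refine lintegral_congr fun ξ => ?_
    rw [enorm_smul]
    have : ‖Complex.exp (((2 * Real.pi * inner ℝ ξ x : ℝ) : ℂ) * Complex.I)‖ₑ = 1 := by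
      rw [← ofReal_norm, Complex.norm_exp_ofReal_mul_I]; simp
    rw [this, one_mul]
  · have h1 := SchwartzMap.norm_fourier_toL2_eq f
    rw [SchwartzMap.norm_toLp, SchwartzMap.norm_toLp] at h1
    have h2 : eLpNorm g 2 volume = eLpNorm f 2 volume := by
      rwa [ENNReal.toReal_eq_toReal_iff' (g.eLpNorm_lt_top 2 volume).ne
        (f.eLpNorm_lt_top 2 volume).ne] at h1
    rw [h2, L2, ← eLpNorm_indicator_eq_eLpNorm_restrict measurableSet_ball]
    refine eLpNorm_mono fun y => ?_
    rw [hfF]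
    by_cases hy : y ∈ ball x r
    · rw [Set.indicator_of_mem hy, norm_mul]
      exact mul_le_of_le_one_right (norm_nonneg _) (hχ1 y)
    · have : χ y = 0 := image_eq_zero_of_notMem_tsupport fun h => hy (hχ.sub h)
      simp [this]

lemma main_bound {d : ℕ} (hd : 0 < d) {V : Euc d → ℂ} {x : Euc d} {r : ℝ} (hr : 0 < r)
    (hV : ContDiffOn ℝ (⊤ : ℕ∞) V (ball x r)) {ε : ℝ} (hε : 0 < ε) :
    ∃ C : ℝ, 0 < C ∧ ∀ (lam : ℂ), 1 ≤ lam.re → ∀ ψ : Euc d → ℂ,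
      ContDiffOn ℝ (⊤ : ℕ∞) ψ (ball x r) →
      (∀ y ∈ ball x r, -(∑ j, pd j (pd j ψ) y) + V y * ψ y = lam * ψ y) →
      (‖ψ x‖₊ : ℝ≥0∞) ≤
        ENNReal.ofReal (C * lam.re ^ (((d : ℝ) - 1) / 4 + ε)) * L2 ψ (ball x r) := by
  obtain ⟨χ₀, hs, hcs, hsm, hrange, hone⟩ :=
    exists_contDiff_tsupport_subset (n := ⊤) (ball_mem_nhds x hr)
  set χ : Euc d → ℂ := fun y => (χ₀ y : ℂ) with hχdef
  have hχ : GoodFn (ball x r) χ := by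
    refine ⟨Complex.ofRealCLM.contDiff.comp hsm, hcs.comp_left (g := Complex.ofReal) (by simp), ?_⟩
    exact (closure_mono (Function.support_comp_subset (g := Complex.ofReal) (by simp) χ₀)).trans hs
  have hχ1 : ∀ y, ‖χ y‖ ≤ 1 := by
    intro y
    have := hrange ⟨y, rfl⟩
    rw [hχdef, Complex.norm_real, Real.norm_eq_abs, abs_of_nonneg this.1]
    exact this.2
  have hχx : χ x = 1 := by simp [hχdef, hone]
  set δ := min 1 (4 * ε) with hδdef
  have hδ : 0 < δ := by positivity
  have hδ1 : δ ≤ 1 := min_le_left _ _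
  have hδε : δ ≤ 4 * ε := min_le_right _ _
  obtain ⟨k, hk⟩ := exists_nat_ge (((d : ℝ) + 1) / δ)
  obtain ⟨K, hK0, hK⟩ := iter_bound hV k hχ
  obtain ⟨A, hA0, hA⟩ := shell_vol hd
  have hIint : Integrable (fun ξ : Euc d => (1 + ‖ξ‖) ^ (-((d : ℝ) + 1))) :=
    integrable_one_add_norm (by simp)
  set I₀ := ∫ ξ : Euc d, (1 + ‖ξ‖) ^ (-((d : ℝ) + 1)) with hI
  have hI0 : 0 ≤ I₀ := integral_nonneg fun ξ => by positivity
  refine ⟨A ^ (1/2 : ℝ) + 3 ^ (d+1) * K * I₀, by positivity, fun lam hlam ψ hψ heq => ?_⟩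
  set a := lam.re with ha
  have ha0 : 0 < a := by linarith
  set E := ((d : ℝ) - 1) / 4 + ε with hE
  have hd1 : (1 : ℝ) ≤ d := by exact_mod_cast hd
  have hE0 : 0 ≤ E := by
    have : 0 ≤ ((d : ℝ) - 1) / 4 := by linarith
    linarith
  have haE : 1 ≤ a ^ E := Real.one_le_rpow hlam hE0
  by_cases hL : L2 ψ (ball x r) = ⊤
  · rw [hL, ENNReal.mul_top]
    · exact le_top
    · simp only [ne_eq, ENNReal.ofReal_eq_zero, not_le]
      positivity
  obtain ⟨G, hGc, hGp, hGx, hG2⟩ := fourier_package hχ hχ1 hχx hψ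
  set N := (L2 ψ (ball x r)).toReal with hN
  have hN0 : 0 ≤ N := ENNReal.toReal_nonneg
  set μ := Real.sqrt a with hμ
  have hμ1 : 1 ≤ μ := by rw [hμ]; exact Real.one_le_sqrt.2 hlam
  have hμ2 : μ ^ 2 = a := Real.sq_sqrt ha0.le
  set w := μ ^ δ with hw
  have hw0 : 0 ≤ w := by positivity
  have hwμ : w ≤ μ := by simpa using Real.rpow_le_rpow_of_exponent_le hμ1 hδ1
  set S := shell d μ w with hS
  -- decay off the shell
  have hoff : ∀ ξ ∈ Sᶜ, ‖G ξ‖ ≤ 3 ^ (d+1) * (K * N) * (1 + ‖ξ‖) ^ (-((d : ℝ) + 1)) := by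
    intro ξ hξ
    have hξ' : w < |2 * Real.pi * ‖ξ‖ - μ| := by
      by_contra hcon
      exact hξ (not_lt.1 hcon)
    set ζ : Euc d := (-(2 * Real.pi)) • ξ with hζ
    have hz : ‖ζ‖ = 2 * Real.pi * ‖ξ‖ := by
      rw [hζ, norm_smul, norm_neg, Real.norm_of_nonneg (by positivity)]
    have h1 := hK lam ψ hψ heq hL ζ
    rw [← hz] at hξ'
    have hz0 : 0 ≤ ‖ζ‖ := norm_nonneg _
    set z := ‖ζ‖ with hzdef
    have h2 : |z - μ| * (1 + z) ≤ ‖lam - (z ^ 2 : ℝ)‖ := by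
      calc |z - μ| * (1 + z) ≤ |z - μ| * (μ + z) := by gcongr
        _ = |a - z ^ 2| := by
          rw [← abs_of_nonneg (show 0 ≤ μ + z by positivity), ← abs_mul, ← hμ2, abs_sub_comm (μ^2)]
          congr 1
          ring
        _ = |(lam - (z ^ 2 : ℝ)).re| := by
          rw [Complex.sub_re, Complex.ofReal_re]
        _ ≤ _ := Complex.abs_re_le_norm _
    have h3 : |z - μ| ^ k * ‖G ξ‖ ≤ K * N := by
      have hp : 0 < (1 + z) ^ k := by positivity
      refine le_of_mul_le_mul_right ?_ hp
      calc |z - μ| ^ k * ‖G ξ‖ * (1 + z) ^ k = (|z - μ| * (1 + z)) ^ k * ‖G ξ‖ := by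
            rw [mul_pow]; ring
        _ ≤ ‖lam - (z ^ 2 : ℝ)‖ ^ k * ‖G ξ‖ := by gcongr
        _ ≤ K * (1 + z) ^ k * N := by rw [hGp]; exact h1
        _ = _ := by ring
    have h4 := off_shell (d := d) hδ hδ1 hμ1 hz0 hk hξ'.le (norm_nonneg (G ξ)) h3
    refine h4.trans ?_
    refine mul_le_mul_of_nonneg_left ?_ (by positivity)
    refine Real.rpow_le_rpow_of_nonpos (by positivity) ?_ (by linarith)
    have := Real.pi_gt_three
    have := norm_nonneg ξ
    rw [hz]
    nlinarith
  have hpart1 : ∫⁻ ξ in S, ‖G ξ‖ₑ ≤ ENNReal.ofReal (A ^ (1/2 : ℝ) * a ^ E) * L2 ψ (ball x r) := by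
    have h1 := eLpNorm_le_eLpNorm_mul_rpow_measure_univ (μ := volume.restrict S) (p := 1) (q := 2)
      (by norm_num) (hGc.aestronglyMeasurable)
    rw [eLpNorm_one_eq_lintegral_enorm, Measure.restrict_apply_univ] at h1
    have h2 : (1 / (1:ℝ≥0∞).toReal - 1 / (2:ℝ≥0∞).toReal) = (1/2 : ℝ) := by norm_num
    rw [h2] at h1
    refine h1.trans ?_
    rw [mul_comm]
    refine mul_le_mul' ?_ ((eLpNorm_restrict_le _ _ _ _).trans hG2)
    calc volume S ^ (1/2 : ℝ) ≤ ENNReal.ofReal (A * (w * μ ^ (d - 1))) ^ (1/2 : ℝ) :=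
          ENNReal.rpow_le_rpow (hA μ w hμ1 hw0 hwμ) (by norm_num)
      _ = ENNReal.ofReal ((A * (w * μ ^ (d - 1))) ^ (1/2 : ℝ)) :=
          ENNReal.ofReal_rpow_of_nonneg (by positivity) (by norm_num)
      _ ≤ _ := by
          apply ENNReal.ofReal_le_ofReal
          rw [Real.mul_rpow hA0.le (by positivity)]
          refine mul_le_mul_of_nonneg_left ?_ (by positivity)
          have e1 : w * μ ^ (d - 1) = a ^ ((δ + ((d:ℝ) - 1)) / 2) := by
            rw [hw, ← Real.rpow_natCast, ← Real.rpow_add (by positivity), Nat.cast_sub hd, hμ,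
              Real.sqrt_eq_rpow, ← Real.rpow_mul ha0.le]
            congr 1
            push_cast; ring
          rw [e1, ← Real.rpow_mul ha0.le]
          apply Real.rpow_le_rpow_of_exponent_le hlam
          rw [hE]; linarith
  have hpart2 : ∫⁻ ξ in Sᶜ, ‖G ξ‖ₑ ≤ 
      ENNReal.ofReal (3 ^ (d+1) * K * I₀ * a ^ E) * L2 ψ (ball x r) := by
    calc ∫⁻ ξ in Sᶜ, ‖G ξ‖ₑ
        ≤ ∫⁻ ξ in Sᶜ, ENNReal.ofReal (3 ^ (d+1) * (K * N) * (1 + ‖ξ‖) ^ (-((d : ℝ) + 1))) := by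
          refine setLIntegral_mono' (shell_meas _ _ _).compl fun ξ hξ => ?_
          rw [← ofReal_norm]
          exact ENNReal.ofReal_le_ofReal (hoff ξ hξ)
      _ ≤ ∫⁻ ξ, ENNReal.ofReal (3 ^ (d+1) * (K * N) * (1 + ‖ξ‖) ^ (-((d : ℝ) + 1))) :=
          setLIntegral_le_lintegral _ _
      _ = ENNReal.ofReal (3 ^ (d+1) * (K * N) * I₀) := by
          rw [← ofReal_integral_eq_lintegral_ofReal (hIint.const_mul _)
            (Filter.Eventually.of_forall fun ξ => by positivity), integral_const_mul]
      _ = ENNReal.ofReal (3 ^ (d+1) * K * I₀) * L2 ψ (ball x r) := by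
          rw [← ENNReal.ofReal_toReal hL, ← ENNReal.ofReal_mul (by positivity)]
          congr 1
          rw [hN]; ring
      _ ≤ _ := by
          refine mul_le_mul_left (ENNReal.ofReal_le_ofReal ?_) _
          exact le_mul_of_one_le_right (by positivity) haE
  calc (‖ψ x‖₊ : ℝ≥0∞) = ‖ψ x‖ₑ := rfl
    _ ≤ ∫⁻ ξ, ‖G ξ‖ₑ := hGx
    _ = (∫⁻ ξ in S, ‖G ξ‖ₑ) + ∫⁻ ξ in Sᶜ, ‖G ξ‖ₑ :=
        (lintegral_add_compl _ (shell_meas _ _ _)).symm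
    _ ≤ _ := add_le_add hpart1 hpart2
    _ = _ := by
        rw [← add_mul, ← ENNReal.ofReal_add (by positivity) (by positivity), ← add_mul]

/-- Theorem `thm-ball`: for a nonempty open `Ω ⊆ ℝ^d`, a smooth potential
`V`, a point `x ∈ Ω` and `r ∈ (0,1)` with `B(x,r) ⊆ Ω`, and any `ε > 0`, there is `C > 0`
(independent of `λ` and `ψ_λ`) such that every smooth solution of `(−Δ+V)ψ_λ = λψ_λ` on `Ω`
with `Re λ ≥ 1` satisfies `|ψ_λ(x)| ≤ C (Re λ)^{(d−1)/4+ε} ‖ψ_λ‖_{L²(B(x,r))}`. -/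
theorem statement1
    (d : ℕ) (Ω : Set (Euc d)) (hΩ : IsOpen Ω) (hne : Ω.Nonempty)
    (V : Euc d → ℂ) (hV : ContDiffOn ℝ (⊤ : ℕ∞) V Ω)
    (x : Euc d) (hx : x ∈ Ω) (r : ℝ) (hr : r ∈ Set.Ioo (0 : ℝ) 1)
    (hball : ball x r ⊆ Ω) (ε : ℝ) (hε : 0 < ε) :
    ∃ C : ℝ, 0 < C ∧ ∀ (lam : ℂ), 1 ≤ lam.re → ∀ ψ : Euc d → ℂ,
      ContDiffOn ℝ (⊤ : ℕ∞) ψ Ω →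
      (∀ y ∈ Ω, -(∑ j, pd j (pd j ψ) y) + V y * ψ y = lam * ψ y) →
      (‖ψ x‖₊ : ℝ≥0∞) ≤
        ENNReal.ofReal (C * lam.re ^ (((d : ℝ) - 1) / 4 + ε)) * L2 ψ (ball x r) := by
  rcases Nat.eq_zero_or_pos d with hd | hd
  · subst hd
    obtain ⟨C, hC, h⟩ := zero_dim Ω V x hx r hr.1 ((((0 : ℕ) : ℝ) - 1) / 4 + ε)
    exact ⟨C, hC, fun lam hlam ψ _ heq => h lam hlam ψ heq⟩
  · obtain ⟨C, hC, h⟩ := main_bound hd hr.1 (hV.mono hball) hε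
    exact ⟨C, hC, fun lam hlam ψ hψ heq =>
      h lam hlam ψ (hψ.mono hball) fun y hy => heq y (hball hy)⟩


end
end

section
/- Let Ω ⊆ ℝ^d be a nonempty open set, V ∈ C^∞(Ω, ℂ), x ∈ Ω and r ∈ (0,1) with B(x,r) ⊆ Ω, and let γ ∈ ℕ^d be a multi-index. Then for every ε > 0 there is a constant C > 0, depending only on d, r, ε, γ, the potential V and the point x, such that for every λ ∈ ℂ with Re λ ≥ 1 and every smooth solution ψ_λ of (−Δ + V)ψ_λ = λψ_λ on Ω one has |(D^γ ψ_λ)(x)| ≤ C (Re λ)^{|γ|/2 + (d−1)/4 + ε} ‖ψ_λ‖_{L²(B(x,r))}. -/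
open MeasureTheory Metric Complex Finset ENNReal NNReal

noncomputable section

variable {d : ℕ}

/-! ### Partial derivatives -/

section basics

variable {F : Type*} [NormedAddCommGroup F] [NormedSpace ℝ F]

/-- Partial derivative for functions with values in any real normed space. -/
def pp (j : Fin d) (f : Euc d → F) : Euc d → F :=
  fun x => fderiv ℝ f x (EuclideanSpace.single j 1)

theorem ContDiff.sdiff {f : Euc d → F} (hf : ContDiff ℝ (⊤ : ℕ∞) f) (y : Euc d) : DifferentiableAt ℝ f y :=
  (hf.differentiable (by simp)) y

@[fun_prop]
theorem contDiff_pp {f : Euc d → F} (hf : ContDiff ℝ (⊤ : ℕ∞) f) (j : Fin d) :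
    ContDiff ℝ (⊤ : ℕ∞) (pp j f) := by
  have h : ContDiff ℝ (⊤ : ℕ∞) (fderiv ℝ f) := hf.fderiv_right (by simp)
  exact h.clm_apply contDiff_const

@[fun_prop]
theorem cont_pp {f : Euc d → F} (hf : ContDiff ℝ (⊤ : ℕ∞) f) (j : Fin d) :
    Continuous (_root_.pp j f) := (contDiff_pp hf j).continuous

theorem pp_add {f g : Euc d → F} (hf : ContDiff ℝ (⊤ : ℕ∞) f) (hg : ContDiff ℝ (⊤ : ℕ∞) g) (j : Fin d) :
    pp j (fun y => f y + g y) = fun y => pp j f y + pp j g y := by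
  funext y
  simp only [pp]
  rw [fderiv_fun_add (hf.sdiff y) (hg.sdiff y)]; rfl

theorem pp_sub {f g : Euc d → F} (hf : ContDiff ℝ (⊤ : ℕ∞) f) (hg : ContDiff ℝ (⊤ : ℕ∞) g) (j : Fin d) :
    pp j (fun y => f y - g y) = fun y => pp j f y - pp j g y := by
  funext y
  simp only [pp]
  rw [fderiv_fun_sub (hf.sdiff y) (hg.sdiff y)]; rfl

theorem pp_const (c : F) (j : Fin d) : pp j (fun _ : Euc d => c) = fun _ => 0 := by
  funext y
  simp [pp]

theorem pp_sum {ι : Type*} (s : Finset ι) {f : ι → Euc d → F} (hf : ∀ i, ContDiff ℝ (⊤ : ℕ∞) (f i)) (j : Fin d) :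
    pp j (fun y => ∑ i ∈ s, f i y) = fun y => ∑ i ∈ s, pp j (f i) y := by
  funext y
  simp only [pp]
  rw [fderiv_fun_sum (fun i _ => (hf i).sdiff y)]
  simp

theorem pp_mul {A : Type*} [NormedCommRing A] [NormedAlgebra ℝ A] {f g : Euc d → A}
    (hf : ContDiff ℝ (⊤ : ℕ∞) f) (hg : ContDiff ℝ (⊤ : ℕ∞) g) (j : Fin d) :
    pp j (fun y => f y * g y) = fun y => pp j f y * g y + f y * pp j g y := by
  funext y
  simp only [pp]
  rw [fderiv_fun_mul (hf.sdiff y) (hg.sdiff y)]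
  simp [mul_comm, add_comm]

theorem pp_comm {f : Euc d → F} (hf : ContDiff ℝ (⊤ : ℕ∞) f) (i j : Fin d) :
    pp i (pp j f) = pp j (pp i f) := by
  funext y
  have h : ContDiff ℝ (⊤ : ℕ∞) (fderiv ℝ f) := hf.fderiv_right (by simp)
  have hd : DifferentiableAt ℝ (fderiv ℝ f) y := h.differentiable (by simp) y
  have key : ∀ v w : Euc d, fderiv ℝ (fun x => fderiv ℝ f x v) y w = fderiv ℝ (fderiv ℝ f) y w v := by
    intro v w
    rw [fderiv_clm_apply hd (differentiableAt_const v)]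
    simp
  have hs : IsSymmSndFDerivAt ℝ f y := by
    apply ContDiffAt.isSymmSndFDerivAt (n := (⊤ : ℕ∞)) hf.contDiffAt
    simp only [minSmoothness_of_isRCLikeNormedField]
    exact WithTop.coe_le_coe.2 le_top
  show fderiv ℝ (fun x => fderiv ℝ f x _) y _ = fderiv ℝ (fun x => fderiv ℝ f x _) y _
  rw [key, key]
  exact hs _ _

theorem pp_clm {G : Type*} [NormedAddCommGroup G] [NormedSpace ℝ G] (T : F →L[ℝ] G)
    {f : Euc d → F} (hf : ContDiff ℝ (⊤ : ℕ∞) f) (j : Fin d) :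
    pp j (fun y => T (f y)) = fun y => T (pp j f y) := by
  funext y
  have := (T.hasFDerivAt.comp y (hf.sdiff y).hasFDerivAt).fderiv
  have h2 : fderiv ℝ (fun y => T (f y)) y = T.comp (fderiv ℝ f y) := this
  simp [pp, h2]

theorem pp_congr {f g : Euc d → F} {s : Set (Euc d)} (hs : IsOpen s) (h : ∀ y ∈ s, f y = g y)
    (j : Fin d) : ∀ y ∈ s, pp j f y = pp j g y := by
  intro y hy
  have : f =ᶠ[nhds y] g := by
    filter_upwards [hs.mem_nhds hy] with z hz using h z hz
  simp only [pp, this.fderiv_eq]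

theorem tsupport_pp (f : Euc d → F) (j : Fin d) : tsupport (pp j f) ⊆ tsupport f := by
  have h1 : tsupport (pp j f) ⊆ tsupport (fderiv ℝ f) := by
    apply closure_mono
    intro y hy hy2
    apply hy
    simp [pp, hy2]
  exact h1.trans (tsupport_fderiv_subset ℝ)

theorem pp_zero_of {f : Euc d → F} {y : Euc d} (hy : y ∉ tsupport f) (j : Fin d) :
    pp j f y = 0 := by
  by_contra h
  exact hy (tsupport_pp f j (subset_tsupport _ h))

/-- Integral over the ball of radius `R` about the origin. -/
def II (R : ℝ) (f : Euc d → ℝ) : ℝ := ∫ y in ball (0 : Euc d) R, f y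

theorem ion {f : Euc d → ℝ} (hf : Continuous f) (R : ℝ) :
    IntegrableOn f (ball (0 : Euc d) R) :=
  (hf.continuousOn.integrableOn_compact (isCompact_closedBall (0 : Euc d) R)).mono_set
    ball_subset_closedBall

theorem II_add {f g : Euc d → ℝ} (hf : Continuous f) (hg : Continuous g) (R : ℝ) :
    II R (fun y => f y + g y) = II R f + II R g := integral_add (ion hf R) (ion hg R)

theorem II_sub {f g : Euc d → ℝ} (hf : Continuous f) (hg : Continuous g) (R : ℝ) :
    II R (fun y => f y - g y) = II R f - II R g := integral_sub (ion hf R) (ion hg R)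

theorem II_mul (c : ℝ) (f : Euc d → ℝ) (R : ℝ) :
    II R (fun y => c * f y) = c * II R f := integral_const_mul _ _

theorem II_sum {ι : Type*} (s : Finset ι) {f : ι → Euc d → ℝ} (hf : ∀ i, Continuous (f i)) (R : ℝ) :
    II R (fun y => ∑ i ∈ s, f i y) = ∑ i ∈ s, II R (f i) :=
  integral_finsetSum _ (fun i _ => ion (hf i) R)

theorem II_mono {f g : Euc d → ℝ} (hf : Continuous f) (hg : Continuous g) (R : ℝ)
    (h : ∀ y ∈ ball (0 : Euc d) R, f y ≤ g y) : II R f ≤ II R g :=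
  setIntegral_mono_on (ion hf R) (ion hg R) measurableSet_ball h

theorem II_congr {f g : Euc d → ℝ} (R : ℝ)
    (h : ∀ y ∈ ball (0 : Euc d) R, f y = g y) : II R f = II R g :=
  setIntegral_congr_fun measurableSet_ball h

theorem II_nonneg {f : Euc d → ℝ} (R : ℝ) (h : ∀ y, 0 ≤ f y) : 0 ≤ II R f :=
  integral_nonneg h

theorem II_mono_set {f : Euc d → ℝ} (hf : Continuous f) (h : ∀ y, 0 ≤ f y) {r R : ℝ} (hr : r ≤ R) :
    II r f ≤ II R f :=
  setIntegral_mono_set (ion hf R) (Filter.Eventually.of_forall h)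
    (ball_subset_ball hr).eventuallyLE

theorem II_pp {f : Euc d → ℝ} (hf : ContDiff ℝ (⊤ : ℕ∞) f) {R : ℝ} (hs : tsupport f ⊆ ball 0 R) (j : Fin d) :
    II R (pp j f) = 0 := by
  have hc : HasCompactSupport f :=
    (isCompact_closedBall (0 : Euc d) R).of_isClosed_subset (isClosed_tsupport f)
      (hs.trans ball_subset_closedBall)
  have hc' : HasCompactSupport (pp j f) :=
    hc.of_isClosed_subset (isClosed_tsupport _) (tsupport_pp f j)
  have h0 : II R (pp j f) = ∫ y, pp j f y := by
    apply setIntegral_eq_integral_of_forall_compl_eq_zero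
    intro y hy
    exact pp_zero_of (fun h => hy (hs h)) j
  rw [h0]
  have h1 : Integrable (fun y => fderiv ℝ f y (EuclideanSpace.single j 1)) :=
    (cont_pp hf j).integrable_of_hasCompactSupport hc'
  have h2 : Integrable f := hf.continuous.integrable_of_hasCompactSupport hc
  have := integral_mul_fderiv_eq_neg_fderiv_mul_of_integrable (𝕜 := ℝ)
    (μ := (volume : Measure (Euc d)))
    (f := fun _ => (1 : ℝ)) (g := f) (v := EuclideanSpace.single j 1)
    (by simp) (by simpa using h1) (by simpa using h2)
    (fun x _ => differentiableAt_const _) (fun x _ => hf.sdiff x)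
  have h3 : ∫ y, fderiv ℝ f y (EuclideanSpace.single j 1) = 0 := by simpa using this
  exact h3

theorem tsupport_mul_sub (W f : Euc d → ℝ) : tsupport (fun y => W y * f y) ⊆ tsupport W :=
  tsupport_mul_subset_left (f := W) (g := f)

end basics

/-! ### Energy identities -/

section identities

theorem contDiff_re {u : Euc d → ℂ} (hu : ContDiff ℝ (⊤ : ℕ∞) u) : ContDiff ℝ (⊤ : ℕ∞) (fun y => (u y).re) :=
  Complex.reCLM.contDiff.comp hu

theorem contDiff_im {u : Euc d → ℂ} (hu : ContDiff ℝ (⊤ : ℕ∞) u) : ContDiff ℝ (⊤ : ℕ∞) (fun y => (u y).im) :=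
  Complex.imCLM.contDiff.comp hu

theorem pp_re {u : Euc d → ℂ} (hu : ContDiff ℝ (⊤ : ℕ∞) u) (j : Fin d) :
    pp j (fun y => (u y).re) = fun y => (pp j u y).re := pp_clm Complex.reCLM hu j

theorem pp_im {u : Euc d → ℂ} (hu : ContDiff ℝ (⊤ : ℕ∞) u) (j : Fin d) :
    pp j (fun y => (u y).im) = fun y => (pp j u y).im := pp_clm Complex.imCLM hu j

theorem energy_id {W a : Euc d → ℝ} (hW : ContDiff ℝ (⊤ : ℕ∞) W) (ha : ContDiff ℝ (⊤ : ℕ∞) a) {R : ℝ} (hs : tsupport W ⊆ ball 0 R) :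
    II R (fun y => W y * ∑ j, (pp j a y) ^ 2 + W y * (a y * ∑ j, pp j (pp j a) y)
      - 1 / 2 * (a y ^ 2 * ∑ j, pp j (pp j W) y)) = 0 := by
  have h : ∀ j : Fin d, II R (pp j (fun y => W y * (a y * pp j a y)
      - pp j W y * (1 / 2 * (a y * a y)))) = 0 := by
    intro j
    rw [pp_sub (by fun_prop) (by fun_prop), II_sub, II_pp, II_pp, sub_zero]
    · fun_prop
    · exact (tsupport_mul_sub _ _).trans ((tsupport_pp W j).trans hs)
    · fun_prop
    · exact (tsupport_mul_sub _ _).trans hs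
    · fun_prop
    · fun_prop
  have h2 := II_sum (d := d) Finset.univ (f := fun j => pp j (fun y => W y * (a y * pp j a y)
      - pp j W y * (1 / 2 * (a y * a y)))) (fun j => by fun_prop) R
  simp only [h, Finset.sum_const_zero] at h2
  rw [← h2]
  congr 1
  funext y
  simp only [Finset.mul_sum]
  rw [← Finset.sum_add_distrib, ← Finset.sum_sub_distrib]
  apply Finset.sum_congr rfl
  intro j _
  simp (disch := fun_prop) only [pp_sub, pp_mul, pp_const]
  ring

theorem im_id {W a b : Euc d → ℝ} (hW : ContDiff ℝ (⊤ : ℕ∞) W) (ha : ContDiff ℝ (⊤ : ℕ∞) a) (hb : ContDiff ℝ (⊤ : ℕ∞) b) {R : ℝ}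
    (hs : tsupport W ⊆ ball 0 R) :
    II R (fun y => ∑ j, pp j W y * (a y * pp j b y - b y * pp j a y) +
      W y * (a y * ∑ j, pp j (pp j b) y - b y * ∑ j, pp j (pp j a) y)) = 0 := by
  have h : ∀ j : Fin d, II R (pp j (fun y => W y * (a y * pp j b y - b y * pp j a y))) = 0 := by
    intro j
    rw [II_pp]
    · fun_prop
    · exact (tsupport_mul_sub _ _).trans hs
  have h2 := II_sum (d := d) Finset.univ (f := fun j => pp j (fun y => W y *
    (a y * pp j b y - b y * pp j a y))) (fun j => by fun_prop) R
  simp only [h, Finset.sum_const_zero] at h2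
  rw [← h2]
  congr 1
  funext y
  simp only [Finset.mul_sum]
  rw [← Finset.sum_sub_distrib, Finset.mul_sum, ← Finset.sum_add_distrib]
  apply Finset.sum_congr rfl
  intro j _
  simp (disch := fun_prop) only [pp_sub, pp_mul, pp_const]
  ring

/-- Pohozaev / Morawetz identity for one real function. -/
theorem mor_id {X : Fin d → Euc d → ℝ} {a : Euc d → ℝ} (hX : ∀ i, ContDiff ℝ (⊤ : ℕ∞) (X i)) (ha : ContDiff ℝ (⊤ : ℕ∞) a) {R : ℝ}
    (hs : ∀ i, tsupport (X i) ⊆ ball 0 R) :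
    II R (fun y => 2 * ((∑ j, pp j (pp j a) y) * ∑ j, X j y * pp j a y)
      + 2 * ∑ i, ∑ j, pp i (X j) y * (pp i a y * pp j a y)
      - (∑ i, pp i (X i) y) * ∑ j, (pp j a y) ^ 2) = 0 := by
  have h : ∀ i : Fin d, II R (pp i (fun y => ∑ j, X j y * (2 * (pp i a y * pp j a y))
      - X i y * ∑ j, pp j a y * pp j a y)) = 0 := by
    intro i
    rw [pp_sub (by fun_prop) (by fun_prop), II_sub (by fun_prop) (by fun_prop)]
    have h1 : II R (pp i (fun y => X i y * ∑ j, pp j a y * pp j a y)) = 0 :=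
      II_pp (by fun_prop) ((tsupport_mul_sub _ _).trans (hs i)) i
    rw [h1, pp_sum _ (by fun_prop), II_sum _ (by fun_prop), sub_zero]
    apply Finset.sum_eq_zero
    intro j _
    exact II_pp (by fun_prop) ((tsupport_mul_sub _ _).trans (hs j)) i
  have h2 := II_sum (d := d) Finset.univ (f := fun i => pp i (fun y =>
    ∑ j, X j y * (2 * (pp i a y * pp j a y))
      - X i y * ∑ j, pp j a y * pp j a y)) (fun j => by fun_prop) R
  simp only [h, Finset.sum_const_zero] at h2
  rw [← h2]
  congr 1
  funext y
  have e : ∀ i : Fin d, pp i (fun y =>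
    ∑ j, X j y * (2 * (pp i a y * pp j a y)) - X i y * ∑ j, pp j a y * pp j a y) y =
    ∑ j, (2 * (pp i (X j) y * (pp i a y * pp j a y)) + 2 * (pp i (pp i a) y * (X j y * pp j a y))
      + 2 * (X j y * (pp i a y * pp i (pp j a) y)) - pp i (X i) y * (pp j a y) ^ 2
      - 2 * (X i y * (pp j a y * pp i (pp j a) y))) := by
    intro i
    rw [pp_sub (by fun_prop) (by fun_prop), pp_sum _ (by fun_prop), pp_mul (by fun_prop) (by fun_prop),
      pp_sum _ (by fun_prop)]
    simp only [Finset.mul_sum]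
    rw [← Finset.sum_add_distrib, ← Finset.sum_sub_distrib]
    apply Finset.sum_congr rfl
    intro j _
    simp (disch := fun_prop) only [pp_mul, pp_const]
    ring
  simp only [e, Finset.sum_add_distrib, Finset.sum_sub_distrib, ← Finset.mul_sum, ← Finset.sum_mul]
  have e2 : ∑ i, ∑ j, X j y * (pp i a y * pp i (pp j a) y) =
      ∑ i, X i y * ∑ j, pp j a y * pp i (pp j a) y := by
    rw [Finset.sum_comm]
    apply Finset.sum_congr rfl
    intro i _
    rw [Finset.mul_sum]
    apply Finset.sum_congr rfl
    intro j _
    rw [pp_comm ha]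
  rw [e2]
  ring

end identities

/-! ### Interior elliptic estimates -/

section elliptic

theorem exists_bump {r1 r2 : ℝ} (h1 : 0 < r1) (h2 : r1 < r2) :
    ∃ χ : Euc d → ℝ, ContDiff ℝ (⊤ : ℕ∞) χ ∧ tsupport χ ⊆ ball 0 r2 ∧ (∀ y, 0 ≤ χ y) ∧ (∀ y, χ y ≤ 1) ∧
      ∀ y ∈ ball (0 : Euc d) r1, χ y = 1 := by
  let f : ContDiffBump (0 : Euc d) := ⟨r1, (r1 + r2) / 2, h1, by linarith⟩
  refine ⟨f, f.contDiff, ?_, fun y => f.nonneg, fun y => f.le_one, ?_⟩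
  · rw [f.tsupport_eq]
    apply closedBall_subset_ball
    show (r1 + r2) / 2 < r2
    linarith
  · intro y hy
    exact f.one_of_mem_closedBall (ball_subset_closedBall hy)

theorem exists_bdd {f : Euc d → ℝ} (hf : Continuous f) {R : ℝ} (hs : tsupport f ⊆ ball 0 R) :
    ∃ C : ℝ, 0 ≤ C ∧ ∀ y, |f y| ≤ C := by
  have hc : HasCompactSupport f :=
    (isCompact_closedBall (0 : Euc d) R).of_isClosed_subset (isClosed_tsupport f)
      (hs.trans ball_subset_closedBall)
  obtain ⟨C, hC⟩ := hc.exists_bound_of_continuous hf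
  exact ⟨C, (norm_nonneg _).trans (hC 0), fun y => hC y⟩

theorem norm_sq_re_im (z : ℂ) : ‖z‖ ^ 2 = z.re ^ 2 + z.im ^ 2 := by
  rw [Complex.sq_norm, Complex.normSq_apply]; ring

theorem energy_est {r1 r2 : ℝ} (h1 : 0 < r1) (h2 : r1 < r2) :
    ∃ K : ℝ, 0 < K ∧ ∀ (h f : Euc d → ℂ) (μ : ℂ) (Λ : ℝ), ContDiff ℝ (⊤ : ℕ∞) h → Continuous f → 0 ≤ Λ → μ.re ≤ Λ →
      (∀ y ∈ ball (0 : Euc d) r2, ∑ j, pp j (pp j h) y = -μ * h y + f y) →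
      II r1 (fun y => ∑ j, ‖pp j h y‖ ^ 2) ≤
        (Λ + K) * II r2 (fun y => ‖h y‖ ^ 2) + II r2 (fun y => ‖f y‖ ^ 2) := by
  obtain ⟨χ, hχ, hχs, hχ0, hχ1, hχe⟩ := exists_bump (d := d) h1 h2
  have hΔs : tsupport (fun y => ∑ j, pp j (pp j χ) y) ⊆ ball 0 r2 := by
    refine Set.Subset.trans ?_ hχs
    apply closure_minimal _ (isClosed_tsupport χ)
    intro y hy
    by_contra hc
    apply hy
    apply Finset.sum_eq_zero
    intro j _
    exact pp_zero_of (fun h => hc (tsupport_pp _ _ h)) j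
  obtain ⟨K0, hK0, hK⟩ := exists_bdd (by fun_prop) hΔs
  refine ⟨K0 + 1, by linarith, ?_⟩
  intro h f μ Λ hh hf hΛ hμ heq
  have ha := contDiff_re hh
  have hb := contDiff_im hh
  have Ea := energy_id hχ ha hχs
  have Eb := energy_id hχ hb hχs
  simp (disch := fun_prop) only [pp_re, pp_im] at Ea Eb
  have hc1 : Continuous fun y => ∑ j, ‖pp j h y‖ ^ 2 := by fun_prop
  have hhc := hh.continuous
  have step1 : II r1 (fun y => ∑ j, ‖pp j h y‖ ^ 2) ≤ II r2 (fun y => χ y * ∑ j, ‖pp j h y‖ ^ 2) := by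
    calc _ = II r1 (fun y => χ y * ∑ j, ‖pp j h y‖ ^ 2) := by
          apply II_congr
          intro y hy
          rw [hχe y hy, one_mul]
      _ ≤ _ := by
          apply II_mono_set (by fun_prop) _ h2.le
          intro y
          exact mul_nonneg (hχ0 y) (Finset.sum_nonneg fun j _ => by positivity)
  refine step1.trans ?_
  have e : (Λ + (K0 + 1)) * II r2 (fun y => ‖h y‖ ^ 2) + II r2 (fun y => ‖f y‖ ^ 2) =
    II r2 (fun y => (χ y * ∑ j, (pp j h y).re ^ 2 + χ y * ((h y).re * ∑ j, (pp j (pp j h) y).re)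
      - 1 / 2 * ((h y).re ^ 2 * ∑ j, pp j (pp j χ) y)) +
      (χ y * ∑ j, (pp j h y).im ^ 2 + χ y * ((h y).im * ∑ j, (pp j (pp j h) y).im)
      - 1 / 2 * ((h y).im ^ 2 * ∑ j, pp j (pp j χ) y)) +
      ((Λ + (K0 + 1)) * ‖h y‖ ^ 2 + ‖f y‖ ^ 2)) := by
    rw [II_add (by fun_prop) (by fun_prop), II_add (by fun_prop) (by fun_prop),
      II_add (by fun_prop) (by fun_prop), Ea, Eb, II_mul]
    ring
  rw [e]
  apply II_mono (by fun_prop) (by fun_prop)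
  intro y hy
  have hre : ∑ j, (pp j (pp j h) y).re = (-μ * h y + f y).re := by
    rw [← heq y hy, Complex.re_sum]
  have him : ∑ j, (pp j (pp j h) y).im = (-μ * h y + f y).im := by
    rw [← heq y hy, Complex.im_sum]
  rw [hre, him]
  simp only [norm_sq_re_im, Finset.sum_add_distrib, Complex.add_re, Complex.add_im, Complex.mul_re,
    Complex.mul_im, Complex.neg_re, Complex.neg_im]
  have hk := abs_le.1 (hK y)
  generalize (∑ j, pp j (pp j χ) y) = D at hk
  generalize (h y).re = a
  generalize (h y).im = b
  generalize (f y).re = f1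
  generalize (f y).im = f2
  have c0 := hχ0 y
  have c1 := hχ1 y
  generalize χ y = c at *
  have n1 : 0 ≤ (a ^ 2 + b ^ 2) * (K0 - D) := mul_nonneg (by positivity) (by linarith [hk.2])
  have n2 : 0 ≤ (a ^ 2 + b ^ 2) * (K0 + D) := mul_nonneg (by positivity) (by linarith [hk.1])
  have n3 : 0 ≤ (c * (Λ - μ.re)) * (a ^ 2 + b ^ 2) := by
    apply mul_nonneg (mul_nonneg c0 (by linarith)) (by positivity)
  have n4 : 0 ≤ ((1 - c) * Λ) * (a ^ 2 + b ^ 2) := by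
    apply mul_nonneg (mul_nonneg (by linarith) hΛ) (by positivity)
  have n5 : 0 ≤ c * ((a + f1) ^ 2 + (b + f2) ^ 2) := by positivity
  have n6 : 0 ≤ (1 - c) * ((a) ^ 2 + (b) ^ 2 + f1 ^ 2 + f2 ^ 2) :=
    mul_nonneg (by linarith) (by positivity)
  have n7 : 0 ≤ a ^ 2 + b ^ 2 := by positivity
  have n8 : 0 ≤ f1 ^ 2 + f2 ^ 2 := by positivity
  have n9 := mul_nonneg n7 hK0
  linarith

/-- Sum of squares of all partial derivatives of order at most `k` (with multiplicities). -/
def AA : ℕ → (Euc d → ℂ) → Euc d → ℝ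
  | 0, u => fun y => ‖u y‖ ^ 2
  | k + 1, u => fun y => AA k u y + ∑ j, AA k (pp j u) y

theorem AA_zero (u : Euc d → ℂ) : AA 0 u = fun y => ‖u y‖ ^ 2 := rfl

theorem AA_succ (k : ℕ) (u : Euc d → ℂ) :
    AA (k + 1) u = fun y => AA k u y + ∑ j, AA k (pp j u) y := rfl

theorem AA_nonneg (k : ℕ) (u : Euc d → ℂ) (y : Euc d) : 0 ≤ AA k u y := by
  induction k generalizing u with
  | zero => simp only [AA_zero]; positivity
  | succ k ih =>
    simp only [AA_succ]
    exact add_nonneg (ih u) (Finset.sum_nonneg fun j _ => ih _)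

@[fun_prop]
theorem AA_cont (k : ℕ) {u : Euc d → ℂ} (hu : ContDiff ℝ (⊤ : ℕ∞) u) : Continuous (AA k u) := by
  induction k generalizing u with
  | zero => have := hu.continuous; simp only [AA_zero]; fun_prop
  | succ k ih =>
    simp only [AA_succ]
    exact (ih hu).add (continuous_finsetSum _ fun j _ => ih (contDiff_pp hu j))

theorem AA_le_succ (k : ℕ) (u : Euc d → ℂ) (y : Euc d) : AA k u y ≤ AA (k + 1) u y := by
  simp only [AA_succ]
  have : 0 ≤ ∑ j, AA k (pp j u) y := Finset.sum_nonneg fun j _ => AA_nonneg _ _ _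
  linarith

theorem AA_pp_le (k : ℕ) (u : Euc d → ℂ) (j : Fin d) (y : Euc d) :
    AA k (pp j u) y ≤ AA (k + 1) u y := by
  simp only [AA_succ]
  have : AA k (pp j u) y ≤ ∑ j, AA k (pp j u) y :=
    Finset.single_le_sum (f := fun j => AA k (pp j u) y)
      (fun j _ => AA_nonneg _ _ _) (Finset.mem_univ j)
  have := AA_nonneg k u y
  linarith

theorem AA_mono {k m : ℕ} (h : k ≤ m) (u : Euc d → ℂ) (y : Euc d) : AA k u y ≤ AA m u y := by
  induction m, h using Nat.le_induction with
  | base => exact le_rfl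
  | succ m _ ih => exact ih.trans (AA_le_succ m u y)

theorem AA_add (k : ℕ) {f g : Euc d → ℂ} (hf : ContDiff ℝ (⊤ : ℕ∞) f) (hg : ContDiff ℝ (⊤ : ℕ∞) g) (y : Euc d) :
    AA k (fun z => f z + g z) y ≤ 2 * AA k f y + 2 * AA k g y := by
  induction k generalizing f g with
  | zero =>
    simp only [AA_zero]
    have h1 := norm_add_le (f y) (g y)
    have h2 : ‖f y + g y‖ ^ 2 ≤ (‖f y‖ + ‖g y‖) ^ 2 := by gcongr
    nlinarith [sq_nonneg (‖f y‖ - ‖g y‖)]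
  | succ k ih =>
    simp only [AA_succ]
    have h1 : ∑ j, AA k (pp j fun z => f z + g z) y ≤
        ∑ j, (2 * AA k (pp j f) y + 2 * AA k (pp j g) y) := by
      apply Finset.sum_le_sum
      intro j _
      rw [pp_add hf hg]
      exact ih (contDiff_pp hf j) (contDiff_pp hg j)
    rw [Finset.sum_add_distrib, ← Finset.mul_sum, ← Finset.mul_sum] at h1
    linarith [ih hf hg]

theorem AA_mul (k : ℕ) (M : ℝ) : ∃ C : ℝ, 0 < C ∧ ∀ (V u : Euc d → ℂ), ContDiff ℝ (⊤ : ℕ∞) V → ContDiff ℝ (⊤ : ℕ∞) u →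
    ∀ y, AA k V y ≤ M → AA k (fun z => V z * u z) y ≤ C * AA k u y := by
  induction k with
  | zero =>
    refine ⟨|M| + 1, by positivity, ?_⟩
    intro V u _ _ y hy
    simp only [AA_zero] at *
    rw [norm_mul, mul_pow]
    gcongr
    linarith [le_abs_self M]
  | succ k ih =>
    obtain ⟨C, hC, h⟩ := ih
    refine ⟨C + 2 * d * C + 2 * C, by positivity, ?_⟩
    intro V u hV hu y hy
    have h0 : AA k V y ≤ M := (AA_le_succ k V y).trans hy
    have hj : ∀ j, AA k (pp j fun z => V z * u z) y ≤ 2 * C * AA k u y + 2 * C * AA k (pp j u) y := by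
      intro j
      rw [pp_mul hV hu]
      refine (AA_add k (by fun_prop) (by fun_prop) y).trans ?_
      have e1 := h (pp j V) u (contDiff_pp hV j) hu y ((AA_pp_le k V j y).trans hy)
      have e2 := h V (pp j u) hV (contDiff_pp hu j) y h0
      linarith
    simp only [AA_succ]
    have hs := Finset.sum_le_sum fun j (_ : j ∈ Finset.univ) => hj j
    rw [Finset.sum_add_distrib, Finset.sum_const, ← Finset.mul_sum] at hs
    simp only [Finset.card_univ, Fintype.card_fin, nsmul_eq_mul] at hs
    have hb := h V u hV hu y h0
    have p1 := AA_nonneg k u y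
    have p2 : 0 ≤ ∑ j, AA k (pp j u) y := Finset.sum_nonneg fun j _ => AA_nonneg _ _ _
    have p3 : 0 ≤ (d : ℝ) * C * ∑ j, AA k (pp j u) y := by positivity
    have p4 := mul_nonneg hC.le p1
    have p5 := mul_nonneg hC.le p2
    linarith

theorem ell_step (k : ℕ) (M : ℝ) {r1 r2 : ℝ} (h1 : 0 < r1) (h2 : r1 < r2) :
    ∃ C : ℝ, 0 < C ∧ ∀ (u f : Euc d → ℂ) (μ : ℂ), ContDiff ℝ (⊤ : ℕ∞) u → ContDiff ℝ (⊤ : ℕ∞) f → μ.re ≤ M →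
      (∀ y ∈ ball (0 : Euc d) r2, ∑ j, pp j (pp j u) y = -μ * u y + f y) →
      II r1 (fun y => ∑ j, AA k (pp j u) y) ≤ C * (II r2 (AA k u) + II r2 (AA k f)) := by
  induction k with
  | zero =>
    obtain ⟨K, hK, h⟩ := energy_est (d := d) h1 h2
    refine ⟨|M| + K + 1, by positivity, ?_⟩
    intro u f μ hu hf hμ heq
    have := h u f μ |M| hu hf.continuous (abs_nonneg _) (hμ.trans (le_abs_self _)) heq
    simp only [AA_zero]
    have n1 : 0 ≤ II r2 (fun y => ‖u y‖ ^ 2) := II_nonneg _ fun y => by positivity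
    have n2 : 0 ≤ II r2 (fun y => ‖f y‖ ^ 2) := II_nonneg _ fun y => by positivity
    have n3 : 0 ≤ (|M| + K) * II r2 (fun y => ‖f y‖ ^ 2) := by positivity
    linarith
  | succ k ih =>
    obtain ⟨C, hC, h⟩ := ih
    refine ⟨C, hC, ?_⟩
    intro u f μ hu hf hμ heq
    have hj : ∀ i : Fin d, II r1 (fun y => ∑ j, AA k (pp j (pp i u)) y) ≤
        C * (II r2 (AA k (pp i u)) + II r2 (AA k (pp i f))) := by
      intro i
      apply h (pp i u) (pp i f) μ (contDiff_pp hu i) (contDiff_pp hf i) hμ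
      intro y hy
      have := pp_congr isOpen_ball heq i y hy
      rw [pp_sum _ (by fun_prop), pp_add (by fun_prop) (by fun_prop), pp_mul (by fun_prop) hu,
        pp_const] at this
      simp only [zero_mul, zero_add] at this
      rw [← this]
      apply Finset.sum_congr rfl
      intro j _
      rw [pp_comm hu j i, pp_comm (contDiff_pp hu j) i j, pp_comm hu i j]
    have h0 := h u f μ hu hf hμ heq
    have hs := Finset.sum_le_sum fun j (_ : j ∈ Finset.univ) => hj j
    rw [← II_sum _ (by fun_prop), ← Finset.mul_sum, Finset.sum_add_distrib,
      ← II_sum _ (by fun_prop), ← II_sum _ (by fun_prop)] at hs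
    simp only [AA_succ]
    rw [II_add (by fun_prop) (by fun_prop), II_add (by fun_prop) (by fun_prop)]
    simp only [Finset.sum_add_distrib]
    rw [II_add (by fun_prop) (by fun_prop)]
    have e : (fun y => ∑ j, ∑ i, AA k (pp i (pp j u)) y) = fun y => ∑ i : Fin d, ∑ j, AA k (pp j (pp i u)) y := by
      rfl
    rw [e]
    linarith

theorem ell_est (k : ℕ) (M : ℝ) {r1 r2 : ℝ} (h1 : 0 < r1) (h2 : r1 < r2) :
    ∃ C : ℝ, 0 < C ∧ ∀ (u V : Euc d → ℂ) (μ : ℂ), ContDiff ℝ (⊤ : ℕ∞) u → ContDiff ℝ (⊤ : ℕ∞) V → μ.re ≤ M →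
      (∀ y ∈ ball (0 : Euc d) r2, ∑ j, pp j (pp j u) y = -μ * u y + V y * u y) →
      (∀ y ∈ ball (0 : Euc d) r2, AA k V y ≤ M) →
      II r1 (AA k u) ≤ C * II r2 (fun y => ‖u y‖ ^ 2) := by
  induction k generalizing r1 with
  | zero =>
    refine ⟨1, one_pos, ?_⟩
    intro u V μ hu _ _ _ _
    have := hu.continuous
    rw [one_mul, AA_zero]
    exact II_mono_set (by fun_prop) (fun y => by positivity) h2.le
  | succ k ih =>
    have h3 : r1 < (r1 + r2) / 2 := by linarith
    obtain ⟨C1, hC1, H1⟩ := ih (r1 := (r1 + r2) / 2) (by linarith) (by linarith)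
    obtain ⟨C2, hC2, H2⟩ := ell_step (d := d) k M h1 h3
    obtain ⟨C3, hC3, H3⟩ := AA_mul (d := d) k M
    refine ⟨C1 + C2 * (C1 + C3 * C1), by positivity, ?_⟩
    intro u V μ hu hV hμ heq hVM
    have hsub : ball (0 : Euc d) ((r1 + r2) / 2) ⊆ ball 0 r2 := ball_subset_ball (by linarith)
    have a1 := H1 u V μ hu hV hμ heq (fun y hy => (AA_le_succ k V y).trans (hVM y hy))
    have a2 := H2 u (fun z => V z * u z) μ hu (by fun_prop) hμ (fun y hy => heq y (hsub hy))
    have a3 : II ((r1 + r2) / 2) (AA k fun z => V z * u z) ≤ C3 * II ((r1 + r2) / 2) (AA k u) := by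
      rw [← II_mul]
      apply II_mono (by fun_prop) (by fun_prop)
      intro y hy
      exact H3 V u hV hu y ((AA_le_succ k V y).trans (hVM y (hsub hy)))
    have a4 : II r1 (AA k u) ≤ II ((r1 + r2) / 2) (AA k u) :=
      II_mono_set (by fun_prop) (AA_nonneg k u) h3.le
    simp only [AA_succ]
    rw [II_add (by fun_prop) (by fun_prop)]
    have a5 : C3 * II ((r1 + r2) / 2) (AA k u) ≤ C3 * (C1 * II r2 (fun y => ‖u y‖ ^ 2)) := by gcongr
    have a6 : C2 * (II ((r1 + r2) / 2) (AA k u) + II ((r1 + r2) / 2) (AA k fun z => V z * u z)) ≤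
      C2 * (C1 * II r2 (fun y => ‖u y‖ ^ 2) + C3 * (C1 * II r2 (fun y => ‖u y‖ ^ 2))) := by
      gcongr
      linarith
    linarith

end elliptic

/-! ### A Sobolev type bound and scaling -/

section sobolev

/-- Iterated partial derivatives along a list of indices. -/
def PD : List (Fin d) → (Euc d → ℂ) → Euc d → ℂ
  | [], f => f
  | i :: L, f => PD L (pp i f)

theorem PD_nil (f : Euc d → ℂ) : PD [] f = f := rfl

theorem PD_cons (i : Fin d) (L : List (Fin d)) (f : Euc d → ℂ) : PD (i :: L) f = PD L (pp i f) := rfl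

@[fun_prop]
theorem PD_contDiff (L : List (Fin d)) {f : Euc d → ℂ} (hf : ContDiff ℝ (⊤ : ℕ∞) f) :
    ContDiff ℝ (⊤ : ℕ∞) (PD L f) := by
  induction L generalizing f with
  | nil => exact hf
  | cons i L ih => exact ih (contDiff_pp hf i)

theorem PD_append (L1 L2 : List (Fin d)) (f : Euc d → ℂ) : PD (L1 ++ L2) f = PD L2 (PD L1 f) := by
  induction L1 generalizing f with
  | nil => rfl
  | cons i L ih => exact ih _

theorem PD_tsupport (L : List (Fin d)) (f : Euc d → ℂ) : tsupport (PD L f) ⊆ tsupport f := by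
  induction L generalizing f with
  | nil => exact le_rfl
  | cons i L ih => exact (ih _).trans (tsupport_pp f i)

theorem PD_congr (L : List (Fin d)) {f g : Euc d → ℂ} {s : Set (Euc d)} (hs : IsOpen s)
    (h : ∀ y ∈ s, f y = g y) : ∀ y ∈ s, PD L f y = PD L g y := by
  induction L generalizing f g with
  | nil => exact h
  | cons i L ih => exact ih (pp_congr hs h i)

theorem AA_PD (k : ℕ) (L : List (Fin d)) (f : Euc d → ℂ) (y : Euc d) :
    AA k (PD L f) y ≤ AA (k + L.length) f y := by
  induction L generalizing f with
  | nil => exact le_rfl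
  | cons i L ih =>
    rw [PD_cons, List.length_cons, ← add_assoc]
    exact (ih _).trans (AA_pp_le _ _ _ _)

theorem sob_marginal (L : List (Fin d)) (hL : L.Nodup) {f : Euc d → ℂ} (hf : ContDiff ℝ (⊤ : ℕ∞) f)
    (hc : HasCompactSupport f) (x : Fin d → ℝ) :
    ‖f (WithLp.toLp 2 x)‖ₑ ≤
      (∫⋯∫⁻_L.toFinset, fun z => ‖PD L f (WithLp.toLp 2 z)‖ₑ ∂(fun _ => volume)) x := by
  induction L generalizing f x with
  | nil => simp [PD_nil]
  | cons i L ih =>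
    rw [List.nodup_cons] at hL
    have hm : Measurable fun z : Fin d → ℝ => ‖PD (i :: L) f (WithLp.toLp 2 z)‖ₑ := by
      have h1 : Continuous (PD (i :: L) f) := (PD_contDiff _ hf).continuous
      have h2 : Continuous fun z : Fin d → ℝ => PD (i :: L) f (WithLp.toLp 2 z) :=
        h1.comp (PiLp.continuous_toLp 2 _)
      exact h2.enorm.measurable
    rw [List.toFinset_cons, lmarginal_insert _ hm (by simpa using hL.1)]
    have hstep : ∀ t : ℝ, ‖pp i f (WithLp.toLp 2 (Function.update x i t))‖ₑ ≤ _ := fun t =>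
      ih hL.2 (contDiff_pp hf i) (hc.of_isClosed_subset (isClosed_tsupport _) (tsupport_pp f i))
        (Function.update x i t)
    refine le_trans ?_ (lintegral_mono hstep)
    have hup : ∀ t : ℝ, WithLp.toLp 2 (Function.update x i t) =
        WithLp.toLp 2 (Function.update x i 0) + t • EuclideanSpace.single i (1 : ℝ) := by
      intro t
      ext k
      by_cases hk : k = i
      · subst hk; simp
      · simp [hk]
    let g : ℝ → ℂ := fun t => f (WithLp.toLp 2 (Function.update x i t))
    have hg : ContDiff ℝ 1 g := by
      have : g = fun t => f (WithLp.toLp 2 (Function.update x i 0) + t • EuclideanSpace.single i (1 : ℝ)) := by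
        funext t
        simp only [g]
        rw [hup]
      rw [this]
      have hf1 : ContDiff ℝ 1 f := hf.of_le (by exact_mod_cast le_top)
      fun_prop
    have hgd : ∀ t, deriv g t = pp i f (WithLp.toLp 2 (Function.update x i t)) := by
      intro t
      have hl : HasDerivAt (fun t : ℝ => WithLp.toLp 2 (Function.update x i t) )
          (EuclideanSpace.single i (1 : ℝ)) t := by
        rw [funext hup]
        have := ((hasDerivAt_id t).smul_const (EuclideanSpace.single i (1 : ℝ))).const_add
          (WithLp.toLp 2 (Function.update x i 0))
        simpa using this
      exact ((hf.sdiff _).hasFDerivAt.comp_hasDerivAt t hl).deriv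
    have hgc : HasCompactSupport g := by
      obtain ⟨R, hR⟩ := hc.isCompact.isBounded.subset_closedBall 0
      refine HasCompactSupport.of_support_subset_isCompact (isCompact_closedBall (0 : ℝ) R) ?_
      intro t ht
      have h1 := hR (subset_tsupport f ht)
      rw [mem_closedBall_zero_iff] at h1 ⊢
      have h2 := PiLp.norm_apply_le (WithLp.toLp 2 (Function.update x i t) : Euc d) i
      simp only [Function.update_self] at h2
      exact h2.trans h1
    calc ‖f (WithLp.toLp 2 x)‖ₑ = ‖g (x i)‖ₑ := by simp [g]
      _ ≤ ∫⁻ t in Set.Iic (x i), ‖deriv g t‖ₑ := hgc.enorm_le_lintegral_Ici_deriv hg _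
      _ ≤ ∫⁻ t, ‖deriv g t‖ₑ := setLIntegral_le_lintegral _ _
      _ = _ := by simp_rw [hgd]

theorem sob_l1 {f : Euc d → ℂ} (hf : ContDiff ℝ (⊤ : ℕ∞) f) {R : ℝ} (hs : tsupport f ⊆ ball 0 R) :
    ‖f 0‖ ≤ II R (fun y => ‖PD (List.finRange d) f y‖) := by
  have hc : HasCompactSupport f :=
    (isCompact_closedBall (0 : Euc d) R).of_isClosed_subset (isClosed_tsupport f)
      (hs.trans ball_subset_closedBall)
  have h := sob_marginal (List.finRange d) (List.nodup_finRange d) hf hc 0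
  have hu : (List.finRange d).toFinset = Finset.univ := by ext; simp
  rw [hu, lmarginal_univ] at h
  set g := PD (List.finRange d) f with hg
  have hgc : Continuous g := (PD_contDiff _ hf).continuous
  have hgs : tsupport g ⊆ ball 0 R := (PD_tsupport _ f).trans hs
  have h2 : ∫⁻ z : Fin d → ℝ, ‖g (WithLp.toLp 2 z)‖ₑ ∂(Measure.pi fun _ => volume) = ∫⁻ y : Euc d, ‖g y‖ₑ := by
    rw [← volume_pi]
    exact (PiLp.volume_preserving_toLp (Fin d)).lintegral_comp hgc.enorm.measurable
  have hgcs : HasCompactSupport g := hc.of_isClosed_subset (isClosed_tsupport _) (PD_tsupport _ f)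
  rw [h2, ← ofReal_integral_norm_eq_lintegral_enorm (hgc.integrable_of_hasCompactSupport hgcs)] at h
  have h3 : II R (fun y => ‖g y‖) = ∫ y, ‖g y‖ := by
    apply setIntegral_eq_integral_of_forall_compl_eq_zero
    intro y hy
    rw [image_eq_zero_of_notMem_tsupport (fun h => hy (hgs h)), norm_zero]
  rw [h3]
  rw [← ofReal_norm] at h
  exact (ENNReal.ofReal_le_ofReal_iff (integral_nonneg fun _ => norm_nonneg _)).1 h

theorem sob_l2 (R : ℝ) : ∃ C : ℝ, 0 < C ∧ ∀ f : Euc d → ℂ, ContDiff ℝ (⊤ : ℕ∞) f → tsupport f ⊆ ball 0 R →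
    ‖f 0‖ ^ 2 ≤ C * II R (AA d f) := by
  set v := II R (fun _ : Euc d => (1 : ℝ)) with hv
  have hv0 : 0 ≤ v := II_nonneg _ fun _ => zero_le_one
  refine ⟨2 * v + 2, by linarith, ?_⟩
  intro f hf hs
  have h1 := sob_l1 hf hs
  set a := ‖f 0‖ with ha
  have ha0 : 0 ≤ a := norm_nonneg _
  have hI0 : 0 ≤ II R (AA d f) := II_nonneg _ (AA_nonneg d f)
  rcases ha0.eq_or_lt with h0 | h0
  · rw [← h0]
    have : 0 ≤ (2 * v + 2) * II R (AA d f) := by positivity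
    simpa using this
  have hc : Continuous (PD (List.finRange d) f) := (PD_contDiff _ hf).continuous
  have h2 : II R (fun y => ‖PD (List.finRange d) f y‖) ≤ II R (fun y => a / (2 * v + 2) * 1 +
      (2 * v + 2) / (4 * a) * AA d f y) := by
    apply II_mono (by fun_prop) (by fun_prop)
    intro y _
    have h3 : ‖PD (List.finRange d) f y‖ ^ 2 ≤ AA d f y := by
      have := AA_PD 0 (List.finRange d) f y
      simpa [AA_zero] using this
    generalize ‖PD (List.finRange d) f y‖ = b at *
    have h4 : b ≤ a / (2 * v + 2) * 1 + (2 * v + 2) / (4 * a) * b ^ 2 := by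
      have hh : 0 < 2 * v + 2 := by linarith
      have : a / (2 * v + 2) * 1 + (2 * v + 2) / (4 * a) * b ^ 2 - b =
        (2 * a - (2 * v + 2) * b) ^ 2 / (4 * a * (2 * v + 2)) := by
        field_simp
        ring
      have h5 : 0 ≤ (2 * a - (2 * v + 2) * b) ^ 2 / (4 * a * (2 * v + 2)) := by positivity
      linarith
    refine h4.trans ?_
    gcongr
  rw [II_add (by fun_prop) (by fun_prop), II_mul, II_mul, ← hv] at h2
  have h3 := h1.trans h2
  have h5 : a / (2 * v + 2) * v ≤ a / 2 := by
    rw [div_mul_eq_mul_div, div_le_div_iff₀ (by linarith) (by norm_num)]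
    nlinarith
  have h6 : a / 2 ≤ (2 * v + 2) / (4 * a) * II R (AA d f) := by linarith
  have h7 : a / 2 * (2 * a) ≤ (2 * v + 2) / (4 * a) * II R (AA d f) * (2 * a) := by gcongr
  have h8 : (2 * v + 2) / (4 * a) * II R (AA d f) * (2 * a) = (2 * v + 2) * II R (AA d f) / 2 := by
    field_simp
    ring
  have h9 : 0 ≤ (2 * v + 2) * II R (AA d f) := by positivity
  nlinarith

theorem pt_est (L : List (Fin d)) (M : ℝ) :
    ∃ C : ℝ, 0 < C ∧ ∀ (u V : Euc d → ℂ) (μ : ℂ), ContDiff ℝ (⊤ : ℕ∞) u → ContDiff ℝ (⊤ : ℕ∞) V → μ.re ≤ M →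
      (∀ y ∈ ball (0 : Euc d) 1, ∑ j, pp j (pp j u) y = -μ * u y + V y * u y) →
      (∀ y ∈ ball (0 : Euc d) 1, AA (d + L.length) V y ≤ M) →
      ‖PD L u 0‖ ^ 2 ≤ C * II 1 (fun y => ‖u y‖ ^ 2) := by
  obtain ⟨χ, hχ, hχs, hχ0, hχ1, hχe⟩ := exists_bump (d := d) (r1 := 1 / 4) (r2 := 1 / 2)
    (by norm_num) (by norm_num)
  let X : Euc d → ℂ := fun y => (χ y : ℂ)
  have hX : ContDiff ℝ (⊤ : ℕ∞) X := Complex.ofRealCLM.contDiff.comp hχ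
  obtain ⟨M1, hM1⟩ := (isCompact_closedBall (0 : Euc d) (1 / 2)).bddAbove_image
    (AA_cont d hX).continuousOn
  obtain ⟨C1, hC1, H1⟩ := sob_l2 (d := d) (1 / 2)
  obtain ⟨C2, hC2, H2⟩ := AA_mul (d := d) d M1
  obtain ⟨C3, hC3, H3⟩ := ell_est (d := d) (d + L.length) M (r1 := 1 / 2) (r2 := 1)
    (by norm_num) (by norm_num)
  refine ⟨C1 * (C2 * C3), by positivity, ?_⟩
  intro u V μ hu hV hμ heq hVM
  have a1 := H1 (fun y => X y * PD L u y) (by fun_prop)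
    ((tsupport_mul_subset_left (f := X) (g := PD L u)).trans
      ((closure_mono (by intro y hy h; exact hy (by simp [X, h]))).trans hχs))
  have h0 : X 0 = 1 := by
    simp only [X]
    rw [hχe 0 (by simp)]
    simp
  rw [h0, one_mul] at a1
  have a2 : II (1 / 2) (AA d fun y => X y * PD L u y) ≤ C2 * II (1 / 2) (AA (d + L.length) u) := by
    rw [← II_mul]
    apply II_mono (by fun_prop) (by fun_prop)
    intro y hy
    refine (H2 X (PD L u) hX (by fun_prop) y
      (hM1 ⟨y, ball_subset_closedBall hy, rfl⟩)).trans ?_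
    gcongr
    exact AA_PD _ _ _ _
  have a3 := H3 u V μ hu hV hμ heq hVM
  calc _ ≤ _ := a1
    _ ≤ C1 * (C2 * (C3 * II 1 (fun y => ‖u y‖ ^ 2))) := by
      gcongr
      refine a2.trans ?_
      gcongr
    _ = _ := by ring

end sobolev

section scaling

theorem pp_affine {u : Euc d → ℂ} (hu : ContDiff ℝ (⊤ : ℕ∞) u) (c : ℝ) (x : Euc d) (t : ℝ) (j : Fin d) :
    pp j (fun y => c • u (x + t • y)) = fun y => (c * t) • pp j u (x + t • y) := by
  funext y
  have h1 : HasFDerivAt (fun y : Euc d => x + t • y) (t • ContinuousLinearMap.id ℝ (Euc d)) y :=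
    ((hasFDerivAt_id y).const_smul t).const_add x
  have h2 := ((hu.sdiff (x + t • y)).hasFDerivAt.comp y h1).const_smul c
  have h3 : fderiv ℝ (fun y => c • u (x + t • y)) y = _ := h2.fderiv
  simp only [pp, h3]
  simp [mul_smul]

theorem PD_affine (L : List (Fin d)) {u : Euc d → ℂ} (hu : ContDiff ℝ (⊤ : ℕ∞) u) (c : ℝ) (x : Euc d) (t : ℝ) :
    PD L (fun y => c • u (x + t • y)) = fun y => (c * t ^ L.length) • PD L u (x + t • y) := by
  induction L generalizing u c with
  | nil => simp [PD_nil]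
  | cons i L ih =>
    rw [PD_cons, pp_affine hu, ih (contDiff_pp hu i), PD_cons, List.length_cons]
    funext y
    congr 1
    ring

theorem AA_affine (k : ℕ) {u : Euc d → ℂ} (hu : ContDiff ℝ (⊤ : ℕ∞) u) (c : ℝ) (x : Euc d) {t : ℝ}
    (ht0 : 0 ≤ t) (ht : t ≤ 1) (y : Euc d) :
    AA k (fun y => c • u (x + t • y)) y ≤ c ^ 2 * AA k u (x + t • y) := by
  induction k generalizing u c with
  | zero => simp [AA_zero, mul_pow]
  | succ k ih =>
    simp only [AA_succ, mul_add]
    gcongr ?_ + ?_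
    · exact ih hu c
    · rw [Finset.mul_sum]
      gcongr with j _
      rw [pp_affine hu]
      refine (ih (contDiff_pp hu j) _).trans ?_
      have := AA_nonneg k (pp j u) (x + t • y)
      have h2 : t ^ 2 ≤ 1 := by nlinarith
      have h3 : (c * t) ^ 2 ≤ c ^ 2 := by rw [mul_pow]; nlinarith [sq_nonneg c]
      exact mul_le_mul_of_nonneg_right h3 this

theorem II_scale (g : Euc d → ℝ) {t : ℝ} (ht : 0 < t) :
    II 1 (fun y => g (t • y)) = (t ^ d)⁻¹ * II t g := by
  unfold II
  have := Measure.setIntegral_comp_smul_of_pos (volume : Measure (Euc d)) g (ball (0 : Euc d) 1) ht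
  rw [this, _root_.smul_ball ht.ne', smul_zero, Real.norm_of_nonneg ht.le, mul_one,
    finrank_euclideanSpace_fin, smul_eq_mul]

/-- Pointwise estimate at scale `t`. -/
theorem pt_scaled (L : List (Fin d)) (M : ℝ) :
    ∃ C : ℝ, 0 < C ∧ ∀ (u V : Euc d → ℂ) (μ : ℂ) (t : ℝ), ContDiff ℝ (⊤ : ℕ∞) u → ContDiff ℝ (⊤ : ℕ∞) V → 0 < t → t ≤ 1 →
      t ^ 2 * μ.re ≤ M →
      (∀ y ∈ ball (0 : Euc d) t, ∑ j, pp j (pp j u) y = -μ * u y + V y * u y) →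
      (∀ y ∈ ball (0 : Euc d) t, AA (d + L.length) V y ≤ M) →
      (t ^ L.length) ^ 2 * ‖PD L u 0‖ ^ 2 ≤ C * ((t ^ d)⁻¹ * II t (fun y => ‖u y‖ ^ 2)) := by
  obtain ⟨C, hC, H⟩ := pt_est L M
  refine ⟨C, hC, ?_⟩
  intro u V μ t hu hV ht0 ht1 hμ heq hVM
  have hb : ∀ y ∈ ball (0 : Euc d) 1, t • y ∈ ball (0 : Euc d) t := by
    intro y hy
    rw [mem_ball_zero_iff] at *
    rw [norm_smul, Real.norm_of_nonneg ht0.le]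
    nlinarith
  have h := H (fun y => (1 : ℝ) • u (0 + t • y)) (fun y => (t ^ 2) • V (0 + t • y)) (t ^ 2 * μ)
    (by fun_prop) (by fun_prop) (by
      have : (t ^ 2 * μ : ℂ).re = t ^ 2 * μ.re := by
        rw [← Complex.ofReal_pow, Complex.re_ofReal_mul]
      rw [this]; exact hμ) ?_ ?_
  · rw [PD_affine L hu, ← II_scale _ ht0] at *
    simpa [norm_smul, mul_pow, abs_of_pos ht0] using h
  · intro y hy
    have e := heq _ (hb y hy)
    simp (disch := fun_prop) only [pp_affine]
    rw [← Finset.smul_sum]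
    simp only [zero_add, one_mul, one_smul]
    rw [e]
    simp only [Complex.real_smul]
    push_cast
    ring
  · intro y hy
    have e := hVM _ (hb y hy)
    refine (AA_affine _ hV _ 0 ht0.le ht1 y).trans ?_
    rw [zero_add]
    have h0 := AA_nonneg (d + L.length) V (t • y)
    have : (t ^ 2) ^ 2 ≤ 1 := pow_le_one₀ (by positivity) (pow_le_one₀ ht0.le ht1)
    nlinarith

end scaling

/-! ### The Morawetz weight -/

section weights

theorem tsupport_lap (χ : Euc d → ℝ) : tsupport (fun y => ∑ j, pp j (pp j χ) y) ⊆ tsupport χ := by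
  apply closure_minimal _ (isClosed_tsupport χ)
  intro y hy
  by_contra hc
  apply hy
  apply Finset.sum_eq_zero
  intro j _
  exact pp_zero_of (fun h => hc (tsupport_pp _ _ h)) j

theorem lap_mul {f g : Euc d → ℝ} (hf : ContDiff ℝ (⊤ : ℕ∞) f) (hg : ContDiff ℝ (⊤ : ℕ∞) g) (y : Euc d) :
    ∑ j, pp j (pp j (fun z => f z * g z)) y = f y * ∑ j, pp j (pp j g) y
      + 2 * ∑ j, pp j f y * pp j g y + g y * ∑ j, pp j (pp j f) y := by
  simp only [Finset.mul_sum]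
  rw [← Finset.sum_add_distrib, ← Finset.sum_add_distrib]
  apply Finset.sum_congr rfl
  intro j _
  simp (disch := fun_prop) only [pp_mul, pp_add]
  ring

theorem lap_add {f g : Euc d → ℝ} (hf : ContDiff ℝ (⊤ : ℕ∞) f) (hg : ContDiff ℝ (⊤ : ℕ∞) g) (y : Euc d) :
    ∑ j, pp j (pp j (fun z => f z + g z)) y = ∑ j, pp j (pp j f) y + ∑ j, pp j (pp j g) y := by
  rw [← Finset.sum_add_distrib]
  apply Finset.sum_congr rfl
  intro j _
  simp (disch := fun_prop) only [pp_add]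

@[fun_prop]
theorem contDiff_coord (j : Fin d) : ContDiff ℝ (⊤ : ℕ∞) (fun y : Euc d => y j) :=
  (EuclideanSpace.proj (𝕜 := ℝ) j).contDiff

theorem pp_coord (i j : Fin d) :
    pp i (fun y : Euc d => y j) = fun _ => if i = j then 1 else 0 := by
  funext y
  have : fderiv ℝ (fun y : Euc d => y j) y = EuclideanSpace.proj (𝕜 := ℝ) j :=
    (EuclideanSpace.proj (𝕜 := ℝ) j).hasFDerivAt.fderiv
  simp [pp, this, eq_comm]

/-- The function `1 / √(ρ² + |y|²)`. -/
def sg (ρ : ℝ) : Euc d → ℝ := fun y => (Real.sqrt (ρ ^ 2 + ∑ j, y j * y j))⁻¹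

variable {ρ : ℝ}

theorem qpos (hρ : 0 < ρ) (y : Euc d) : 0 < ρ ^ 2 + ∑ j, y j * y j := by
  have : 0 ≤ ∑ j, y j * y j := Finset.sum_nonneg fun j _ => mul_self_nonneg _
  positivity

theorem sg_pos (hρ : 0 < ρ) (y : Euc d) : 0 < sg ρ y :=
  inv_pos.2 (Real.sqrt_pos.2 (qpos hρ y))

theorem sg_sq (hρ : 0 < ρ) (y : Euc d) : sg ρ y * sg ρ y * (ρ ^ 2 + ∑ j, y j * y j) = 1 := by
  unfold sg
  have h := Real.mul_self_sqrt (qpos hρ y).le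
  rw [← mul_inv, h]
  exact inv_mul_cancel₀ (qpos hρ y).ne'

theorem sg_contDiff (hρ : 0 < ρ) : ContDiff ℝ (⊤ : ℕ∞) (sg (d := d) ρ) := by
  have h : ContDiff ℝ (⊤ : ℕ∞) (fun y : Euc d => ρ ^ 2 + ∑ j, y j * y j) := by fun_prop
  exact (h.sqrt (fun y => (qpos hρ y).ne')).inv (fun y => (Real.sqrt_pos.2 (qpos hρ y)).ne')

theorem pp_sg (hρ : 0 < ρ) (i : Fin d) : pp i (sg ρ) = fun y : Euc d => - (y i * (sg ρ y * sg ρ y * sg ρ y)) := by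
  funext y
  have hs := sg_contDiff (d := d) hρ
  have h : pp i (fun y : Euc d => sg ρ y * sg ρ y * (ρ ^ 2 + ∑ j, y j * y j)) y = 0 := by
    rw [funext (sg_sq hρ), pp_const]
  simp (disch := fun_prop) only [pp_mul, pp_add, pp_const, pp_sum, pp_coord] at h
  have e : ∑ j, ((if i = j then (1 : ℝ) else 0) * y j + y j * if i = j then 1 else 0) = 2 * y i := by
    simp [Finset.sum_add_distrib]; ring
  rw [e] at h
  have h1 := sg_sq hρ y
  linear_combination (sg ρ y / 2) * h - pp i (sg ρ) y * h1

theorem nsg (hρ : 0 < ρ) (y : Euc d) : (∑ j, y j * y j) * (sg ρ y * sg ρ y) = 1 - ρ ^ 2 * (sg ρ y * sg ρ y) := by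
  linear_combination sg_sq hρ y

theorem rho_sg_sq (hρ : 0 < ρ) (y : Euc d) : ρ ^ 2 * (sg ρ y * sg ρ y) ≤ 1 := by
  have h1 := nsg hρ y
  have h2 : 0 ≤ (∑ j, y j * y j) * (sg ρ y * sg ρ y) :=
    mul_nonneg (Finset.sum_nonneg fun j _ => mul_self_nonneg _) (mul_self_nonneg _)
  linarith

theorem coord_sg (hρ : 0 < ρ) (y : Euc d) (j : Fin d) : |y j * sg ρ y| ≤ 1 := by
  have h1 := nsg hρ y
  have h2 : y j * y j ≤ ∑ j, y j * y j :=
    Finset.single_le_sum (f := fun j => y j * y j) (fun j _ => mul_self_nonneg _) (Finset.mem_univ j)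
  have h3 : 0 ≤ sg ρ y * sg ρ y := mul_self_nonneg _
  rw [abs_le_one_iff_mul_self_le_one]
  nlinarith [mul_le_mul_of_nonneg_right h2 h3, mul_nonneg (sq_nonneg ρ) h3]

theorem lap_sg (hρ : 0 < ρ) (y : Euc d) : ∑ j, pp j (pp j (sg ρ)) y =
    (3 - d) * sg ρ y ^ 3 - 3 * ρ ^ 2 * sg ρ y ^ 5 := by
  have hs := sg_contDiff (d := d) hρ
  have e : ∀ j : Fin d, pp j (pp j (sg ρ)) y = - sg ρ y ^ 3 + 3 * (y j * y j) * sg ρ y ^ 5 := by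
    intro j
    rw [pp_sg hρ]
    have : (fun y : Euc d => -(y j * (sg ρ y * sg ρ y * sg ρ y))) =
      fun y => (-1) * (y j * (sg ρ y * sg ρ y * sg ρ y)) := by funext y; ring
    rw [this]
    simp (disch := fun_prop) only [pp_mul, pp_const, pp_coord, pp_sg hρ]
    simp only [if_true]
    ring
  simp only [e, Finset.sum_add_distrib, Finset.sum_const, Finset.card_univ, Fintype.card_fin,
    nsmul_eq_mul, ← Finset.sum_mul, ← Finset.mul_sum]
  linear_combination 3 * sg ρ y ^ 3 * nsg hρ y

theorem pp_sg3 (hρ : 0 < ρ) (j : Fin d) : pp j (fun y : Euc d => sg ρ y * sg ρ y * sg ρ y) =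
    fun y => -3 * (y j * sg ρ y ^ 5) := by
  have hs := sg_contDiff (d := d) hρ
  funext y
  simp (disch := fun_prop) only [pp_mul, pp_sg hρ]
  ring

theorem lap_sg3 (hρ : 0 < ρ) (y : Euc d) : ∑ j, pp j (pp j (fun y : Euc d => sg ρ y * sg ρ y * sg ρ y)) y =
    (15 - 3 * d) * sg ρ y ^ 5 - 15 * ρ ^ 2 * sg ρ y ^ 7 := by
  have hs := sg_contDiff (d := d) hρ
  have e : ∀ j : Fin d, pp j (pp j (fun y : Euc d => sg ρ y * sg ρ y * sg ρ y)) y =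
      - 3 * sg ρ y ^ 5 + 15 * (y j * y j) * sg ρ y ^ 7 := by
    intro j
    rw [pp_sg3 hρ]
    have : (fun y : Euc d => -3 * (y j * sg ρ y ^ 5)) =
      fun y => (-3) * (y j * (sg ρ y * sg ρ y * sg ρ y * sg ρ y * sg ρ y)) := by funext y; ring
    rw [this]
    simp (disch := fun_prop) only [pp_mul, pp_const, pp_coord, pp_sg hρ]
    simp only [if_true]
    ring
  simp only [e, Finset.sum_add_distrib, Finset.sum_const, Finset.card_univ, Fintype.card_fin,
    nsmul_eq_mul, ← Finset.sum_mul, ← Finset.mul_sum]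
  linear_combination 15 * sg ρ y ^ 5 * nsg hρ y

end weights

/-! ### Bounds for the Morawetz weights -/

section wbounds

variable {ρ : ℝ}

theorem exists_bdd_fam {ι : Type*} [Fintype ι] {f : ι → Euc d → ℝ} (hf : ∀ i, Continuous (f i)) {R : ℝ}
    (hs : ∀ i, tsupport (f i) ⊆ ball 0 R) :
    ∃ C : ℝ, 0 ≤ C ∧ ∀ i y, |f i y| ≤ C := by
  choose C h0 h using fun i => exists_bdd (hf i) (hs i)
  refine ⟨∑ i, C i, Finset.sum_nonneg fun i _ => h0 i, fun i y => (h i y).trans ?_⟩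
  exact Finset.single_le_sum (f := C) (fun i _ => h0 i) (Finset.mem_univ i)

/-- `p = (d-1) σ + ρ² σ³`. -/
def pw (d : ℕ) (ρ : ℝ) : Euc d → ℝ := fun y =>
  ((d : ℝ) - 1) * sg ρ y + ρ ^ 2 * (sg ρ y * sg ρ y * sg ρ y)

theorem pw_contDiff (hρ : 0 < ρ) : ContDiff ℝ (⊤ : ℕ∞) (pw d ρ) := by
  have hs := sg_contDiff (d := d) hρ
  unfold pw
  fun_prop

theorem pw_bdd (hρ : 0 < ρ) (y : Euc d) : |pw d ρ y| ≤ (d + 2) * sg ρ y := by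
  have h1 := rho_sg_sq hρ y
  have h2 := sg_pos hρ y
  have hd : (0 : ℝ) ≤ d := by positivity
  have e : pw d ρ y = sg ρ y * ((d : ℝ) - 1 + ρ ^ 2 * (sg ρ y * sg ρ y)) := by unfold pw; ring
  have h3 : 0 ≤ ρ ^ 2 * (sg ρ y * sg ρ y) := by positivity
  rw [e, abs_mul, abs_of_pos h2, mul_comm]
  gcongr
  rw [abs_le]; constructor <;> linarith

theorem pp_pw_bdd (hρ : 0 < ρ) (y : Euc d) (j : Fin d) :
    |pp j (pw d ρ) y| ≤ (d + 4) * (sg ρ y * sg ρ y) := by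
  have hs := sg_contDiff (d := d) hρ
  have h1 := rho_sg_sq hρ y
  have h2 := sg_pos hρ y
  have hd : (0 : ℝ) ≤ d := by positivity
  have h3 : 0 ≤ ρ ^ 2 * (sg ρ y * sg ρ y) := by positivity
  have e : pp j (pw d ρ) y = (y j * sg ρ y) * ((sg ρ y * sg ρ y) *
      (-((d : ℝ) - 1) - 3 * (ρ ^ 2 * (sg ρ y * sg ρ y)))) := by
    unfold pw
    rw [pp_add (by fun_prop) (by fun_prop), pp_mul (by fun_prop) (by fun_prop),
      pp_mul (by fun_prop) (by fun_prop), pp_const, pp_const, pp_sg hρ, pp_sg3 hρ]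
    ring
  rw [e, abs_mul, abs_mul (sg ρ y * sg ρ y)]
  have h4 := coord_sg hρ y j
  have h5 : |(-((d : ℝ) - 1) - 3 * (ρ ^ 2 * (sg ρ y * sg ρ y)))| ≤ (d : ℝ) + 4 := by
    rw [abs_le]; constructor <;> linarith
  rw [abs_of_nonneg (mul_self_nonneg (sg ρ y))]
  calc _ ≤ 1 * (sg ρ y * sg ρ y * (d + 4)) := by gcongr
    _ = _ := by ring

theorem lap_mul_const (c : ℝ) {f : Euc d → ℝ} (hf : ContDiff ℝ (⊤ : ℕ∞) f) (y : Euc d) :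
    ∑ j, pp j (pp j (fun z => c * f z)) y = c * ∑ j, pp j (pp j f) y := by
  rw [lap_mul (by fun_prop) hf]
  simp [pp_const]

theorem lap_pw_bdd (hρ : 0 < ρ) (y : Euc d) :
    |∑ j, pp j (pp j (pw d ρ)) y| ≤ ((d + 1) * (d + 6) + 3 * d + 30) * sg ρ y ^ 3 := by
  have hs := sg_contDiff (d := d) hρ
  have h1 := rho_sg_sq hρ y
  have h2 := sg_pos hρ y
  have hd : (0 : ℝ) ≤ d := by positivity
  set z := ρ ^ 2 * (sg ρ y * sg ρ y) with hz
  have h3 : 0 ≤ z := by positivity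
  have e : ∑ j, pp j (pp j (pw d ρ)) y = ((d - 1) * (3 - d) - 3 * (d - 1) * z + (15 - 3 * d) * z
      - 15 * (z * z)) * sg ρ y ^ 3 := by
    unfold pw
    rw [lap_add (by fun_prop) (by fun_prop), lap_mul_const _ (by fun_prop),
      lap_mul_const _ (by fun_prop), lap_sg hρ, lap_sg3 hρ, hz]
    ring
  rw [e, abs_mul, abs_of_pos (pow_pos h2 3)]
  gcongr
  rw [abs_le]; constructor <;> nlinarith [mul_nonneg hd h3, mul_nonneg hd (sub_nonneg.2 h1), mul_nonneg h3 (sub_nonneg.2 h1)]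

theorem lap_sg_bdd (hρ : 0 < ρ) (y : Euc d) :
    |∑ j, pp j (pp j (sg ρ)) y| ≤ (d + 6) * sg ρ y ^ 3 := by
  have h1 := rho_sg_sq hρ y
  have h2 := sg_pos hρ y
  have hd : (0 : ℝ) ≤ d := by positivity
  have h3 : 0 ≤ ρ ^ 2 * (sg ρ y * sg ρ y) := by positivity
  have e : (3 - d) * sg ρ y ^ 3 - 3 * ρ ^ 2 * sg ρ y ^ 5 =
    ((3 - d) - 3 * (ρ ^ 2 * (sg ρ y * sg ρ y))) * sg ρ y ^ 3 := by ring
  rw [lap_sg hρ, e, abs_mul, abs_of_pos (pow_pos h2 3)]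
  gcongr
  rw [abs_le]; constructor <;> linarith

theorem lap_sg3_bdd (hρ : 0 < ρ) (y : Euc d) :
    |ρ ^ 2 * ∑ j, pp j (pp j (fun y : Euc d => sg ρ y * sg ρ y * sg ρ y)) y| ≤ (3 * d + 30) * sg ρ y ^ 3 := by
  have h1 := rho_sg_sq hρ y
  have h2 := sg_pos hρ y
  have hd : (0 : ℝ) ≤ d := by positivity
  set z := ρ ^ 2 * (sg ρ y * sg ρ y) with hz
  have h3 : 0 ≤ z := by positivity
  have e : ρ ^ 2 * ((15 - 3 * d) * sg ρ y ^ 5 - 15 * ρ ^ 2 * sg ρ y ^ 7) =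
    ((15 - 3 * d) * z - 15 * (z * z)) * sg ρ y ^ 3 := by rw [hz]; ring
  rw [lap_sg3 hρ, e, abs_mul, abs_of_pos (pow_pos h2 3)]
  gcongr
  rw [abs_le]; constructor <;> nlinarith [mul_nonneg hd h3, mul_nonneg hd (sub_nonneg.2 h1), mul_nonneg h3 (sub_nonneg.2 h1)]

theorem abs_sum_bdd {f : Fin d → ℝ} {c : ℝ} (h : ∀ j, |f j| ≤ c) : |∑ j, f j| ≤ d * c := by
  refine (Finset.abs_sum_le_sum_abs _ _).trans ((Finset.sum_le_sum fun j _ => h j).trans ?_)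
  simp

theorem sum_sq_le (ξ : Fin d → ℝ) : (∑ j, |ξ j|) ^ 2 ≤ d * ∑ j, ξ j ^ 2 := by
  have := sq_sum_le_card_mul_sum_sq (s := (Finset.univ : Finset (Fin d))) (f := fun j => |ξ j|)
  simpa using this

set_option maxHeartbeats 1000000 in
theorem weights {r1 r2 : ℝ} (h1 : 0 < r1) (h2 : r1 < r2) :
    ∃ c : ℝ, 0 < c ∧ ∀ ρ : ℝ, 0 < ρ → ρ ≤ 1 → ∃ (X : Fin d → Euc d → ℝ) (W : Euc d → ℝ),
      (∀ j, ContDiff ℝ (⊤ : ℕ∞) (X j)) ∧ (∀ j, tsupport (X j) ⊆ ball 0 r2) ∧ ContDiff ℝ (⊤ : ℕ∞) W ∧ tsupport W ⊆ ball 0 r2 ∧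
      (∀ j y, |X j y| ≤ 1) ∧ (∀ y, 0 ≤ W y) ∧
      (∀ y (ξ : Fin d → ℝ), (W y - c) * ∑ j, ξ j ^ 2 ≤ ∑ i, ∑ j, pp i (X j) y * (ξ i * ξ j)) ∧
      (∀ y, |∑ j, pp j (pp j (fun z => ∑ i, pp i (X i) z)) y| ≤ c * ((ρ ^ 2)⁻¹ * (W y + 1))) ∧
      (∀ y, |∑ j, pp j (pp j W) y| ≤ c * ((ρ ^ 2)⁻¹ * (W y + 1))) ∧
      (ρ ≤ r1 → ∀ y ∈ ball (0 : Euc d) ρ, (8 * ρ)⁻¹ ≤ W y) := by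
  obtain ⟨χ, hχ, hχs, hχ0, hχ1, hχe⟩ := exists_bump (d := d) h1 h2
  -- the radial derivative of the cut-off
  obtain ⟨θ, hθ⟩ : ∃ θ : Euc d → ℝ, θ = fun y => ∑ j, y j * pp j χ y := ⟨_, rfl⟩
  have hθc : ContDiff ℝ (⊤ : ℕ∞) (θ) := by rw [hθ]; fun_prop
  have hθs : tsupport θ ⊆ ball 0 r2 := by
    refine Set.Subset.trans (closure_minimal ?_ (isClosed_tsupport χ)) hχs
    intro y hy
    by_contra hc
    apply hy
    rw [hθ]
    exact Finset.sum_eq_zero fun j _ => by rw [pp_zero_of hc]; simp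
  obtain ⟨C1, hC1, b1⟩ := exists_bdd_fam (f := fun j => pp j χ) (fun j => by fun_prop)
    (fun j => (tsupport_pp χ j).trans hχs)
  obtain ⟨C2, hC2, b2⟩ := exists_bdd (f := fun y => ∑ j, pp j (pp j χ) y) (by fun_prop)
    ((tsupport_lap χ).trans hχs)
  obtain ⟨C3, hC3, b3⟩ := exists_bdd_fam (f := fun j => pp j θ) (fun j => by fun_prop)
    (fun j => (tsupport_pp θ j).trans hθs)
  obtain ⟨C4, hC4, b4⟩ := exists_bdd (f := fun y => ∑ j, pp j (pp j θ) y) (by fun_prop)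
    ((tsupport_lap θ).trans hθs)
  obtain ⟨C0, hC0⟩ : ∃ C0, C0 = C1 + C2 + C3 + C4 := ⟨_, rfl⟩
  replace b1 : ∀ j y, |pp j χ y| ≤ C0 := fun j y => (b1 j y).trans (by linarith)
  replace b2 : ∀ y, |∑ j, pp j (pp j χ) y| ≤ C0 := fun y => (b2 y).trans (by linarith)
  replace b3 : ∀ j y, |pp j θ y| ≤ C0 := fun j y => (b3 j y).trans (by linarith)
  replace b4 : ∀ y, |∑ j, pp j (pp j θ) y| ≤ C0 := fun y => (b4 y).trans (by linarith)
  have hC0' : 0 ≤ C0 := by linarith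
  have hd : (0 : ℝ) ≤ d := by positivity
  obtain ⟨c1, hc1⟩ : ∃ c1 : ℝ, c1 = (d + 1) * (d + 6) + 3 * d + 30 := ⟨_, rfl⟩
  obtain ⟨c2, hc2⟩ : ∃ c2 : ℝ, c2 = 2 * (d * (C0 * (d + 4))) + (d + 2) * C0 + d * C0 * (d + 6)
    + 2 * (d * C0) + C0 + 6 * (d * C0) := ⟨_, rfl⟩
  have hc1' : 0 < c1 := by rw [hc1]; positivity
  have hc2' : 0 ≤ c2 := by rw [hc2]; positivity
  refine ⟨c1 + c2 + C0 * d, by positivity, ?_⟩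
  intro ρ hρ hρ1
  have hs := sg_contDiff (d := d) hρ
  have hp := pw_contDiff (d := d) hρ
  have ht : 0 < (ρ ^ 2)⁻¹ := by positivity
  have ht1 : 1 ≤ (ρ ^ 2)⁻¹ := (one_le_inv₀ (by positivity)).2 (pow_le_one₀ hρ.le hρ1)
  have hss : ∀ y : Euc d, sg ρ y * sg ρ y ≤ (ρ ^ 2)⁻¹ := by
    intro y
    have := rho_sg_sq hρ y
    rw [← one_div, le_div_iff₀ (by positivity)]
    linarith
  have hs1 : ∀ y : Euc d, sg ρ y ≤ (ρ ^ 2)⁻¹ := by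
    intro y
    by_cases h : sg ρ y ≤ 1
    · exact h.trans ht1
    · push Not at h
      nlinarith [hss y]
  refine ⟨fun j y => χ y * (y j * sg ρ y), fun y => χ y * (ρ ^ 2 * (sg ρ y * sg ρ y * sg ρ y)),
    fun j => by fun_prop, fun j => (tsupport_mul_sub _ _).trans hχs, by fun_prop,
    (tsupport_mul_sub _ _).trans hχs, ?_, ?_, ?_, ?_, ?_, ?_⟩
  · intro j y
    rw [abs_mul, abs_of_nonneg (hχ0 y)]
    exact mul_le_one₀ (hχ1 y) (abs_nonneg _) (coord_sg hρ y j)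
  · intro y
    have := sg_pos hρ y
    have := hχ0 y
    positivity
  · intro y ξ
    beta_reduce
    have e : ∀ i j : Fin d, pp i (fun y : Euc d => χ y * (y j * sg ρ y)) y * (ξ i * ξ j) =
        (pp i χ y * ξ i) * (y j * sg ρ y * ξ j) + χ y * sg ρ y * ((if i = j then 1 else 0) * (ξ i * ξ j))
          - χ y * sg ρ y ^ 3 * ((y i * ξ i) * (y j * ξ j)) := by
      intro i j
      simp (disch := fun_prop) only [pp_mul, pp_coord, pp_sg hρ]
      ring
    have e2 : ∑ i, ∑ j, pp i (fun y : Euc d => χ y * (y j * sg ρ y)) y * (ξ i * ξ j) =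
        (∑ i, pp i χ y * ξ i) * (∑ j, y j * sg ρ y * ξ j) + χ y * sg ρ y * ∑ i, ξ i ^ 2
          - χ y * sg ρ y ^ 3 * ((∑ i, y i * ξ i) * ∑ i, y i * ξ i) := by
      simp only [e, Finset.sum_add_distrib, Finset.sum_sub_distrib, Finset.sum_mul_sum,
        ← Finset.mul_sum]
      simp [pow_two]
    rw [e2]
    obtain ⟨Y, hY⟩ : ∃ Y, Y = ∑ i, |ξ i| := ⟨_, rfl⟩
    have hY0 : 0 ≤ Y := by rw [hY]; exact Finset.sum_nonneg fun i _ => abs_nonneg _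
    have f1 : |∑ i, pp i χ y * ξ i| ≤ C0 * Y := by
      rw [hY, Finset.mul_sum]
      refine (Finset.abs_sum_le_sum_abs _ _).trans (Finset.sum_le_sum fun i _ => ?_)
      rw [abs_mul]
      gcongr
      exact b1 i y
    have f2 : |∑ j, y j * sg ρ y * ξ j| ≤ Y := by
      rw [hY]
      refine (Finset.abs_sum_le_sum_abs _ _).trans (Finset.sum_le_sum fun i _ => ?_)
      rw [abs_mul]
      exact mul_le_of_le_one_left (abs_nonneg _) (coord_sg hρ y i)
    have f3 : -(C0 * Y * Y) ≤ (∑ i, pp i χ y * ξ i) * (∑ j, y j * sg ρ y * ξ j) := by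
      have : |(∑ i, pp i χ y * ξ i) * (∑ j, y j * sg ρ y * ξ j)| ≤ C0 * Y * Y := by
        rw [abs_mul]; gcongr
      exact (abs_le.1 this).1
    have f4 : Y ^ 2 ≤ d * ∑ i, ξ i ^ 2 := by rw [hY]; exact sum_sq_le ξ
    have f5 : (∑ i, y i * ξ i) * (∑ i, y i * ξ i) ≤ (∑ j, y j * y j) * ∑ i, ξ i ^ 2 := by
      have := Finset.sum_mul_sq_le_sq_mul_sq Finset.univ (fun i => y i) ξ
      simpa only [pow_two] using this
    obtain ⟨Q, hQ⟩ : ∃ Q, Q = ∑ i, ξ i ^ 2 := ⟨_, rfl⟩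
    have hQ0 : 0 ≤ Q := by rw [hQ]; exact Finset.sum_nonneg fun i _ => sq_nonneg _
    rw [← hQ] at f4 f5 ⊢
    have hsp := sg_pos hρ y
    have hsχ : 0 ≤ χ y * sg ρ y ^ 3 := mul_nonneg (hχ0 y) (pow_nonneg hsp.le 3)
    have f6 := mul_le_mul_of_nonneg_left f5 hsχ
    have f7 : χ y * sg ρ y ^ 3 * ((∑ j, y j * y j) * Q) =
        χ y * sg ρ y * Q - χ y * (ρ ^ 2 * (sg ρ y * sg ρ y * sg ρ y)) * Q := by
      linear_combination χ y * sg ρ y * Q * nsg hρ y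
    have f8 : C0 * Y * Y ≤ C0 * d * Q := by nlinarith
    have f9 : 0 ≤ (c1 + c2) * Q := by positivity
    linarith
  · have eD : (fun z => ∑ i, pp i (fun y : Euc d => χ y * (y i * sg ρ y)) z) =
        fun z => χ z * pw d ρ z + θ z * sg ρ z := by
      funext z
      simp (disch := fun_prop) only [pp_mul, pp_coord, pp_sg hρ]
      simp only [hθ, pw, Finset.sum_add_distrib, ← Finset.mul_sum, Finset.sum_mul]
      have e3 : ∑ i, z i * -(z i * (sg ρ z * sg ρ z * sg ρ z)) =
        - ((∑ i, z i * z i) * (sg ρ z * sg ρ z * sg ρ z)) := by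
        rw [Finset.sum_mul, ← Finset.sum_neg_distrib]
        exact Finset.sum_congr rfl fun i _ => by ring
      rw [e3]
      have e4 : ∑ i, pp i χ z * (z i * sg ρ z) = ∑ i, z i * pp i χ z * sg ρ z :=
        Finset.sum_congr rfl fun i _ => by ring
      rw [e4]
      simp
      linear_combination - χ z * sg ρ z * nsg hρ z
    intro y
    beta_reduce
    rw [eD, lap_add (by fun_prop) (by fun_prop), lap_mul (by fun_prop) (by fun_prop),
      lap_mul (by fun_prop) (by fun_prop)]
    have hsp := sg_pos hρ y
    have g1 : |χ y * ∑ j, pp j (pp j (pw d ρ)) y| ≤ c1 * (χ y * sg ρ y ^ 3) := by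
      rw [abs_mul, abs_of_nonneg (hχ0 y)]
      have := lap_pw_bdd hρ y
      rw [← hc1] at this
      calc _ ≤ χ y * (c1 * sg ρ y ^ 3) := mul_le_mul_of_nonneg_left this (hχ0 y)
        _ = _ := by ring
    have g2 : |∑ j, pp j χ y * pp j (pw d ρ) y| ≤ d * (C0 * ((d + 4) * (ρ ^ 2)⁻¹)) := by
      apply abs_sum_bdd
      intro j
      rw [abs_mul]
      gcongr
      · exact b1 j y
      · exact (pp_pw_bdd hρ y j).trans (by gcongr; exact hss y)
    have g3 : |pw d ρ y * ∑ j, pp j (pp j χ) y| ≤ (d + 2) * (ρ ^ 2)⁻¹ * C0 := by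
      rw [abs_mul]
      gcongr
      · exact (pw_bdd hρ y).trans (by gcongr; exact hs1 y)
      · exact b2 y
    have g4 : |θ y * ∑ j, pp j (pp j (sg ρ)) y| ≤ d * C0 * ((d + 6) * (ρ ^ 2)⁻¹) := by
      have k1 : |θ y * sg ρ y| ≤ d * C0 := by
        simp only [hθ, Finset.sum_mul]
        apply abs_sum_bdd
        intro j
        have : y j * pp j χ y * sg ρ y = (y j * sg ρ y) * pp j χ y := by ring
        rw [this, abs_mul]
        calc _ ≤ 1 * C0 := by
              gcongr
              · exact coord_sg hρ y j
              · exact b1 j y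
          _ = C0 := one_mul _
      rw [abs_mul]
      calc |θ y| * |∑ j, pp j (pp j (sg ρ)) y| ≤ |θ y| * ((d + 6) * sg ρ y ^ 3) := by
            gcongr; exact lap_sg_bdd hρ y
        _ = |θ y * sg ρ y| * ((d + 6) * (sg ρ y * sg ρ y)) := by
            rw [abs_mul, abs_of_pos hsp]; ring
        _ ≤ _ := by gcongr; exact hss y
    have g5 : |∑ j, pp j θ y * pp j (sg ρ) y| ≤ d * (C0 * (ρ ^ 2)⁻¹) := by
      apply abs_sum_bdd
      intro j
      rw [abs_mul]
      gcongr
      · exact b3 j y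
      · have : pp j (sg ρ) y = - ((y j * sg ρ y) * (sg ρ y * sg ρ y)) := by
          rw [pp_sg hρ]; ring
        rw [this, abs_neg, abs_mul, abs_of_nonneg (mul_self_nonneg (sg ρ y))]
        calc _ ≤ 1 * (ρ ^ 2)⁻¹ := by
              gcongr
              · exact coord_sg hρ y j
              · exact hss y
          _ = _ := one_mul _
    have g6 : |sg ρ y * ∑ j, pp j (pp j θ) y| ≤ (ρ ^ 2)⁻¹ * C0 := by
      rw [abs_mul, abs_of_pos hsp]
      gcongr
      · exact hs1 y
      · exact b4 y
    have gW : χ y * sg ρ y ^ 3 = (ρ ^ 2)⁻¹ * (χ y * (ρ ^ 2 * (sg ρ y * sg ρ y * sg ρ y))) := by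
      field_simp
    have hW0 : 0 ≤ χ y * (ρ ^ 2 * (sg ρ y * sg ρ y * sg ρ y)) := by
      have := hχ0 y
      positivity
    rw [gW] at g1
    generalize χ y * (ρ ^ 2 * (sg ρ y * sg ρ y * sg ρ y)) = w at *
    generalize (ρ ^ 2)⁻¹ = t at *
    have tw : 0 ≤ t * w := by positivity
    have q1 : 0 ≤ c1 * t := by positivity
    have q2 : 0 ≤ c2 * (t * w) := by positivity
    have q3 : 0 ≤ C0 * d * (t * w) := by positivity
    have q4 : 0 ≤ C0 * d * t := by positivity
    have q5 : 2 * (d * (C0 * (d + 4))) * t + (d + 2) * C0 * t + d * C0 * (d + 6) * t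
      + 2 * (d * C0) * t + C0 * t + 6 * (d * C0) * t = c2 * t := by rw [hc2]; ring
    rw [abs_le] at *
    constructor <;> linarith [g1.1, g1.2, g2.1, g2.2, g3.1, g3.2, g4.1, g4.2, g5.1, g5.2, g6.1, g6.2]
  · intro y
    beta_reduce
    have hsp := sg_pos hρ y
    have hz := rho_sg_sq hρ y
    rw [lap_mul (by fun_prop) (by fun_prop), lap_mul_const _ (by fun_prop)]
    have g1 : |χ y * (ρ ^ 2 * ∑ j, pp j (pp j (fun y : Euc d => sg ρ y * sg ρ y * sg ρ y)) y)|
        ≤ c1 * (χ y * sg ρ y ^ 3) := by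
      rw [abs_mul, abs_of_nonneg (hχ0 y)]
      have := lap_sg3_bdd hρ y
      calc _ ≤ χ y * ((3 * d + 30) * sg ρ y ^ 3) := mul_le_mul_of_nonneg_left this (hχ0 y)
        _ = (3 * d + 30) * (χ y * sg ρ y ^ 3) := by ring
        _ ≤ _ := by
          have : 0 ≤ χ y := hχ0 y
          gcongr
          rw [hc1]
          nlinarith
    have g2 : |∑ j, pp j χ y * pp j (fun y : Euc d => ρ ^ 2 * (sg ρ y * sg ρ y * sg ρ y)) y| ≤
        d * (C0 * (3 * (ρ ^ 2)⁻¹)) := by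
      apply abs_sum_bdd
      intro j
      rw [abs_mul]
      gcongr
      · exact b1 j y
      · have : pp j (fun y : Euc d => ρ ^ 2 * (sg ρ y * sg ρ y * sg ρ y)) y =
            -3 * ((y j * sg ρ y) * ((ρ ^ 2 * (sg ρ y * sg ρ y)) * (sg ρ y * sg ρ y))) := by
          rw [pp_mul (by fun_prop) (by fun_prop), pp_const, pp_sg3 hρ]; ring
        rw [this, abs_mul, abs_mul, abs_mul (ρ ^ 2 * _), abs_of_nonneg (mul_self_nonneg (sg ρ y)),
          abs_of_nonneg (a := ρ ^ 2 * _) (by positivity)]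
        rw [show |(-3 : ℝ)| = 3 by norm_num]
        gcongr
        calc _ ≤ 1 * (1 * (ρ ^ 2)⁻¹) := by
              gcongr
              · exact coord_sg hρ y j
              · exact hss y
          _ = _ := by ring
    have g3 : |(ρ ^ 2 * (sg ρ y * sg ρ y * sg ρ y)) * ∑ j, pp j (pp j χ) y| ≤ (ρ ^ 2)⁻¹ * C0 := by
      rw [abs_mul]
      gcongr
      · rw [abs_of_nonneg (by positivity)]
        calc _ = (ρ ^ 2 * (sg ρ y * sg ρ y)) * sg ρ y := by ring
          _ ≤ 1 * (ρ ^ 2)⁻¹ := by gcongr; exact hs1 y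
          _ = _ := one_mul _
      · exact b2 y
    have gW : χ y * sg ρ y ^ 3 = (ρ ^ 2)⁻¹ * (χ y * (ρ ^ 2 * (sg ρ y * sg ρ y * sg ρ y))) := by
      field_simp
    have hW0 : 0 ≤ χ y * (ρ ^ 2 * (sg ρ y * sg ρ y * sg ρ y)) := by
      have := hχ0 y
      positivity
    rw [gW] at g1
    generalize χ y * (ρ ^ 2 * (sg ρ y * sg ρ y * sg ρ y)) = w at *
    generalize (ρ ^ 2)⁻¹ = t at *
    have tw : 0 ≤ t * w := by positivity
    have q1 : 0 ≤ c1 * t := by positivity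
    have q2 : 0 ≤ c2 * (t * w) := by positivity
    have q3 : 0 ≤ C0 * d * (t * w) := by positivity
    have q4 : 0 ≤ C0 * d * t := by positivity
    have q5 : 2 * (d * (C0 * (d + 4))) * t + (d + 2) * C0 * t + d * C0 * (d + 6) * t
      + 2 * (d * C0) * t + C0 * t + 6 * (d * C0) * t = c2 * t := by rw [hc2]; ring
    have q6 : 0 ≤ 2 * (d * (C0 * (d + 4))) * t := by positivity
    have q7 : 0 ≤ (d + 2) * C0 * t := by positivity
    have q8 : 0 ≤ d * C0 * (d + 6) * t := by positivity
    have q9 : 0 ≤ d * C0 * t := by positivity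
    rw [abs_le] at *
    constructor <;> linarith [g1.1, g1.2, g2.1, g2.2, g3.1, g3.2]
  · intro hr y hy
    beta_reduce
    rw [hχe y (ball_subset_ball hr hy), one_mul]
    have hsp := sg_pos hρ y
    have n1 : ∑ j, y j * y j = ‖y‖ ^ 2 := by
      rw [EuclideanSpace.real_norm_sq_eq]
      exact Finset.sum_congr rfl fun j _ => (pow_two _).symm
    have n2 : ‖y‖ < ρ := by simpa using hy
    have n3 : ‖y‖ ^ 2 ≤ ρ ^ 2 := by gcongr
    have e := sg_sq hρ y
    rw [n1] at e
    have k : 1 ≤ 2 * (ρ * sg ρ y) := by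
      by_contra hc
      push Not at hc
      have hp : 0 < ρ * sg ρ y := by positivity
      have : sg ρ y * sg ρ y * (ρ ^ 2 + ‖y‖ ^ 2) ≤ sg ρ y * sg ρ y * (ρ ^ 2 + ρ ^ 2) := by gcongr
      have k2 : 1 ≤ 2 * ((ρ * sg ρ y) * (ρ * sg ρ y)) := by linarith
      have k3 : (ρ * sg ρ y) * (2 * (ρ * sg ρ y)) < (ρ * sg ρ y) * 1 := mul_lt_mul_of_pos_left hc hp
      linarith
    rw [inv_eq_one_div, div_le_iff₀ (by positivity)]
    calc (1 : ℝ) ≤ (2 * (ρ * sg ρ y)) ^ 3 := one_le_pow₀ k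
      _ = _ := by ring

end wbounds

/-! ### The Morawetz estimate -/

section morawetz

theorem pair_energy {W a b g1 g2 : Euc d → ℝ} (hW : ContDiff ℝ (⊤ : ℕ∞) W) (ha : ContDiff ℝ (⊤ : ℕ∞) a) (hb : ContDiff ℝ (⊤ : ℕ∞) b) {R : ℝ}
    (hs : tsupport W ⊆ ball 0 R)
    (e1 : ∀ y ∈ ball (0 : Euc d) R, ∑ j, pp j (pp j a) y = g1 y * a y - g2 y * b y)
    (e2 : ∀ y ∈ ball (0 : Euc d) R, ∑ j, pp j (pp j b) y = g2 y * a y + g1 y * b y) :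
    II R (fun y => W y * (∑ j, (pp j a y) ^ 2 + ∑ j, (pp j b y) ^ 2)
      + W y * g1 y * (a y ^ 2 + b y ^ 2)
      - 1 / 2 * (a y ^ 2 + b y ^ 2) * ∑ j, pp j (pp j W) y) = 0 := by
  have h1 := energy_id hW ha hs
  have h2 := energy_id hW hb hs
  have h3 := II_add (f := fun y => W y * ∑ j, (pp j a y) ^ 2 + W y * (a y * ∑ j, pp j (pp j a) y)
      - 1 / 2 * (a y ^ 2 * ∑ j, pp j (pp j W) y))
      (g := fun y => W y * ∑ j, (pp j b y) ^ 2 + W y * (b y * ∑ j, pp j (pp j b) y)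
      - 1 / 2 * (b y ^ 2 * ∑ j, pp j (pp j W) y)) (by fun_prop) (by fun_prop) R
  rw [h1, h2, add_zero] at h3
  rw [← h3]
  apply II_congr
  intro y hy
  beta_reduce
  rw [e1 y hy, e2 y hy]
  ring

theorem pair_mor {X : Fin d → Euc d → ℝ} {a b g1 g2 : Euc d → ℝ} (hX : ∀ j, ContDiff ℝ (⊤ : ℕ∞) (X j)) (ha : ContDiff ℝ (⊤ : ℕ∞) a)
    (hb : ContDiff ℝ (⊤ : ℕ∞) b) (hg1 : ContDiff ℝ (⊤ : ℕ∞) g1) {R : ℝ}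
    (hs : ∀ j, tsupport (X j) ⊆ ball 0 R)
    (e1 : ∀ y ∈ ball (0 : Euc d) R, ∑ j, pp j (pp j a) y = g1 y * a y - g2 y * b y)
    (e2 : ∀ y ∈ ball (0 : Euc d) R, ∑ j, pp j (pp j b) y = g2 y * a y + g1 y * b y) :
    II R (fun y => 2 * (∑ i, ∑ j, pp i (X j) y * (pp i a y * pp j a y)
        + ∑ i, ∑ j, pp i (X j) y * (pp i b y * pp j b y))
      - 1 / 2 * (a y ^ 2 + b y ^ 2) * ∑ j, pp j (pp j (fun z => ∑ i, pp i (X i) z)) y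
      - (∑ j, X j y * pp j g1 y) * (a y ^ 2 + b y ^ 2)
      + 2 * g2 y * ∑ j, X j y * (a y * pp j b y - b y * pp j a y)) = 0 := by
  have hD : ContDiff ℝ (⊤ : ℕ∞) (fun z => ∑ i, pp i (X i) z) := by fun_prop
  have hDs : tsupport (fun z => ∑ i, pp i (X i) z) ⊆ ball 0 R := by
    have k : tsupport (fun z => ∑ i, pp i (X i) z) ⊆ ⋃ i, tsupport (X i) := by
      apply closure_minimal _ (isClosed_iUnion_of_finite fun i => isClosed_tsupport (X i))
      intro y hy
      by_contra hc
      apply hy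
      refine Finset.sum_eq_zero fun i _ => pp_zero_of (fun h => hc ?_) i
      exact Set.mem_iUnion.2 ⟨i, h⟩
    exact k.trans (Set.iUnion_subset hs)
  have h1 := mor_id hX ha hs
  have h2 := mor_id hX hb hs
  have h3 := pair_energy hD ha hb hDs e1 e2
  have h4 : II R (fun y => ∑ j, pp j (fun z => X j z * (g1 z * (a z * a z + b z * b z))) y) = 0 := by
    rw [II_sum _ (fun j => by fun_prop)]
    exact Finset.sum_eq_zero fun j _ => II_pp (by fun_prop) ((tsupport_mul_sub _ _).trans (hs j)) j
  have h5 : II R (fun y => ∑ j, pp j (fun z => X j z * (g1 z * (a z * a z + b z * b z))) y) =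
    II R (fun y => (∑ i, pp i (X i) y) * (g1 y * (a y ^ 2 + b y ^ 2))
      + (∑ j, X j y * pp j g1 y) * (a y ^ 2 + b y ^ 2)
      + 2 * g1 y * (a y * ∑ j, X j y * pp j a y + b y * ∑ j, X j y * pp j b y)) := by
    congr 1
    funext y
    simp only [Finset.mul_sum, Finset.sum_mul]
    rw [← Finset.sum_add_distrib, ← Finset.sum_add_distrib, Finset.mul_sum,
      ← Finset.sum_add_distrib]
    refine Finset.sum_congr rfl fun j _ => ?_
    simp (disch := fun_prop) only [pp_mul, pp_add]
    ring
  rw [h5] at h4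
  have hc : ∀ (p q r s : Euc d → ℝ), Continuous p → Continuous q → Continuous r → Continuous s →
      II R p = 0 → II R q = 0 → II R r = 0 → II R s = 0 →
      II R (fun y => p y + q y + r y - s y) = 0 := by
    intro p q r s hp hq hr hs i1 i2 i3 i4
    rw [II_sub (by fun_prop) (by fun_prop), II_add (by fun_prop) (by fun_prop),
      II_add (by fun_prop) (by fun_prop), i1, i2, i3, i4]
    norm_num
  have hcon3 : Continuous (fun y => (∑ i, pp i (X i) y) * (∑ j, (pp j a y) ^ 2 + ∑ j, (pp j b y) ^ 2)
      + (∑ i, pp i (X i) y) * g1 y * (a y ^ 2 + b y ^ 2)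
      - 1 / 2 * (a y ^ 2 + b y ^ 2) * ∑ j, pp j (pp j (fun z => ∑ i, pp i (X i) z)) y) := by fun_prop
  have h6 := hc _ _ _ _ (by fun_prop) (by fun_prop) hcon3 (by fun_prop) h1 h2 h3 h4
  rw [← h6]
  apply II_congr
  intro y hy
  beta_reduce
  have e7 : ∑ j, X j y * (a y * pp j b y - b y * pp j a y) =
      a y * (∑ j, X j y * pp j b y) - b y * ∑ j, X j y * pp j a y := by
    rw [Finset.mul_sum, Finset.mul_sum, ← Finset.sum_sub_distrib]
    exact Finset.sum_congr rfl fun j _ => by ring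
  rw [e1 y hy, e2 y hy, e7]
  ring

/-- Pointwise bound for the current `a ∇b - b ∇a`. -/
theorem current_bdd {X : Fin d → ℝ} {c s : ℝ} (hX : ∀ j, |X j| ≤ c) (hs : 0 < s) (a b : ℝ)
    (p q : Fin d → ℝ) : 2 * |∑ j, X j * (a * q j - b * p j)| ≤
      c * (d * (s * (a ^ 2 + b ^ 2)) + s⁻¹ * (∑ j, p j ^ 2 + ∑ j, q j ^ 2)) := by
  have h : ∀ j, 2 * |X j * (a * q j - b * p j)| ≤
      c * (s * (a ^ 2 + b ^ 2) + s⁻¹ * (p j ^ 2 + q j ^ 2)) := by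
    intro j
    have h1 : ∀ x z : ℝ, 2 * |x * z| ≤ s * x ^ 2 + s⁻¹ * z ^ 2 := by
      intro x z
      have e : s * x ^ 2 + s⁻¹ * z ^ 2 - 2 * |x * z| = s⁻¹ * (s * |x| - |z|) ^ 2 := by
        rw [abs_mul]
        have := hs.ne'
        field_simp
        rw [← sq_abs x, ← sq_abs z]
        ring
      have : 0 ≤ s⁻¹ * (s * |x| - |z|) ^ 2 := by positivity
      linarith
    have h2 : |a * q j - b * p j| ≤ |a * q j| + |b * p j| := abs_sub _ _
    have h3 := h1 a (q j)
    have h4 := h1 b (p j)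
    have hc : 0 ≤ c := (abs_nonneg _).trans (hX j)
    rw [abs_mul]
    calc 2 * (|X j| * |a * q j - b * p j|) ≤ 2 * (c * |a * q j - b * p j|) := by
          gcongr; exact hX j
      _ = c * (2 * |a * q j - b * p j|) := by ring
      _ ≤ _ := by gcongr; linarith
  calc 2 * |∑ j, X j * (a * q j - b * p j)| ≤ 2 * ∑ j, |X j * (a * q j - b * p j)| := by
        gcongr; exact Finset.abs_sum_le_sum_abs _ _
    _ = ∑ j, 2 * |X j * (a * q j - b * p j)| := Finset.mul_sum _ _ _
    _ ≤ ∑ j, c * (s * (a ^ 2 + b ^ 2) + s⁻¹ * (p j ^ 2 + q j ^ 2)) := Finset.sum_le_sum fun j _ => h j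
    _ = _ := by
      rw [← Finset.mul_sum, Finset.sum_add_distrib, ← Finset.mul_sum Finset.univ _ s⁻¹, Finset.sum_add_distrib (f := fun j => p j ^ 2), Finset.sum_const, Finset.card_univ,
        Fintype.card_fin, nsmul_eq_mul]

theorem im_est {r1 r2 M : ℝ} (h1 : 0 < r1) (h2 : r1 < r2) (hM : 0 ≤ M) :
    ∃ K : ℝ, 0 < K ∧ ∀ (a b g1 V2 : Euc d → ℝ) (m2 s : ℝ), ContDiff ℝ (⊤ : ℕ∞) a → ContDiff ℝ (⊤ : ℕ∞) b → 1 ≤ s → Continuous V2 →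
      (∀ y ∈ ball (0 : Euc d) r2, ∑ j, pp j (pp j a) y = g1 y * a y - (V2 y - m2) * b y) →
      (∀ y ∈ ball (0 : Euc d) r2, ∑ j, pp j (pp j b) y = (V2 y - m2) * a y + g1 y * b y) →
      (∀ y ∈ ball (0 : Euc d) r2, |V2 y| ≤ M) →
      |m2| * II r1 (fun y => a y ^ 2 + b y ^ 2) ≤ K * (s * II r2 (fun y => a y ^ 2 + b y ^ 2)
        + s⁻¹ * II r2 (fun y => ∑ j, (pp j a y) ^ 2 + ∑ j, (pp j b y) ^ 2)) := by
  obtain ⟨χ, hχ, hχs, hχ0, hχ1, hχe⟩ := exists_bump (d := d) h1 h2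
  obtain ⟨C1, hC1, b1⟩ := exists_bdd_fam (f := fun j => pp j χ) (fun j => by fun_prop)
    (fun j => (tsupport_pp χ j).trans hχs)
  refine ⟨M + C1 * d + C1 + 1, by positivity, ?_⟩
  intro a b g1 V2 m2 s ha hb hs hV2c e1 e2 hV2
  have hs0 : 0 < s := by linarith
  have hid := im_id hχ ha hb hχs
  obtain ⟨σ, hσ, hσ1⟩ : ∃ σ : ℝ, σ * m2 = |m2| ∧ |σ| = 1 := by
    rcases le_total 0 m2 with h | h
    · exact ⟨1, by rw [abs_of_nonneg h, one_mul], by simp⟩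
    · exact ⟨-1, by rw [abs_of_nonpos h]; ring, by simp⟩
  -- pointwise bound
  have hpt : ∀ y ∈ ball (0 : Euc d) r2, |m2| * (χ y * (a y ^ 2 + b y ^ 2)) ≤
      (M + C1 * d * s) * (a y ^ 2 + b y ^ 2)
      + C1 * s⁻¹ * (∑ j, (pp j a y) ^ 2 + ∑ j, (pp j b y) ^ 2)
      - σ * (∑ j, pp j χ y * (a y * pp j b y - b y * pp j a y) +
      χ y * (a y * ∑ j, pp j (pp j b) y - b y * ∑ j, pp j (pp j a) y)) := by
    intro y hy
    rw [e1 y hy, e2 y hy, ← hσ]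
    have k1 := current_bdd (fun j => b1 j y) hs0 (a y) (b y) (fun j => pp j a y) (fun j => pp j b y)
    beta_reduce at k1
    have k2 : σ * (∑ j, pp j χ y * (a y * pp j b y - b y * pp j a y)) ≤
        |∑ j, pp j χ y * (a y * pp j b y - b y * pp j a y)| := by
      refine (le_abs_self _).trans ?_
      rw [abs_mul, hσ1, one_mul]
    have k3 : σ * V2 y ≤ M := by
      refine (le_abs_self _).trans ?_
      rw [abs_mul, hσ1, one_mul]
      exact hV2 y hy
    have hN : 0 ≤ a y ^ 2 + b y ^ 2 := by positivity
    have k3' : -(σ * V2 y) ≤ M := by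
      refine (neg_le_abs _).trans ?_
      rw [abs_mul, hσ1, one_mul]
      exact hV2 y hy
    have k4 : σ * V2 y * (χ y * (a y ^ 2 + b y ^ 2)) ≤ M * (a y ^ 2 + b y ^ 2) := by
      calc _ ≤ M * (χ y * (a y ^ 2 + b y ^ 2)) :=
            mul_le_mul_of_nonneg_right k3 (mul_nonneg (hχ0 y) hN)
        _ ≤ M * (1 * (a y ^ 2 + b y ^ 2)) := by gcongr; exact hχ1 y
        _ = _ := by ring
    have k5 := abs_nonneg (∑ j, pp j χ y * (a y * pp j b y - b y * pp j a y))
    nlinarith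
  have hIntg := II_mono (by fun_prop) (by fun_prop) r2 hpt
  rw [II_sub (by fun_prop) (by fun_prop), II_add (by fun_prop) (by fun_prop), II_mul, II_mul, II_mul,
    II_mul, hid, mul_zero, sub_zero] at hIntg
  have hloc : II r1 (fun y => a y ^ 2 + b y ^ 2) ≤ II r2 (fun y => χ y * (a y ^ 2 + b y ^ 2)) := by
    have q1 : II r1 (fun y => a y ^ 2 + b y ^ 2) = II r1 (fun y => χ y * (a y ^ 2 + b y ^ 2)) :=
      II_congr _ fun y hy => by rw [hχe y hy, one_mul]
    rw [q1]
    refine II_mono_set (by fun_prop) (fun y => ?_) h2.le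
    have := hχ0 y
    positivity
  have p1 := mul_le_mul_of_nonneg_left hloc (abs_nonneg m2)
  have n1 : 0 ≤ II r2 (fun y => a y ^ 2 + b y ^ 2) := II_nonneg _ fun y => by positivity
  have n2 : 0 ≤ II r2 (fun y => ∑ j, (pp j a y) ^ 2 + ∑ j, (pp j b y) ^ 2) :=
    II_nonneg _ fun y => by positivity
  refine p1.trans (hIntg.trans ?_)
  generalize II r2 (fun y => a y ^ 2 + b y ^ 2) = J at *
  generalize II r2 (fun y => ∑ j, (pp j a y) ^ 2 + ∑ j, (pp j b y) ^ 2) = H at *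
  have hsi : 0 < s⁻¹ := by positivity
  have r1 : M * J ≤ M * (s * J) := by
    gcongr
    nlinarith
  have r2 : 0 ≤ (C1 + 1) * (s * J) := by positivity
  have r3 : 0 ≤ (M + C1 * d + 1) * (s⁻¹ * H) := by positivity
  linarith

theorem mor_core {r1 r2 M : ℝ} (h1 : 0 < r1) (h2 : r1 < r2) (hM : 0 ≤ M) :
    ∃ c : ℝ, 0 < c ∧ ∀ (a b V1 V2 : Euc d → ℝ) (Λ m2 s ρ : ℝ), ContDiff ℝ (⊤ : ℕ∞) a → ContDiff ℝ (⊤ : ℕ∞) b → ContDiff ℝ (⊤ : ℕ∞) V1 → Continuous V2 →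
      1 ≤ s → 0 < ρ → ρ ≤ 1 → ρ ≤ r1 → 2 * M + c ≤ ρ ^ 2 * Λ →
      (∀ y ∈ ball (0 : Euc d) r2, ∑ j, pp j (pp j a) y = (V1 y - Λ) * a y - (V2 y - m2) * b y) →
      (∀ y ∈ ball (0 : Euc d) r2, ∑ j, pp j (pp j b) y = (V2 y - m2) * a y + (V1 y - Λ) * b y) →
      (∀ y ∈ ball (0 : Euc d) r2, |V1 y| ≤ M) → (∀ y ∈ ball (0 : Euc d) r2, |V2 y| ≤ M) →
      (∀ y ∈ ball (0 : Euc d) r2, ∀ j, |pp j V1 y| ≤ M) →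
      Λ * ((8 * ρ)⁻¹ * II ρ (fun y => a y ^ 2 + b y ^ 2)) ≤
        (Λ + d * M + (M + |m2|) * (d * s)) * II r2 (fun y => a y ^ 2 + b y ^ 2)
        + (c + (M + |m2|) * s⁻¹) * II r2 (fun y => ∑ j, (pp j a y) ^ 2 + ∑ j, (pp j b y) ^ 2) := by
  obtain ⟨c, hc, hw⟩ := weights (d := d) h1 h2
  refine ⟨2 * c, by positivity, ?_⟩
  intro a b V1 V2 Λ m2 s ρ ha hb hV1c hV2c hs hρ hρ1 hρr hΛ e1 e2 hV1 hV2 hdV1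
  obtain ⟨X, W, hX, hXs, hW, hWs, hX1, hW0, hH, hΔD, hΔW, hWl⟩ := hw ρ hρ hρ1
  have hs0 : 0 < s := by linarith
  have ht1 : 1 ≤ (ρ ^ 2)⁻¹ := (one_le_inv₀ (by positivity)).2 (pow_le_one₀ hρ.le hρ1)
  have hΛ' : 2 * M + 2 * c * (ρ ^ 2)⁻¹ ≤ Λ := by
    have : (2 * M + 2 * c) * (ρ ^ 2)⁻¹ ≤ Λ := by
      rw [← div_eq_mul_inv, div_le_iff₀ (by positivity)]; linarith
    nlinarith
  have i1 := pair_mor (g1 := fun y => V1 y - Λ) (g2 := fun y => V2 y - m2) hX ha hb (by fun_prop) hXs e1 e2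
  have i2 := pair_energy (g1 := fun y => V1 y - Λ) (g2 := fun y => V2 y - m2) hW ha hb hWs e1 e2
  have hD : ContDiff ℝ (⊤ : ℕ∞) (fun z => ∑ i, pp i (X i) z) := by fun_prop
  have hpt : ∀ y ∈ ball (0 : Euc d) r2, Λ * (W y * (a y ^ 2 + b y ^ 2)) ≤
      (Λ + d * M + (M + |m2|) * (d * s)) * (a y ^ 2 + b y ^ 2)
        + (2 * c + (M + |m2|) * s⁻¹) * (∑ j, (pp j a y) ^ 2 + ∑ j, (pp j b y) ^ 2)
      + ((2 * (∑ i, ∑ j, pp i (X j) y * (pp i a y * pp j a y)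
        + ∑ i, ∑ j, pp i (X j) y * (pp i b y * pp j b y))
      - 1 / 2 * (a y ^ 2 + b y ^ 2) * ∑ j, pp j (pp j (fun z => ∑ i, pp i (X i) z)) y
      - (∑ j, X j y * pp j (fun y => V1 y - Λ) y) * (a y ^ 2 + b y ^ 2)
      + 2 * (V2 y - m2) * ∑ j, X j y * (a y * pp j b y - b y * pp j a y))
      - 2 * (W y * (∑ j, (pp j a y) ^ 2 + ∑ j, (pp j b y) ^ 2)
      + W y * (V1 y - Λ) * (a y ^ 2 + b y ^ 2)
      - 1 / 2 * (a y ^ 2 + b y ^ 2) * ∑ j, pp j (pp j W) y)) := by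
    intro y hy
    have hN : 0 ≤ a y ^ 2 + b y ^ 2 := by positivity
    have hG : 0 ≤ ∑ j, (pp j a y) ^ 2 + ∑ j, (pp j b y) ^ 2 := by positivity
    have q1 := hH y (fun j => pp j a y)
    have q2 := hH y (fun j => pp j b y)
    have q3 := (abs_le.1 (hΔD y)).2
    have q4 := (abs_le.1 (hΔW y)).1
    have q5 : (∑ j, X j y * pp j (fun y => V1 y - Λ) y) ≤ d * M := by
      refine (le_abs_self _).trans (abs_sum_bdd fun j => ?_)
      rw [pp_sub (by fun_prop) (by fun_prop), pp_const]
      beta_reduce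
      rw [sub_zero, abs_mul]
      calc _ ≤ 1 * M := by gcongr; exacts [hX1 j y, hdV1 y hy j]
        _ = M := one_mul _
    have q6 := current_bdd (fun j => hX1 j y) hs0 (a y) (b y) (fun j => pp j a y) (fun j => pp j b y)
    beta_reduce at q1 q2 q6
    have q7 : -(2 * (V2 y - m2) * ∑ j, X j y * (a y * pp j b y - b y * pp j a y)) ≤
        (M + |m2|) * (d * (s * (a y ^ 2 + b y ^ 2))
          + s⁻¹ * (∑ j, (pp j a y) ^ 2 + ∑ j, (pp j b y) ^ 2)) := by
      refine (neg_le_abs _).trans ?_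
      have v : |V2 y - m2| ≤ M + |m2| := (abs_sub _ _).trans (by linarith [hV2 y hy])
      have : |2 * (V2 y - m2) * ∑ j, X j y * (a y * pp j b y - b y * pp j a y)| =
          |V2 y - m2| * (2 * |∑ j, X j y * (a y * pp j b y - b y * pp j a y)|) := by
        rw [abs_mul, abs_mul, abs_two]; ring
      rw [this]
      have hh : 0 ≤ M + |m2| := by positivity
      gcongr
      linarith
    generalize (∑ j, X j y * (a y * pp j b y - b y * pp j a y)) = cur at *
    generalize (∑ j, X j y * pp j (fun y => V1 y - Λ) y) = dv at *
    generalize ∑ j, pp j (pp j (fun z => ∑ i, pp i (X i) z)) y = ΔD at *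
    generalize ∑ j, pp j (pp j W) y = ΔW at *
    generalize ∑ i, ∑ j, pp i (X j) y * (pp i a y * pp j a y) = Ha at *
    generalize ∑ i, ∑ j, pp i (X j) y * (pp i b y * pp j b y) = Hb at *
    generalize ∑ j, (pp j a y) ^ 2 = Ga at *
    generalize ∑ j, (pp j b y) ^ 2 = Gb at *
    generalize a y ^ 2 + b y ^ 2 = N at *
    have hWy := hW0 y
    have hv := hV1 y hy
    generalize W y = w at *
    generalize (ρ ^ 2)⁻¹ = t at *
    have u1 : V1 y * (w * N) ≤ M * (w * N) :=
      mul_le_mul_of_nonneg_right ((le_abs_self _).trans hv) (by positivity)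
    have u2 : ΔD * N ≤ c * (t * (w + 1)) * N := mul_le_mul_of_nonneg_right q3 hN
    have u3 : -(c * (t * (w + 1))) * N ≤ ΔW * N := mul_le_mul_of_nonneg_right q4 hN
    have u4 : dv * N ≤ d * M * N := mul_le_mul_of_nonneg_right q5 hN
    have u5 : (2 * M + 2 * c * t) * (w * N) ≤ Λ * (w * N) := mul_le_mul_of_nonneg_right hΛ' (by positivity)
    have u6 : (2 * M + 2 * c * t) * N ≤ Λ * N := mul_le_mul_of_nonneg_right hΛ' (by positivity)
    have u7 : 0 ≤ M * N := by positivity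
    have u8 : 0 ≤ c * t * N := by positivity
    have u9 : 0 ≤ c * t * (w * N) := by positivity
    linarith
  have hIntg := II_mono (by fun_prop) (by fun_prop) r2 hpt
  rw [II_add (by fun_prop) (by fun_prop), II_add (by fun_prop) (by fun_prop),
    II_sub (by fun_prop) (by fun_prop), II_mul, II_mul, II_mul, II_mul, i1, i2] at hIntg
  have hloc : (8 * ρ)⁻¹ * II ρ (fun y => a y ^ 2 + b y ^ 2) ≤ II r2 (fun y => W y * (a y ^ 2 + b y ^ 2)) := by
    rw [← II_mul]
    calc _ ≤ II ρ (fun y => W y * (a y ^ 2 + b y ^ 2)) := by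
          refine II_mono (by fun_prop) (by fun_prop) ρ fun y hy => ?_
          have := hWl hρr y hy
          gcongr
      _ ≤ _ := by
          refine II_mono_set (by fun_prop) (fun y => ?_) (hρr.trans h2.le)
          have := hW0 y
          positivity
  have hΛ0 : 0 ≤ Λ := by
    have : 0 ≤ 2 * M + 2 * c * (ρ ^ 2)⁻¹ := by positivity
    linarith
  have := mul_le_mul_of_nonneg_left hloc hΛ0
  linarith

end morawetz

section final_est

theorem grad_crude {r1 r2 M : ℝ} (h1 : 0 < r1) (h2 : r1 < r2) (hM : 0 ≤ M) :
    ∃ K : ℝ, 0 < K ∧ ∀ (u V : Euc d → ℂ) (lam : ℂ), ContDiff ℝ (⊤ : ℕ∞) u → ContDiff ℝ (⊤ : ℕ∞) V → 1 ≤ lam.re →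
      (∀ y ∈ ball (0 : Euc d) r2, ∑ j, pp j (pp j u) y = -lam * u y + V y * u y) →
      (∀ y ∈ ball (0 : Euc d) r2, ‖V y‖ ^ 2 ≤ M) →
      II r1 (fun y => ∑ j, ‖pp j u y‖ ^ 2) ≤ K * (lam.re * II r2 (fun y => ‖u y‖ ^ 2)) := by
  obtain ⟨K, hK, h⟩ := energy_est (d := d) h1 h2
  refine ⟨1 + K + M, by positivity, ?_⟩
  intro u V lam hu hV hl heq hVM
  have hu' := hu.continuous
  have hV' := hV.continuous
  have e := h u (fun y => V y * u y) lam lam.re hu (by fun_prop) (by linarith) le_rfl heq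
  have f : II r2 (fun y => ‖V y * u y‖ ^ 2) ≤ M * II r2 (fun y => ‖u y‖ ^ 2) := by
    rw [← II_mul]
    refine II_mono (by fun_prop) (by fun_prop) r2 fun y hy => ?_
    rw [norm_mul, mul_pow]
    gcongr
    exact hVM y hy
  have n1 : 0 ≤ II r2 (fun y => ‖u y‖ ^ 2) := II_nonneg _ fun y => by positivity
  generalize II r2 (fun y => ‖u y‖ ^ 2) = J at *
  have : J ≤ lam.re * J := by nlinarith
  nlinarith

theorem morawetz {R M : ℝ} (hR : 0 < R) (hR1 : R ≤ 1) (hM : 0 ≤ M) :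
    ∃ K C : ℝ, 0 < K ∧ 0 < C ∧ ∀ (u V : Euc d → ℂ) (lam : ℂ) (ρ : ℝ), ContDiff ℝ (⊤ : ℕ∞) u → ContDiff ℝ (⊤ : ℕ∞) V → 1 ≤ lam.re →
      0 < ρ → ρ ≤ R / 8 → K ≤ ρ ^ 2 * lam.re →
      (∀ y ∈ ball (0 : Euc d) R, ∑ j, pp j (pp j u) y = -lam * u y + V y * u y) →
      (∀ y ∈ ball (0 : Euc d) R, AA 1 V y ≤ M) →
      II ρ (fun y => ‖u y‖ ^ 2) ≤ C * (ρ * II R (fun y => ‖u y‖ ^ 2)) := by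
  obtain ⟨K1, hK1, g1⟩ := grad_crude (d := d) (r1 := R / 4) (r2 := R / 2) (by linarith) (by linarith) hM
  obtain ⟨K2, hK2, g2⟩ := grad_crude (d := d) (r1 := 3 * R / 4) (r2 := R) (by linarith) (by linarith) hM
  have hM' : 0 ≤ M + 1 := by linarith
  obtain ⟨K3, hK3, g3⟩ := im_est (d := d) (r1 := R / 2) (r2 := 3 * R / 4) (by linarith) (by linarith) hM'
  obtain ⟨c, hc, g4⟩ := mor_core (d := d) (r1 := R / 8) (r2 := R / 4) (by linarith) (by linarith) hM'
  obtain ⟨K4, hK4⟩ : ∃ K4, K4 = K3 * (1 + K2) := ⟨_, rfl⟩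
  have hK4' : 0 < K4 := by rw [hK4]; positivity
  refine ⟨2 * (M + 1) + c, 8 * (1 + d * (M + 1) + (M + 1) * d + d * K4 + c * K1 + (M + 1) * K1 + K1 * K4),
    by positivity, by positivity, ?_⟩
  intro u V lam ρ hu hV hl hρ hρR hK heq hAA
  have bV : ∀ y ∈ ball (0 : Euc d) R, ‖V y‖ ^ 2 ≤ M := fun y hy =>
    (AA_le_succ 0 V y).trans (hAA y hy)
  have bdV : ∀ y ∈ ball (0 : Euc d) R, ∀ j, ‖pp j V y‖ ^ 2 ≤ M := fun y hy j =>
    (AA_pp_le 0 V j y).trans (hAA y hy)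
  have hsq : ∀ x : ℝ, x ^ 2 ≤ M → x ≤ M + 1 := fun x hx => by nlinarith
  have s1 : ball (0 : Euc d) (R / 4) ⊆ ball 0 R := ball_subset_ball (by linarith)
  have s2 : ball (0 : Euc d) (R / 2) ⊆ ball 0 R := ball_subset_ball (by linarith)
  have s3 : ball (0 : Euc d) (3 * R / 4) ⊆ ball 0 R := ball_subset_ball (by linarith)
  have k1 := g1 u V lam hu hV hl (fun y hy => heq y (s2 hy)) (fun y hy => bV y (s2 hy))
  have k2 := g2 u V lam hu hV hl heq bV
  have ha := contDiff_re hu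
  have hb := contDiff_im hu
  have hV1 := contDiff_re hV
  have hV2 := contDiff_im hV
  have e1 : ∀ y ∈ ball (0 : Euc d) R, ∑ j, pp j (pp j (fun y => (u y).re)) y =
      ((V y).re - lam.re) * (u y).re - ((V y).im - lam.im) * (u y).im := by
    intro y hy
    have := congrArg Complex.re (heq y hy)
    simp only [pp_re hu, pp_re (contDiff_pp hu _)]
    rw [Complex.re_sum] at this
    rw [this]
    simp
    ring
  have e2 : ∀ y ∈ ball (0 : Euc d) R, ∑ j, pp j (pp j (fun y => (u y).im)) y =
      ((V y).im - lam.im) * (u y).re + ((V y).re - lam.re) * (u y).im := by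
    intro y hy
    have := congrArg Complex.im (heq y hy)
    simp only [pp_im hu, pp_im (contDiff_pp hu _)]
    rw [Complex.im_sum] at this
    rw [this]
    simp
    ring
  obtain ⟨s, hs⟩ : ∃ s, s = Real.sqrt lam.re := ⟨_, rfl⟩
  have hs1 : 1 ≤ s := by rw [hs]; exact Real.one_le_sqrt.2 hl
  have hss : s * s = lam.re := by rw [hs]; exact Real.mul_self_sqrt (by linarith)
  have k3 := g3 _ _ (fun y => (V y).re - lam.re) (fun y => (V y).im) lam.im s ha hb hs1 hV2.continuous
    (fun y hy => e1 y (s3 hy)) (fun y hy => e2 y (s3 hy))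
    (fun y hy => (Complex.abs_im_le_norm _).trans (hsq _ (bV y (s3 hy))))
  have k4 := g4 _ _ (fun y => (V y).re) (fun y => (V y).im) lam.re lam.im s ρ ha hb hV1 hV2.continuous
    hs1 hρ (by linarith) hρR hK
    (fun y hy => e1 y (s1 hy)) (fun y hy => e2 y (s1 hy))
    (fun y hy => (Complex.abs_re_le_norm _).trans (hsq _ (bV y (s1 hy))))
    (fun y hy => (Complex.abs_im_le_norm _).trans (hsq _ (bV y (s1 hy))))
    (fun y hy j => by
      rw [pp_re hV]
      exact (Complex.abs_re_le_norm _).trans (hsq _ (bdV y (s1 hy) j)))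
  have hN : (fun y => (u y).re ^ 2 + (u y).im ^ 2) = fun y => ‖u y‖ ^ 2 := by
    funext y; rw [norm_sq_re_im]
  have hG : (fun y => ∑ j, pp j (fun y => (u y).re) y ^ 2 + ∑ j, pp j (fun y => (u y).im) y ^ 2)
      = fun y => ∑ j, ‖pp j u y‖ ^ 2 := by
    funext y
    simp only [pp_re hu, pp_im hu, norm_sq_re_im, Finset.sum_add_distrib]
  rw [hN, hG] at k3 k4
  have hu' := hu.continuous
  have cN : Continuous (fun y => ‖u y‖ ^ 2) := by fun_prop
  have m1 := II_mono_set cN (fun y => by positivity) (show R / 4 ≤ R / 2 by linarith)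
  have m2 := II_mono_set cN (fun y => by positivity) (show R / 2 ≤ R by linarith)
  have m3 := II_mono_set cN (fun y => by positivity) (show 3 * R / 4 ≤ R by linarith)
  have nG : 0 ≤ II (R / 4) (fun y => ∑ j, ‖pp j u y‖ ^ 2) := II_nonneg _ fun y => by positivity
  have nN : 0 ≤ II (R / 4) (fun y => ‖u y‖ ^ 2) := II_nonneg _ fun y => by positivity
  generalize II R (fun y => ‖u y‖ ^ 2) = J at *
  generalize II (R / 4) (fun y => ‖u y‖ ^ 2) = N4 at *
  generalize II (R / 2) (fun y => ‖u y‖ ^ 2) = N2 at *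
  generalize II (3 * R / 4) (fun y => ‖u y‖ ^ 2) = N3 at *
  generalize II ρ (fun y => ‖u y‖ ^ 2) = P at *
  generalize II (R / 4) (fun y => ∑ j, ‖pp j u y‖ ^ 2) = G4 at *
  generalize II (3 * R / 4) (fun y => ∑ j, ‖pp j u y‖ ^ 2) = G3 at *
  rw [← hss] at *
  have hsp : 0 < s := by linarith
  have hsi : s⁻¹ * s = 1 := inv_mul_cancel₀ hsp.ne'
  have hsi1 : s⁻¹ ≤ 1 := inv_le_one_of_one_le₀ hs1
  have hsi0 : 0 < s⁻¹ := by positivity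
  have hJ : 0 ≤ J := by linarith
  have hd : (0 : ℝ) ≤ d := by positivity
  have am := abs_nonneg lam.im
  generalize |lam.im| = m at *
  -- |m| N2 ≤ K4 s J
  have p1 : m * N2 ≤ K4 * (s * J) := by
    refine k3.trans ?_
    rw [hK4, mul_assoc]
    apply mul_le_mul_of_nonneg_left _ hK3.le
    have q1 : s⁻¹ * G3 ≤ s⁻¹ * (K2 * (s * s * J)) := by gcongr
    have q2 : s⁻¹ * (K2 * (s * s * J)) = K2 * (s * J) := by
      linear_combination K2 * s * J * hsi
    have q3 : s * N3 ≤ s * J := by gcongr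
    linarith
  have p2 : m * N4 ≤ K4 * (s * J) := (mul_le_mul_of_nonneg_left m1 am).trans p1
  have p3 : m * G4 ≤ K1 * K4 * (s * (s * s * J)) := by
    calc m * G4 ≤ m * (K1 * (s * s * N2)) := by gcongr
      _ = K1 * (s * s) * (m * N2) := by ring
      _ ≤ K1 * (s * s) * (K4 * (s * J)) := by gcongr
      _ = _ := by ring
  have p4 : G4 ≤ K1 * (s * s * J) := by
    refine k1.trans ?_
    gcongr
  have p5 : N4 ≤ J := m1.trans m2
  have hsJ : s * J ≤ s * s * J := by
    have : 0 ≤ s * J * (s - 1) := mul_nonneg (by positivity) (by linarith)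
    linarith
  have hJJ : J ≤ s * s * J := by
    have : 0 ≤ J * (s - 1) := mul_nonneg (by positivity) (by linarith)
    linarith
  have t1 : s * s * N4 ≤ s * s * J := by gcongr
  have t2 : d * (M + 1) * N4 ≤ d * (M + 1) * (s * s * J) := by gcongr; linarith
  have t3 : (M + 1) * (d * s) * N4 ≤ (M + 1) * d * (s * s * J) := by
    calc _ ≤ (M + 1) * (d * s) * J := by gcongr
      _ = (M + 1) * d * (s * J) := by ring
      _ ≤ _ := by gcongr
  have t4 : d * s * (m * N4) ≤ d * K4 * (s * s * J) := by
    calc _ ≤ d * s * (K4 * (s * J)) := by gcongr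
      _ = _ := by ring
  have t5 : c * G4 ≤ c * K1 * (s * s * J) := by
    calc _ ≤ c * (K1 * (s * s * J)) := by gcongr
      _ = _ := by ring
  have t6 : (M + 1) * s⁻¹ * G4 ≤ (M + 1) * K1 * (s * s * J) := by
    calc _ ≤ (M + 1) * 1 * (K1 * (s * s * J)) := by gcongr
      _ = _ := by ring
  have t7 : s⁻¹ * (m * G4) ≤ K1 * K4 * (s * s * J) := by
    calc _ ≤ s⁻¹ * (K1 * K4 * (s * (s * s * J))) := by gcongr
      _ = _ := by linear_combination K1 * K4 * (s * s * J) * hsi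
  obtain ⟨C', hC'⟩ : ∃ C', C' = (1 + d * (M + 1) + (M + 1) * d + d * K4 + c * K1 + (M + 1) * K1 + K1 * K4) :=
    ⟨_, rfl⟩
  have fin : s * s * ((8 * ρ)⁻¹ * P) ≤ s * s * (C' * J) := by
    rw [hC']
    refine k4.trans ?_
    linarith
  have fin2 : (8 * ρ)⁻¹ * P ≤ C' * J := le_of_mul_le_mul_left fin (by positivity)
  rw [inv_mul_le_iff₀ (by positivity)] at fin2
  rw [← hC']
  linarith

theorem key_est (L : List (Fin d)) {R M : ℝ} (hR : 0 < R) (hR1 : R ≤ 1) (hM : 0 ≤ M) :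
    ∃ C : ℝ, 0 < C ∧ ∀ (u V : Euc d → ℂ) (lam : ℂ), ContDiff ℝ (⊤ : ℕ∞) u → ContDiff ℝ (⊤ : ℕ∞) V → 1 ≤ lam.re →
      (∀ y ∈ ball (0 : Euc d) R, ∑ j, pp j (pp j u) y = -lam * u y + V y * u y) →
      (∀ y ∈ ball (0 : Euc d) R, AA (d + L.length + 1) V y ≤ M) →
      ‖PD L u 0‖ ^ 2 ≤ C * (lam.re ^ ((L.length : ℝ) + ((d : ℝ) - 1) / 2) *
        II R (fun y => ‖u y‖ ^ 2)) := by
  obtain ⟨K, C2, hK, hC2, hmor⟩ := morawetz (d := d) hR hR1 hM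
  obtain ⟨C1, hC1, hpt⟩ := pt_scaled L (M + K)
  generalize hn : L.length = n at hpt ⊢
  obtain ⟨q, hq⟩ : ∃ q : ℝ, q = (n : ℝ) + ((d : ℝ) - 1) / 2 := ⟨_, rfl⟩
  rw [← hq]
  obtain ⟨t, ht⟩ : ∃ t, t = R / 8 := ⟨_, rfl⟩
  have ht0 : 0 < t := by rw [ht]; positivity
  have hKq : 0 < K ^ (-q) := Real.rpow_pos_of_pos hK _
  obtain ⟨C3, hC3⟩ : ∃ C3, C3 = C1 * (t ^ d)⁻¹ * ((t ^ n) ^ 2)⁻¹ * (K * (t ^ 2)⁻¹) := ⟨_, rfl⟩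
  have hC3' : 0 < C3 := by rw [hC3]; positivity
  refine ⟨C1 * C2 * K ^ (-q) + C3, by positivity, ?_⟩
  intro u V lam hu hV hl heq hAA
  have hu' := hu.continuous
  have cN : Continuous (fun y => ‖u y‖ ^ 2) := by fun_prop
  have hJ : 0 ≤ II R (fun y => ‖u y‖ ^ 2) := II_nonneg _ fun y => by positivity
  have hl0 : 0 < lam.re := by linarith
  have hlq : 0 < lam.re ^ q := Real.rpow_pos_of_pos hl0 _
  by_cases hcase : K ≤ t ^ 2 * lam.re
  · obtain ⟨ρ, hρ⟩ : ∃ ρ, ρ = Real.sqrt (K / lam.re) := ⟨_, rfl⟩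
    have hρ0 : 0 < ρ := by rw [hρ]; exact Real.sqrt_pos.2 (by positivity)
    have hρ2 : ρ ^ 2 = K / lam.re := by rw [hρ]; exact Real.sq_sqrt (by positivity)
    have hρK : ρ ^ 2 * lam.re = K := by rw [hρ2]; field_simp
    have hρt : ρ ≤ t := by
      apply (sq_le_sq₀ hρ0.le ht0.le).1
      rw [hρ2, div_le_iff₀ hl0]
      exact hcase
    have hρR : ρ ≤ R := by linarith
    have sub : ball (0 : Euc d) ρ ⊆ ball 0 R := ball_subset_ball hρR
    have b1 := hpt u V lam ρ hu hV hρ0 (by linarith) (by rw [hρK]; linarith)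
      (fun y hy => heq y (sub hy))
      (fun y hy => (AA_mono (by omega) V y).trans ((hAA y (sub hy)).trans (by linarith)))
    have b2 := hmor u V lam ρ hu hV hl hρ0 (by linarith) hρK.ge heq
      (fun y hy => (AA_mono (by omega) V y).trans (hAA y hy))
    generalize II R (fun y => ‖u y‖ ^ 2) = J at *
    have b3 : (ρ ^ n) ^ 2 * ‖PD L u 0‖ ^ 2 ≤ C1 * ((ρ ^ d)⁻¹ * (C2 * (ρ * J))) := by
      refine b1.trans ?_
      gcongr
    have pw1 : ((ρ ^ n) ^ 2)⁻¹ * ((ρ ^ d)⁻¹ * ρ) = K ^ (-q) * lam.re ^ q := by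
      have z1 : ((ρ ^ n) ^ 2)⁻¹ * ((ρ ^ d)⁻¹ * ρ) = ρ ^ (-(2 * q)) := by
        rw [← pow_mul, ← Real.rpow_natCast, ← Real.rpow_natCast, ← Real.rpow_neg hρ0.le,
          ← Real.rpow_neg hρ0.le]
        nth_rewrite 3 [← Real.rpow_one ρ]
        rw [← Real.rpow_add hρ0, ← Real.rpow_add hρ0]
        congr 1
        rw [hq]
        push_cast
        ring
      rw [z1, show -(2 * q) = (2 : ℕ) * (-q) by push_cast; ring, Real.rpow_mul hρ0.le,
        Real.rpow_natCast, hρ2, Real.div_rpow hK.le hl0.le, Real.rpow_neg hl0.le, div_inv_eq_mul]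
    have b4 : ‖PD L u 0‖ ^ 2 ≤ C1 * C2 * J * (((ρ ^ n) ^ 2)⁻¹ * ((ρ ^ d)⁻¹ * ρ)) := by
      have := (le_inv_mul_iff₀ (show 0 < (ρ ^ n) ^ 2 by positivity)).2 b3
      refine this.trans_eq ?_
      ring
    rw [pw1] at b4
    have : 0 ≤ C3 * (lam.re ^ q * J) := by positivity
    linarith
  · push Not at hcase
    have htR : t ≤ R := by linarith
    have sub : ball (0 : Euc d) t ⊆ ball 0 R := ball_subset_ball htR
    have b1 := hpt u V lam t hu hV ht0 (by linarith) (by linarith)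
      (fun y hy => heq y (sub hy))
      (fun y hy => (AA_mono (by omega) V y).trans ((hAA y (sub hy)).trans (by linarith)))
    have m := II_mono_set cN (fun y => by positivity) htR
    generalize II R (fun y => ‖u y‖ ^ 2) = J at *
    have b3 : (t ^ n) ^ 2 * ‖PD L u 0‖ ^ 2 ≤ C1 * ((t ^ d)⁻¹ * J) := by
      refine b1.trans ?_
      gcongr
    have b4 : ‖PD L u 0‖ ^ 2 ≤ C1 * (t ^ d)⁻¹ * ((t ^ n) ^ 2)⁻¹ * J := by
      have := (le_inv_mul_iff₀ (show 0 < (t ^ n) ^ 2 by positivity)).2 b3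
      refine this.trans_eq ?_
      ring
    have b5 : 1 ≤ (K * (t ^ 2)⁻¹) * lam.re ^ q := by
      have z1 : lam.re ^ (-1 : ℝ) ≤ lam.re ^ q := by
        apply Real.rpow_le_rpow_of_exponent_le hl
        rw [hq]
        have : (0 : ℝ) ≤ n := by positivity
        have : (0 : ℝ) ≤ d := by positivity
        linarith
      rw [Real.rpow_neg_one] at z1
      have z2 : lam.re * (t ^ 2) ≤ K := by linarith
      have z3 : 1 ≤ K * (t ^ 2)⁻¹ * (lam.re)⁻¹ := by
        rw [mul_assoc, ← mul_inv, ← div_eq_mul_inv, le_div_iff₀ (by positivity)]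
        linarith
      refine z3.trans ?_
      gcongr
    have b6 : C1 * (t ^ d)⁻¹ * ((t ^ n) ^ 2)⁻¹ * J ≤ C3 * (lam.re ^ q * J) := by
      rw [hC3]
      have : 0 ≤ C1 * (t ^ d)⁻¹ * ((t ^ n) ^ 2)⁻¹ * J := by positivity
      have := mul_le_mul_of_nonneg_left b5 this
      refine le_trans (le_of_eq (mul_one _).symm) (this.trans_eq ?_)
      ring
    have : 0 ≤ C1 * C2 * K ^ (-q) * (lam.re ^ q * J) := by positivity
    linarith

end final_est

section assembly

theorem pp_trans (j : Fin d) (f : Euc d → ℂ) (x : Euc d) :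
    pp j (fun y => f (x + y)) = fun y => pp j f (x + y) := by
  funext y
  simp only [pp]
  rw [fderiv_comp_add_left]

theorem PD_trans (L : List (Fin d)) (f : Euc d → ℂ) (x : Euc d) :
    PD L (fun y => f (x + y)) = fun y => PD L f (x + y) := by
  induction L generalizing f with
  | nil => rfl
  | cons i L ih => rw [PD_cons, pp_trans, ih, PD_cons]

theorem iter_PD (j : Fin d) (n : ℕ) (f : Euc d → ℂ) :
    (pd j)^[n] f = PD (List.replicate n j) f := by
  induction n generalizing f with
  | zero => rfl
  | succ n ih =>
    rw [Function.iterate_succ_apply, ih, List.replicate_succ, PD_cons]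
    rfl

theorem foldr_PD (γ : Fin d → ℕ) (l : List (Fin d)) :
    ∃ L : List (Fin d), L.length = (l.map γ).sum ∧
      ∀ f : Euc d → ℂ, l.foldr (fun j g => (pd j)^[γ j] g) f = PD L f := by
  induction l with
  | nil => exact ⟨[], rfl, fun f => rfl⟩
  | cons i l ih =>
    obtain ⟨L, h1, h2⟩ := ih
    refine ⟨L ++ List.replicate (γ i) i, ?_, ?_⟩
    · simp [h1, add_comm]
    · intro f
      rw [List.foldr_cons, h2, iter_PD, PD_append]

theorem Dpow_PD (γ : Fin d → ℕ) :
    ∃ L : List (Fin d), L.length = ∑ j, γ j ∧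
      ∀ (f : Euc d → ℂ) (x : Euc d), ‖Dpow γ f x‖ = ‖PD L f x‖ := by
  obtain ⟨L, h1, h2⟩ := foldr_PD γ (List.finRange d)
  refine ⟨L, ?_, ?_⟩
  · rw [h1, ← List.ofFn_eq_map, List.sum_ofFn]
  · intro f x
    rw [Dpow, h2, norm_mul, norm_pow, norm_neg, Complex.norm_I, one_pow, one_mul]

theorem cut_smooth {Ω : Set (Euc d)} (hΩ : IsOpen Ω) {f : Euc d → ℂ}
    (hf : ContDiffOn ℝ (⊤ : ℕ∞) f Ω) {x : Euc d} {r : ℝ} (hball : ball x r ⊆ Ω)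
    {χ : Euc d → ℝ} (hχ : ContDiff ℝ (⊤ : ℕ∞) χ) (hs : tsupport χ ⊆ ball 0 r) :
    ContDiff ℝ (⊤ : ℕ∞) (fun y => χ y • f (x + y)) := by
  rw [contDiff_iff_contDiffAt]
  intro y
  by_cases hy : y ∈ tsupport χ
  · have h1 : x + y ∈ Ω := by
      apply hball
      have := hs hy
      simpa [mem_ball, dist_eq_norm] using this
    have h2 : ContDiffAt ℝ (⊤ : ℕ∞) f (x + y) := hf.contDiffAt (hΩ.mem_nhds h1)
    have h3 : ContDiffAt ℝ (⊤ : ℕ∞) (fun y : Euc d => x + y) y := by fun_prop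
    exact hχ.contDiffAt.smul (h2.comp y h3)
  · have : (fun y => χ y • f (x + y)) =ᶠ[nhds y] fun _ => 0 := by
      have := (isClosed_tsupport χ).isOpen_compl.mem_nhds hy
      filter_upwards [this] with z hz
      rw [image_eq_zero_of_notMem_tsupport hz, zero_smul]
    exact contDiffAt_const.congr_of_eventuallyEq this

theorem II_le_L2 {u ψ : Euc d → ℂ} {x : Euc d} {R r : ℝ} (hRr : R ≤ r)
    (hu : Continuous u) (h : ∀ y ∈ ball (0 : Euc d) R, u y = ψ (x + y)) :
    ENNReal.ofReal (II R (fun y => ‖u y‖ ^ 2)) ≤ (L2 ψ (ball x r)) ^ 2 := by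
  have e1 : ENNReal.ofReal (II R (fun y => ‖u y‖ ^ 2)) =
      ∫⁻ y in ball (0 : Euc d) R, ‖u y‖ₑ ^ 2 := by
    rw [II, ofReal_integral_eq_lintegral_ofReal]
    · congr 1
      funext y
      rw [ENNReal.ofReal_pow (norm_nonneg _), ofReal_norm_eq_enorm]
    · exact ion (by fun_prop) R
    · exact Filter.Eventually.of_forall fun y => by positivity
  have e2 : (L2 ψ (ball x r)) ^ 2 = ∫⁻ y in ball x r, ‖ψ y‖ₑ ^ 2 := by
    rw [L2, eLpNorm_eq_lintegral_rpow_enorm_toReal (by norm_num) (by norm_num),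
      ← ENNReal.rpow_natCast, ← ENNReal.rpow_mul]
    norm_num
  have e3 : ∫⁻ y in ball (0 : Euc d) R, ‖u y‖ₑ ^ 2 =
      ∫⁻ y in ball (0 : Euc d) R, ‖ψ (x + y)‖ₑ ^ 2 := by
    apply setLIntegral_congr_fun measurableSet_ball
    intro y hy
    simp only [h y hy]
  have e4 : ∫⁻ y in ball (0 : Euc d) R, ‖ψ (x + y)‖ₑ ^ 2 = ∫⁻ y in ball x R, ‖ψ y‖ₑ ^ 2 := by
    rw [← lintegral_indicator measurableSet_ball, ← lintegral_indicator measurableSet_ball,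
      ← lintegral_add_left_eq_self ((ball x R).indicator _) x]
    congr 1
    funext y
    simp only [Set.indicator, mem_ball, dist_eq_norm, sub_zero, add_sub_cancel_left]
  rw [e1, e2, e3, e4]
  exact lintegral_mono_set (ball_subset_ball hRr)

end assembly


/-- Corollary `cor-der`, local form: for every multi-index `γ`,
`|(D^γψ_λ)(x)| ≤ C (Re λ)^{|γ|/2+(d−1)/4+ε} ‖ψ_λ‖_{L²(B(x,r))}`, with `C` depending
only on `d, r, ε, γ, V, x` (not on `λ` or `ψ_λ`). -/
theorem statement4
    (d : ℕ) (Ω : Set (Euc d)) (hΩ : IsOpen Ω) (hne : Ω.Nonempty)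
    (V : Euc d → ℂ) (hV : ContDiffOn ℝ (⊤ : ℕ∞) V Ω)
    (x : Euc d) (hx : x ∈ Ω) (r : ℝ) (hr : r ∈ Set.Ioo (0 : ℝ) 1)
    (hball : ball x r ⊆ Ω) (γ : Fin d → ℕ) (ε : ℝ) (hε : 0 < ε) :
    ∃ C : ℝ, 0 < C ∧ ∀ (lam : ℂ), 1 ≤ lam.re → ∀ ψ : Euc d → ℂ,
      ContDiffOn ℝ (⊤ : ℕ∞) ψ Ω →
      (∀ y ∈ Ω, -(∑ j, pd j (pd j ψ) y) + V y * ψ y = lam * ψ y) →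
      (‖Dpow γ ψ x‖₊ : ℝ≥0∞) ≤
        ENNReal.ofReal
          (C * lam.re ^ ((∑ j, γ j : ℝ) / 2 + ((d : ℝ) - 1) / 4 + ε)) *
          L2 ψ (ball x r) := by
  obtain ⟨L, hL, hD⟩ := Dpow_PD γ
  have hr0 : 0 < r := hr.1
  obtain ⟨χ, hχ, hsupp, -, -, hχ1⟩ := exists_bump (d := d) (r1 := r / 2) (r2 := r)
    (by linarith) (by linarith)
  have hVs := cut_smooth hΩ hV hball hχ hsupp
  obtain ⟨R, hRe⟩ : ∃ R, R = r / 2 := ⟨_, rfl⟩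
  rw [← hRe] at hχ1
  have hR : 0 < R := by rw [hRe]; linarith
  have hRr : R ≤ r := by rw [hRe]; linarith
  have hR1 : R ≤ 1 := hRr.trans hr.2.le
  obtain ⟨M, hM⟩ : ∃ M, ∀ y ∈ closedBall (0 : Euc d) R,
      AA (d + L.length + 1) (fun y => χ y • V (x + y)) y ≤ M := by
    obtain ⟨M, hM⟩ := ((isCompact_closedBall (0 : Euc d) R).bddAbove_image
      (AA_cont (d + L.length + 1) hVs).continuousOn)
    exact ⟨M, fun y hy => hM ⟨y, hy, rfl⟩⟩
  have hM0 : 0 ≤ M := (AA_nonneg _ _ _).trans (hM 0 (mem_closedBall_self hR.le))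
  obtain ⟨C, hC, hkey⟩ := key_est L hR hR1 hM0
  refine ⟨Real.sqrt C, Real.sqrt_pos.2 hC, ?_⟩
  intro lam hl ψ hψ heq
  have hu := cut_smooth hΩ hψ hball hχ hsupp
  have hue : ∀ y ∈ ball (0 : Euc d) R, χ y • ψ (x + y) = ψ (x + y) := fun y hy => by
    rw [hχ1 y hy, one_smul]
  have hVe : ∀ y ∈ ball (0 : Euc d) R, χ y • V (x + y) = V (x + y) := fun y hy => by
    rw [hχ1 y hy, one_smul]
  have hmem : ∀ y ∈ ball (0 : Euc d) R, x + y ∈ Ω := fun y hy => by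
    apply hball
    have := ball_subset_ball hRr hy
    simpa [mem_ball, dist_eq_norm] using this
  have key := hkey (fun y => χ y • ψ (x + y)) (fun y => χ y • V (x + y)) lam hu hVs hl
    (fun y hy => by
      have e1 : ∀ j, pp j (pp j (fun y => χ y • ψ (x + y))) y = pd j (pd j ψ) (x + y) := by
        intro j
        rw [pp_congr isOpen_ball (pp_congr isOpen_ball hue j) j y hy, pp_trans, pp_trans]
        rfl
      have e2 := heq (x + y) (hmem y hy)
      simp only [e1, hue y hy, hVe y hy]
      linear_combination -e2)
    (fun y hy => hM y (ball_subset_closedBall hy))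
  rw [PD_congr L isOpen_ball hue 0 (mem_ball_self hR), PD_trans] at key
  beta_reduce at key
  rw [add_zero, ← hD] at key
  have hI := II_le_L2 hRr hu.continuous hue
  generalize II R (fun y => ‖χ y • ψ (x + y)‖ ^ 2) = J at key hI
  have hl0 : 0 < lam.re := by linarith
  rw [← ENNReal.pow_le_pow_left_iff (two_ne_zero), mul_pow]
  obtain ⟨p, hp⟩ : ∃ p, p = (∑ j, γ j : ℝ) / 2 + ((d : ℝ) - 1) / 4 + ε := ⟨_, rfl⟩
  rw [← hp]
  have hpow : C * lam.re ^ ((L.length : ℝ) + ((d : ℝ) - 1) / 2) ≤ (Real.sqrt C * lam.re ^ p) ^ 2 := by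
    rw [mul_pow, Real.sq_sqrt hC.le, ← Real.rpow_natCast (lam.re ^ p), ← Real.rpow_mul hl0.le]
    apply mul_le_mul_of_nonneg_left _ hC.le
    apply Real.rpow_le_rpow_of_exponent_le hl
    rw [hp, hL]
    push_cast
    linarith
  calc (‖Dpow γ ψ x‖₊ : ℝ≥0∞) ^ 2 = ENNReal.ofReal (‖Dpow γ ψ x‖ ^ 2) := by
        rw [ENNReal.ofReal_pow (norm_nonneg _), ofReal_norm_eq_enorm]; rfl
    _ ≤ ENNReal.ofReal (C * lam.re ^ ((L.length : ℝ) + ((d : ℝ) - 1) / 2) * J) := by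
        apply ENNReal.ofReal_le_ofReal
        rw [mul_assoc]
        exact key
    _ = ENNReal.ofReal (C * lam.re ^ ((L.length : ℝ) + ((d : ℝ) - 1) / 2)) * ENNReal.ofReal J :=
        ENNReal.ofReal_mul (by positivity)
    _ ≤ _ := by
        rw [← ENNReal.ofReal_pow (by positivity)]
        exact mul_le_mul' (ENNReal.ofReal_le_ofReal hpow) hI

end
end

section
/- Let d ≥ 1 and δ ∈ (0,1). There exist constants c_δ > 0 and C > 0 (depending only on d and δ) such that for every λ ∈ ℂ with Re λ ≥ c_δ, the number of lattice points ξ ∈ ℤ^d satisfying ||ξ|² − λ| ≤ |ξ|^{1+δ} is at most C (Re λ)^{(d−1+δ)/2}. -/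
open MeasureTheory Metric Complex Finset ENNReal NNReal

noncomputable section

variable {d : ℕ}

lemma aux_int_card (T : Finset ℤ) (L : ℕ) (h : ∀ a ∈ T, ∀ b ∈ T, a - b ≤ L) :
    T.card ≤ L + 1 := by
  rcases T.eq_empty_or_nonempty with rfl | hT
  · simp
  · have hsub : T ⊆ Finset.Icc (T.min' hT) (T.min' hT + L) := by
      intro a ha
      rw [Finset.mem_Icc]
      have h1 := h a ha _ (T.min'_mem hT)
      exact ⟨T.min'_le a ha, by linarith⟩
    have := Finset.card_le_card hsub
    rw [Int.card_Icc] at this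
    omega

lemma aux_count (d : ℕ) (S : Finset (Fin d → ℤ)) (j : Fin d) (N L : ℕ)
    (hN : ∀ ξ ∈ S, ∀ i, |ξ i| ≤ N)
    (hL : ∀ ξ ∈ S, ∀ η ∈ S, (∀ i, i ≠ j → ξ i = η i) → (0 ≤ ξ j ↔ 0 ≤ η j) →
      ξ j - η j ≤ L) :
    S.card ≤ (L + 1) * ((2 * N + 1) ^ (d - 1) * 2) := by
  classical
  let f : (Fin d → ℤ) → (Fin d → ℤ) × Bool :=
    fun ξ => (Function.update ξ j 0, decide (0 ≤ ξ j))
  have hf : ∀ ξ η, f ξ = f η → (∀ i, i ≠ j → ξ i = η i) ∧ (0 ≤ ξ j ↔ 0 ≤ η j) := by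
    intro ξ η h
    simp only [f, Prod.mk.injEq, decide_eq_decide] at h
    refine ⟨fun i hi => ?_, h.2⟩
    have := congrFun h.1 i
    simpa [Function.update_of_ne hi] using this
  have h1 : S.card ≤ (L + 1) * (S.image f).card := by
    apply Finset.card_le_mul_card_image
    intro a _
    have hinj : Set.InjOn (fun ξ : Fin d → ℤ => ξ j) (S.filter (fun x => f x = a)) := by
      intro ξ hξ η hη hj
      simp only [Finset.coe_filter, Set.mem_ofPred_eq] at hξ hη
      have := hf ξ η (hξ.2.trans hη.2.symm)
      funext i
      by_cases hi : i = j
      · subst hi; exact hj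
      · exact this.1 i hi
    rw [← Finset.card_image_of_injOn hinj]
    apply aux_int_card
    intro x hx y hy
    simp only [Finset.mem_image, Finset.mem_filter] at hx hy
    obtain ⟨ξ, ⟨hξ, hξa⟩, rfl⟩ := hx
    obtain ⟨η, ⟨hη, hηa⟩, rfl⟩ := hy
    have := hf ξ η (hξa.trans hηa.symm)
    exact hL ξ hξ η hη this.1 this.2
  have h2 : (S.image f).card ≤ (2 * N + 1) ^ (d - 1) * 2 := by
    have hsub : S.image f ⊆
        (Fintype.piFinset (fun i : Fin d => if i = j then ({0} : Finset ℤ)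
          else Finset.Icc (-(N : ℤ)) N)) ×ˢ (Finset.univ : Finset Bool) := by
      intro a ha
      obtain ⟨ξ, hξ, rfl⟩ := Finset.mem_image.1 ha
      simp only [f, Finset.mem_product, Fintype.mem_piFinset, Finset.mem_univ, and_true]
      intro i
      by_cases hi : i = j
      · subst hi; simp
      · simp only [Function.update_of_ne hi, if_neg hi, Finset.mem_Icc]
        exact abs_le.1 (hN ξ hξ i)
    refine (Finset.card_le_card hsub).trans ?_
    rw [Finset.card_product, Fintype.card_piFinset]
    have h3 : ∀ i : Fin d, (if i = j then ({0} : Finset ℤ)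
          else Finset.Icc (-(N : ℤ)) N).card = if i = j then 1 else 2 * N + 1 := by
      intro i
      split_ifs
      · simp
      · rw [Int.card_Icc]; omega
    simp_rw [h3]
    rw [← Finset.mul_prod_erase _ _ (Finset.mem_univ j), if_pos rfl, one_mul,
      Finset.prod_congr rfl (g := fun _ => 2 * N + 1)
        (fun i hi => if_neg (Finset.ne_of_mem_erase hi))]
    simp
  exact h1.trans (Nat.mul_le_mul_left _ h2)

lemma aux_diff (a b r D A : ℝ) (hr : 0 < r) (hD : 0 < D) (hA : 0 ≤ A)
    (ha : r / (2 * D) ≤ |a|) (hb : r / (2 * D) ≤ |b|) (hs : 0 ≤ a ↔ 0 ≤ b)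
    (h : |a ^ 2 - b ^ 2| ≤ 8 * r * A) : a - b ≤ 8 * D * A := by
  rcases le_total a b with hab | hab
  · have : 0 ≤ 8 * D * A := by positivity
    linarith
  · have h1 : (a - b) * (|a| + |b|) ≤ 8 * r * A := by
      by_cases h0 : 0 ≤ a
      · have h0b := hs.1 h0
        rw [abs_of_nonneg h0, abs_of_nonneg h0b]
        have := (abs_le.1 h).2
        nlinarith
      · have h0b : ¬ 0 ≤ b := fun hb => h0 (hs.2 hb)
        push Not at h0 h0b
        rw [abs_of_neg h0, abs_of_neg h0b]
        have := (abs_le.1 h).1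
        nlinarith
    have h2 : (a - b) * (r / D) ≤ 8 * r * A := by
      refine le_trans (mul_le_mul_of_nonneg_left ?_ (by linarith)) h1
      have : r / D = r / (2 * D) + r / (2 * D) := by field_simp; norm_num
      linarith
    have h3 : (a - b) * r ≤ (8 * D * A) * r := by
      have := mul_le_mul_of_nonneg_right h2 hD.le
      have e : (a - b) * (r / D) * D = (a - b) * r := by field_simp
      rw [e] at this
      linarith
    exact le_of_mul_le_mul_right h3 hr

lemma aux_shell (n r δ : ℝ) (hδ0 : 0 < δ) (hδ1 : δ < 1) (hn : 0 ≤ n) (hr : 1 ≤ r)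
    (h8 : 8 ≤ r ^ (1 - δ)) (h : |n ^ 2 - r ^ 2| ≤ n ^ (1 + δ)) :
    n ≤ 2 * r ∧ |n ^ 2 - r ^ 2| ≤ 4 * r * r ^ δ ∧ r ^ 2 / 2 ≤ n ^ 2 := by
  have hr0 : 0 < r := by linarith
  have h1 : n ≤ 2 * r := by
    by_contra hc
    push Not at hc
    have hn0 : 0 < n := by linarith
    have h2 : 8 ≤ n ^ (1 - δ) :=
      h8.trans (Real.rpow_le_rpow hr0.le (by linarith) (by linarith))
    have h3 : n ^ (1 + δ) * n ^ (1 - δ) = n ^ 2 := by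
      rw [← Real.rpow_add hn0, ← Real.rpow_natCast]; norm_num
    have h4 : 0 < n ^ (1 + δ) := by positivity
    have h5 := (abs_le.1 h).2
    nlinarith
  have h2 : n ^ (1 + δ) ≤ 4 * r * r ^ δ := by
    calc n ^ (1 + δ) ≤ (2 * r) ^ (1 + δ) := Real.rpow_le_rpow hn h1 (by linarith)
      _ = 2 ^ (1 + δ) * (r * r ^ δ) := by
        rw [Real.mul_rpow (by norm_num) hr0.le, Real.rpow_add hr0, Real.rpow_one]
      _ ≤ 4 * (r * r ^ δ) := by
        gcongr
        calc (2 : ℝ) ^ (1 + δ) ≤ 2 ^ (2 : ℝ) :=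
              Real.rpow_le_rpow_of_exponent_le (by norm_num) (by linarith)
          _ = 4 := by norm_num
      _ = _ := by ring
  refine ⟨h1, h.trans h2, ?_⟩
  have h3 : r ^ (1 - δ) * r ^ δ = r := by
    rw [← Real.rpow_add hr0]; norm_num
  have h4 : 0 < r ^ δ := by positivity
  have h5 : 8 * r ^ δ ≤ r := by nlinarith
  have h6 := (abs_le.1 (h.trans h2)).1
  nlinarith

/-- for `d ≥ 1` and `δ ∈ (0,1)` there are `c_δ, C > 0` such that for
every `λ ∈ ℂ` with `Re λ ≥ c_δ`, the set of lattice points `ξ ∈ ℤ^d` with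
`||ξ|² − λ| ≤ |ξ|^{1+δ}` is finite of cardinality at most `C (Re λ)^{(d−1+δ)/2}`. -/
theorem statement8
    (d : ℕ) (hd : 1 ≤ d) (δ : ℝ) (hδ : δ ∈ Set.Ioo (0 : ℝ) 1) :
    ∃ c : ℝ, 0 < c ∧ ∃ C : ℝ, 0 < C ∧ ∀ lam : ℂ, c ≤ lam.re →
      {ξ : Fin d → ℤ | ‖((znorm ξ ^ 2 : ℝ) : ℂ) - lam‖ ≤ znorm ξ ^ (1 + δ)}.Finite ∧
      (Nat.card {ξ : Fin d → ℤ | ‖((znorm ξ ^ 2 : ℝ) : ℂ) - lam‖ ≤ znorm ξ ^ (1 + δ)} : ℝ)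
        ≤ C * lam.re ^ (((d : ℝ) - 1 + δ) / 2) := by
  classical
  obtain ⟨hδ0, hδ1⟩ := hδ
  have hd0 : (1 : ℝ) ≤ d := by exact_mod_cast hd
  refine ⟨(8 ^ (1 / (1 - δ))) ^ 2, by positivity, d * ((9 * d) * (5 ^ (d - 1) * 2)),
    by positivity, ?_⟩
  intro lam hlam
  set r := Real.sqrt lam.re with hrdef
  have hc1 : (1 : ℝ) ≤ 8 ^ (1 / (1 - δ)) :=
    Real.one_le_rpow (by norm_num) (by apply div_nonneg <;> linarith)
  have hRpos : 0 < lam.re := lt_of_lt_of_le (by positivity) hlam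
  have hr2 : r ^ 2 = lam.re := Real.sq_sqrt hRpos.le
  have hcr : (8 : ℝ) ^ (1 / (1 - δ)) ≤ r := Real.le_sqrt_of_sq_le hlam
  have hr1 : 1 ≤ r := hc1.trans hcr
  have hr0 : 0 < r := by linarith
  have h8 : 8 ≤ r ^ (1 - δ) := by
    calc (8 : ℝ) = (8 ^ (1 / (1 - δ))) ^ (1 - δ) := by
          rw [← Real.rpow_mul (by norm_num), one_div_mul_cancel (by linarith), Real.rpow_one]
      _ ≤ _ := Real.rpow_le_rpow (by positivity) hcr (by linarith)
  set A := r ^ δ with hA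
  have hA1 : 1 ≤ A := Real.one_le_rpow hr1 hδ0.le
  set X := {ξ : Fin d → ℤ | ‖((znorm ξ ^ 2 : ℝ) : ℂ) - lam‖ ≤ znorm ξ ^ (1 + δ)} with hX
  have hsq : ∀ ξ : Fin d → ℤ, znorm ξ ^ 2 = ∑ j, ((ξ j : ℝ)) ^ 2 := fun ξ =>
    Real.sq_sqrt (Finset.sum_nonneg fun _ _ => sq_nonneg _)
  have hn0 : ∀ ξ : Fin d → ℤ, 0 ≤ znorm ξ := fun ξ => Real.sqrt_nonneg _
  have key : ∀ ξ ∈ X, znorm ξ ≤ 2 * r ∧ |znorm ξ ^ 2 - r ^ 2| ≤ 4 * r * A ∧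
      r ^ 2 / 2 ≤ znorm ξ ^ 2 := by
    intro ξ hξ
    refine aux_shell _ r δ hδ0 hδ1 (hn0 ξ) hr1 h8 (le_trans ?_ hξ)
    have := Complex.abs_re_le_norm (((znorm ξ ^ 2 : ℝ) : ℂ) - lam)
    rw [Complex.sub_re, Complex.ofReal_re] at this
    rwa [hr2]
  set N := ⌊2 * r⌋₊ with hNdef
  have hbd : ∀ ξ ∈ X, ∀ i, |ξ i| ≤ (N : ℤ) := by
    intro ξ hξ i
    have h1 : |(ξ i : ℝ)| ≤ 2 * r := by
      refine le_trans ?_ (key ξ hξ).1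
      apply Real.le_sqrt_of_sq_le
      rw [sq_abs]
      exact Finset.single_le_sum (f := fun j => ((ξ j : ℝ)) ^ 2)
        (fun _ _ => sq_nonneg _) (Finset.mem_univ i)
    have h2 : (((ξ i).natAbs : ℕ) : ℝ) ≤ 2 * r := by
      rw [Nat.cast_natAbs, Int.cast_abs]; exact h1
    have h3 := Nat.le_floor h2
    rw [Int.abs_eq_natAbs]
    exact_mod_cast h3
  have hfin : X.Finite := by
    refine (Set.Finite.pi' (fun _ : Fin d => Set.finite_Icc (-(N : ℤ)) N)).subset ?_
    intro ξ hξ i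
    exact abs_le.1 (hbd ξ hξ i)
  refine ⟨hfin, ?_⟩
  set S := hfin.toFinset with hS
  have hcard : Nat.card X = S.card := Nat.card_eq_card_finite_toFinset hfin
  rw [hcard]
  set L := ⌊8 * d * A⌋₊ with hLdef
  let Sj : Fin d → Finset (Fin d → ℤ) := fun j => S.filter (fun ξ => r / (2 * d) ≤ |(ξ j : ℝ)|)
  have hcov : S ⊆ Finset.univ.biUnion Sj := by
    intro ξ hξ
    have hξX : ξ ∈ X := hfin.mem_toFinset.1 hξ
    have h1 := (key ξ hξX).2.2
    rw [hsq] at h1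
    simp only [Finset.mem_biUnion, Finset.mem_univ, true_and, Sj, Finset.mem_filter]
    by_contra hcon
    push Not at hcon
    have h2 : ∀ j, ((ξ j : ℝ)) ^ 2 ≤ (r / (2 * d)) ^ 2 := by
      intro j
      rw [← sq_abs (ξ j : ℝ)]
      have := hcon j hξ
      gcongr
    have h3 : ∑ j, ((ξ j : ℝ)) ^ 2 ≤ d * (r / (2 * d)) ^ 2 := by
      refine (Finset.sum_le_sum fun j _ => h2 j).trans ?_
      simp
    have h4 : d * (r / (2 * d)) ^ 2 = r ^ 2 / (4 * d) := by field_simp; norm_num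
    have h5 : r ^ 2 / (4 * d) ≤ r ^ 2 / 4 := by
      gcongr
      linarith
    nlinarith
  have hSj : ∀ j, (Sj j).card ≤ (L + 1) * ((2 * N + 1) ^ (d - 1) * 2) := by
    intro j
    apply aux_count d (Sj j) j N L
    · intro ξ hξ
      exact hbd ξ (hfin.mem_toFinset.1 (Finset.mem_filter.1 hξ).1)
    · intro ξ hξ η hη hne hsgn
      obtain ⟨hξS, hξj⟩ := Finset.mem_filter.1 hξ
      obtain ⟨hηS, hηj⟩ := Finset.mem_filter.1 hη
      have k1 := (key ξ (hfin.mem_toFinset.1 hξS)).2.1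
      have k2 := (key η (hfin.mem_toFinset.1 hηS)).2.1
      have e : znorm ξ ^ 2 - znorm η ^ 2 = (ξ j : ℝ) ^ 2 - (η j : ℝ) ^ 2 := by
        rw [hsq, hsq, ← Finset.add_sum_erase _ _ (Finset.mem_univ j),
          ← Finset.add_sum_erase _ (fun j => (η j : ℝ) ^ 2) (Finset.mem_univ j),
          Finset.sum_congr rfl (fun i hi => by rw [hne i (Finset.ne_of_mem_erase hi)])]
        ring
      have hdiff : (ξ j : ℝ) - η j ≤ 8 * d * A := by
        refine aux_diff _ _ r d A hr0 (by linarith) (by linarith) hξj hηj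
          (by exact_mod_cast hsgn) ?_
        rw [← e]
        rw [abs_le] at *
        constructor <;> linarith [k1.1, k1.2, k2.1, k2.2]
      have h2 : ((ξ j - η j : ℤ) : ℝ) ≤ 8 * d * A := by push_cast; exact hdiff
      rw [hLdef, Int.natCast_floor_eq_floor (by positivity)]
      exact Int.le_floor.2 h2
  have hT : S.card ≤ d * ((L + 1) * ((2 * N + 1) ^ (d - 1) * 2)) := by
    refine (Finset.card_le_card hcov).trans ?_
    refine (Finset.card_biUnion_le_card_mul _ _ _ (fun j _ => hSj j)).trans ?_
    simp
  have hTr : (S.card : ℝ) ≤ d * (((L : ℝ) + 1) * ((2 * (N : ℝ) + 1) ^ (d - 1) * 2)) := by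
    exact_mod_cast hT
  have hLr : (L : ℝ) + 1 ≤ 9 * d * A := by
    have : (L : ℝ) ≤ 8 * d * A := Nat.floor_le (by positivity)
    nlinarith
  have hNr : 2 * (N : ℝ) + 1 ≤ 5 * r := by
    have : (N : ℝ) ≤ 2 * r := Nat.floor_le (by positivity)
    linarith
  have hpow : lam.re ^ (((d : ℝ) - 1 + δ) / 2) = r ^ (d - 1) * A := by
    rw [← hr2, ← Real.rpow_natCast, ← Real.rpow_mul hr0.le, hA, ← Real.rpow_natCast,
      ← Real.rpow_add hr0, Nat.cast_sub hd]
    congr 1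
    push_cast
    ring
  rw [hpow]
  calc (S.card : ℝ) ≤ d * (((L : ℝ) + 1) * ((2 * (N : ℝ) + 1) ^ (d - 1) * 2)) := hTr
    _ ≤ d * ((9 * d * A) * ((5 * r) ^ (d - 1) * 2)) := by gcongr
    _ = _ := by rw [mul_pow]; ring

end
end
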